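/- Let d ≥ 2 and fix λ with 0 < λ ≤ (d−1)/2; construct h_{λ,ℓ} with this λ. Then for every 1 < r < ∞ there exist ε(r) > 0 and C such that for every integer s ≥ 0, every finite collection 𝔔 ⊆ 𝔇_{≥0} of pairwise disjoint dyadic cubes and every family F = {F_Q}_{Q∈𝔔} of L¹(ℝ^d) functions: ‖𝒜_{s,𝔔} F‖_{L^r(ℝ^d)} ≤ C · 2^{s(d − ε(r))} · μ(𝔔)^{1/r} · ‖F‖_{ℓ^∞(L¹)}. -/

import Mathlib

open MeasureTheory Filter
open scoped ENNReal NNReal RealInnerProductSpace BigOperators Topology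

noncomputable section

/-- `ℝ^d` as a Euclidean space. -/
abbrev Euc (d : ℕ) : Type := EuclideanSpace ℝ (Fin d)

/-- The geometric setup: `Ω` is a bounded open convex subset of `ℝ^d` containing the origin,
`ρ` is its Minkowski functional, which is assumed to be smooth away from the origin and
positive away from the origin. -/
structure IsMinkowskiGauge (d : ℕ) (Ω : Set (Euc d)) (ρ : Euc d → ℝ) : Prop where
  isOpen : IsOpen Ω
  convex : Convex ℝ Ω
  isBounded : Bornology.IsBounded Ω
  zero_mem : (0 : Euc d) ∈ Ω
  eq_gauge : ρ = gauge Ω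
  smooth : ContDiffOn ℝ (⊤ : ℕ∞) ρ {(0 : Euc d)}ᶜ
  pos : ∀ ξ : Euc d, ξ ≠ 0 → 0 < ρ ξ

/-- Everywhere nonvanishing Gaussian curvature of `∂Ω = {ρ = 1}`: for every `ξ ≠ 0`
the Hessian of `ρ` at `ξ` has rank `d - 1`. -/
def HasNonvanishingCurvature (d : ℕ) (ρ : Euc d → ℝ) : Prop :=
  ∀ ξ : Euc d, ξ ≠ 0 →
    LinearMap.rank ((fderiv ℝ (fderiv ℝ ρ) ξ : Euc d →L[ℝ] (Euc d →L[ℝ] ℝ)) :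
      Euc d →ₗ[ℝ] (Euc d →L[ℝ] ℝ)) = (d - 1 : ℕ)

/-- The Fourier transform `f̂(ξ) = ∫ f(y) e^{−i⟨y,ξ⟩} dy` on `ℝ^d`. -/
def FTd {d : ℕ} (f : Euc d → ℂ) (ξ : Euc d) : ℂ :=
  ∫ y : Euc d, f y * Complex.exp (-(Complex.I * (⟪y, ξ⟫ : ℂ)))

/-- The Riesz mean `R^λ_{a,t} f(x) = (2π)^{-d} ∫ (1 - ρ(ξ)^a/t^a)_+^λ f̂(ξ) e^{i⟨x,ξ⟩} dξ`. -/
def RieszMean {d : ℕ} (ρ : Euc d → ℝ) (a lam t : ℝ) (f : Euc d → ℂ) (x : Euc d) : ℂ :=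
  (((2 * Real.pi) ^ d)⁻¹ : ℝ) •
    ∫ ξ : Euc d, ((max (1 - ρ ξ ^ a / t ^ a) 0) ^ lam : ℝ) •
      (FTd f ξ * Complex.exp (Complex.I * (⟪x, ξ⟫ : ℂ)))

/-- The critical index `λ(p) = d(1/p - 1/2) - 1/2`. -/
def criticalIndex (d : ℕ) (p : ℝ) : ℝ := (d : ℝ) * (1 / p - 1 / 2) - 1 / 2

/-- One-dimensional Fourier transform `φ̂(ϱ) = ∫ φ(s) e^{-isϱ} ds`. -/
def FT1 (φ : ℝ → ℂ) (ϱ : ℝ) : ℂ :=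
  ∫ s : ℝ, φ s * Complex.exp (-(Complex.I * (s : ℂ) * (ϱ : ℂ)))

/-- One-dimensional Fourier transform of a real-valued function. -/
def FT1R (Φ : ℝ → ℝ) : ℝ → ℂ := FT1 (fun s => (Φ s : ℂ))

/-- The pieces `h_{λ,ℓ}` of the decomposition of the Riesz multiplier. -/
def hfun (χ Φ Ψ : ℝ → ℝ) (lam : ℝ) : ℕ → ℝ → ℂ
  | 0 => fun ϱ => ((2 * Real.pi)⁻¹ * χ ϱ : ℝ) •
      ∫ u : ℝ, ((max (1 - u) 0) ^ lam : ℝ) • FT1R Φ (ϱ - u)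
  | (ℓ + 1) => fun ϱ => ((2 * Real.pi)⁻¹ * χ ϱ : ℝ) •
      ∫ u : ℝ, ((max (1 - u) 0) ^ lam : ℝ) •
        (((2 : ℝ) ^ ℓ) • FT1R Ψ ((2 : ℝ) ^ ℓ * (ϱ - u)))

/-- The data entering the construction of `h_{λ,ℓ}`: a cutoff `χ ∈ C_c^∞((1/2,2))`, an even
`Φ = Φ∘ ∈ C_c^∞(ℝ)` with `Φ∘ = 1` on `[-1/2,1/2]`, `supp Φ∘ ⊆ [-1,1]`, satisfying the moment
cancellation conditions, and `Ψ(x) = Φ∘(x/2) - Φ∘(x)`. -/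
structure HData (lam : ℝ) (N0 : ℕ) (χ Φ Ψ : ℝ → ℝ) : Prop where
  hχsm : ContDiff ℝ (⊤ : ℕ∞) χ
  hχsupp : Function.support χ ⊆ Set.Ioo (1/2 : ℝ) 2
  hΦsm : ContDiff ℝ (⊤ : ℕ∞) Φ
  hΦeven : ∀ s, Φ (-s) = Φ s
  hΦone : ∀ s : ℝ, |s| ≤ 1/2 → Φ s = 1
  hΦzero : ∀ s : ℝ, 1 ≤ |s| → Φ s = 0
  hΦcanc : ∀ j : ℕ, j ≤ N0 → (j : ℝ) ≠ lam →
    (∫ ϱ in Set.Ioi (0 : ℝ), ((ϱ ^ lam : ℝ) : ℂ) * iteratedDeriv j (FT1R Φ) ϱ) = 0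
  hΨ : Ψ = fun x => Φ (x / 2) - Φ x

/-- Inverse Fourier transform on `ℝ^d`. -/
def invFTd {d : ℕ} (m : Euc d → ℂ) (x : Euc d) : ℂ :=
  (((2 * Real.pi) ^ d)⁻¹ : ℝ) •
    ∫ ξ : Euc d, m ξ * Complex.exp (Complex.I * (⟪x, ξ⟫ : ℂ))

/-- The Fourier multiplier operator `m(D) f = (𝓕⁻¹ m) * f`. -/
def mulOp {d : ℕ} (m : Euc d → ℂ) (f : Euc d → ℂ) (x : Euc d) : ℂ :=
  ∫ y : Euc d, invFTd m (x - y) * f y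

/-- The Hardy–Littlewood maximal function. -/
def HLMaximal {d : ℕ} (w : Euc d → ℝ) (x : Euc d) : ℝ≥0∞ :=
  ⨆ r : {r : ℝ // 0 < r},
    (volume (Metric.ball x r.1))⁻¹ * ∫⁻ y in Metric.ball x r.1, ENNReal.ofReal (w y)

/-- `w` is an `A₁` weight. -/
structure IsA1Weight {d : ℕ} (w : Euc d → ℝ) : Prop where
  nonneg : ∀ x, 0 ≤ w x
  locInt : LocallyIntegrable w volume
  ne_zero : ¬ (w =ᵐ[(volume : Measure (Euc d))] (0 : Euc d → ℝ))
  maximal_le : ∃ C : ℝ, ∀ᵐ x ∂(volume : Measure (Euc d)),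
    HLMaximal w x ≤ ENNReal.ofReal (C * w x)

/-- `w` satisfies a reverse Hölder inequality with exponent `σ`. -/
def IsRH {d : ℕ} (σ : ℝ) (w : Euc d → ℝ) : Prop :=
  ∃ C : ℝ, ∀ (x : Euc d) (r : ℝ), 0 < r →
    ((volume (Metric.ball x r))⁻¹ *
        ∫⁻ y in Metric.ball x r, ENNReal.ofReal (w y) ^ σ) ^ (1 / σ) ≤
      ENNReal.ofReal C *
        ((volume (Metric.ball x r))⁻¹ * ∫⁻ y in Metric.ball x r, ENNReal.ofReal (w y))

/-- The weighted `L^p(w)` (quasi-)norm. -/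
def wLpNorm {d : ℕ} (p : ℝ) (w : Euc d → ℝ) (g : Euc d → ℂ) : ℝ≥0∞ :=
  (∫⁻ x, (‖g x‖₊ : ℝ≥0∞) ^ p * ENNReal.ofReal (w x)) ^ (1 / p)

/-- The weighted weak `L^{p,∞}(w)` (quasi-)norm. -/
def wWeakNorm {d : ℕ} (p : ℝ) (w : Euc d → ℝ) (g : Euc d → ℂ) : ℝ≥0∞ :=
  ⨆ α : {α : ℝ // 0 < α},
    ENNReal.ofReal α.1 *
      (∫⁻ x in {x : Euc d | α.1 < ‖g x‖}, ENNReal.ofReal (w x)) ^ (1 / p)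

/-- A (half-open, axes-parallel) cube `x + [0,s)^d` in `ℝ^d`. -/
def IsCube {d : ℕ} (Q : Set (Euc d)) : Prop :=
  ∃ (x : Euc d) (s : ℝ), 0 < s ∧ Q = {y : Euc d | ∀ i, y i ∈ Set.Ico (x i) (x i + s)}

/-- The average `⟨f⟩_{Q,p} = (|Q|⁻¹ ∫_Q |f|^p)^{1/p}`. -/
def cubeAvg {d : ℕ} (p : ℝ) (Q : Set (Euc d)) (f : Euc d → ℂ) : ℝ≥0∞ :=
  ((volume Q)⁻¹ * ∫⁻ x in Q, (‖f x‖₊ : ℝ≥0∞) ^ p) ^ (1 / p)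

/-- A `γ`-sparse (finite) family of cubes. -/
def IsSparseFamily {d : ℕ} (γ : ℝ) (𝔖 : Finset (Set (Euc d))) : Prop :=
  (∀ Q ∈ 𝔖, IsCube Q) ∧
  ∃ E : Set (Euc d) → Set (Euc d),
    (∀ Q ∈ 𝔖, MeasurableSet (E Q) ∧ E Q ⊆ Q ∧
      ENNReal.ofReal γ * volume Q ≤ volume (E Q)) ∧
    (𝔖 : Set (Set (Euc d))).Pairwise fun Q Q' => Disjoint (E Q) (E Q')

/-- The maximal sparse form `Λ*_{p,q}(f₁,f₂)` (supremum over `1/2`-sparse families). -/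
def sparseFormMax {d : ℕ} (p q : ℝ) (f₁ f₂ : Euc d → ℂ) : ℝ≥0∞ :=
  ⨆ 𝔖 : {𝔖 : Finset (Set (Euc d)) // IsSparseFamily (1/2) 𝔖},
    ∑ Q ∈ 𝔖.1, volume Q * cubeAvg p Q f₁ * cubeAvg q Q f₂

/-- The sparse bound `T ∈ Sp(p,q)`. -/
def SparseBound {d : ℕ} (p q : ℝ) (T : (Euc d → ℂ) → Euc d → ℂ) : Prop :=
  ∃ C : ℝ, ∀ f₁ f₂ : Euc d → ℂ,
    ContDiff ℝ (⊤ : ℕ∞) f₁ → HasCompactSupport f₁ →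
    ContDiff ℝ (⊤ : ℕ∞) f₂ → HasCompactSupport f₂ →
    ENNReal.ofReal ‖∫ x, T f₁ x * f₂ x‖ ≤ ENNReal.ofReal C * sparseFormMax p q f₁ f₂

/-- The exponent `r_*(p, p∘, r∘)`. -/
def rStar (d : ℕ) (p p0 r0 : ℝ) : ℝ :=
  if p ≤ 2 * ((d : ℝ) + 1) / ((d : ℝ) + 3) then
    (((d : ℝ) + 1) / ((d : ℝ) - 1) * (1 - 1 / p))⁻¹
  else
    ((1 / r0 * (((d : ℝ) + 3) / (2 * ((d : ℝ) + 1)) - 1 / p) +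
        1 / 2 * (1 / p - 1 / p0)) /
      (((d : ℝ) + 3) / (2 * ((d : ℝ) + 1)) - 1 / p0))⁻¹

/-- The exponent `q_*(p, p∘, r∘)`, the conjugate of `r_*(p, p∘, r∘)`. -/
def qStar (d : ℕ) (p p0 r0 : ℝ) : ℝ := (1 - 1 / rStar d p p0 r0)⁻¹

/-- The trapezoid `∏_d(λ)` with corners `P₁, P₂, P₃, P₄`. -/
def trapez (d : ℕ) (lam : ℝ) : Set (ℝ × ℝ) :=
  convexHull ℝ
    {((2*lam + (d:ℝ) + 1)/(2*(d:ℝ)), ((d:ℝ) - 2*lam - 1)/(2*(d:ℝ))),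
     ((2*lam + (d:ℝ) + 1)/(2*(d:ℝ)),
       ((d:ℝ) - 1)/(2*(d:ℝ)) + lam*((d:ℝ) + 1)/((d:ℝ)*((d:ℝ) - 1))),
     (((d:ℝ) - 1)/(2*(d:ℝ)) + lam*((d:ℝ) + 1)/((d:ℝ)*((d:ℝ) - 1)),
       (2*lam + (d:ℝ) + 1)/(2*(d:ℝ))),
     (((d:ℝ) - 2*lam - 1)/(2*(d:ℝ)), (2*lam + (d:ℝ) + 1)/(2*(d:ℝ)))}

/-- A dyadic cube `2^k(m + [0,1)^d)`, recorded by its generation `k` and position `m`. -/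
structure DyadicCube (d : ℕ) where
  k : ℤ
  m : Fin d → ℤ
deriving DecidableEq

/-- The subset of `ℝ^d` corresponding to a dyadic cube. -/
def DyadicCube.set {d : ℕ} (Q : DyadicCube d) : Set (Euc d) :=
  {x : Euc d | ∀ i, x i ∈ Set.Ico ((2:ℝ) ^ Q.k * (Q.m i : ℝ)) ((2:ℝ) ^ Q.k * ((Q.m i : ℝ) + 1))}

/-- `μ(𝔔) = Σ_{Q ∈ 𝔔} |Q|`. -/
def dyadicMeasure {d : ℕ} (𝔔 : Finset (DyadicCube d)) : ℝ≥0∞ :=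
  ∑ Q ∈ 𝔔, volume Q.set

/-- The class `𝒴_M` of normalized bump functions. -/
def MemYM (M : ℕ) (χ : ℝ → ℂ) : Prop :=
  ContDiff ℝ (M : ℕ∞) χ ∧ Function.support χ ⊆ Set.Ioo (1/2 : ℝ) 2 ∧
    ∑ ν ∈ Finset.range (M + 1), (⨆ s : ℝ, ‖iteratedDeriv ν χ s‖) ≤ 1

/-- The function `Σ_{j ≥ 1} 2^{j(d+1)/2} m_j(D)[Σ_{Q ∈ 𝔇_j} f_Q]` appearing in `VBR(p,r)`,
where `m_j(ξ) = χ_j(2^j(1 - ρ(ξ)))`. -/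
def vbrSum {d : ℕ} (ρ : Euc d → ℝ) (χ : ℕ → ℝ → ℂ) (𝔉 : Finset (DyadicCube d))
    (f : DyadicCube d → Euc d → ℂ) (x : Euc d) : ℂ :=
  Finset.sum ((𝔉.image (fun Q => Q.k)).filter (fun j => 1 ≤ j)) fun (j : ℤ) =>
    ((2:ℝ) ^ ((j : ℝ) * ((d : ℝ) + 1) / 2)) •
      mulOp (fun ξ => χ j.toNat ((2:ℝ) ^ j * (1 - ρ ξ)))
        (fun y => ∑ Q ∈ 𝔉.filter (fun Q' => Q'.k = j), f Q y) x

/-- The statement `VBR(p,r)`. -/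
def VBR (d : ℕ) (ρ : Euc d → ℝ) (p r : ℝ) : Prop :=
  ∃ (M : ℕ) (C : ℝ), 1 ≤ M ∧
    ∀ χ : ℕ → ℝ → ℂ, (∀ j : ℕ, 1 ≤ j → MemYM M (χ j)) →
    ∀ (𝔉 : Finset (DyadicCube d)) (f : DyadicCube d → Euc d → ℂ),
      (∀ Q ∈ 𝔉, Function.support (f Q) ⊆ closure Q.set) →
      eLpNorm (vbrSum ρ χ 𝔉 f) (ENNReal.ofReal r) volume ≤
        ENNReal.ofReal C *
          (∑ Q ∈ 𝔉, volume Q.set * eLpNorm (f Q) (ENNReal.ofReal p) volume ^ r) ^ (1 / r)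

/-- `Hyp(p∘, r∘)`: `VBR(p,r)` holds for all `p ∈ [2(d+1)/(d+3), p∘)`
and all `r ∈ [p, r_*(p,p∘,r∘))`. -/
def Hyp (d : ℕ) (ρ : Euc d → ℝ) (p0 r0 : ℝ) : Prop :=
  ∀ p r : ℝ, 2 * ((d : ℝ) + 1) / ((d : ℝ) + 3) ≤ p → p < p0 →
    p ≤ r → r < rStar d p p0 r0 → VBR d ρ p r

/-- The operator `A_{λ,ℓ} = 2^{ℓ(λ + (d+1)/2)} h_{λ,ℓ}(ρ(D))`. -/
def Aop {d : ℕ} (ρ : Euc d → ℝ) (h : ℕ → ℝ → ℂ) (lam : ℝ) (ℓ : ℕ)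
    (f : Euc d → ℂ) (x : Euc d) : ℂ :=
  ((2:ℝ) ^ ((ℓ : ℝ) * (lam + ((d : ℝ) + 1) / 2))) • mulOp (fun ξ => h ℓ (ρ ξ)) f x

/-- `𝒜_{s,𝔔} F = Σ_{ℓ ≥ s} Σ_{Q ∈ 𝔔_{ℓ-s}} A_{λ,ℓ}[F_Q 1_Q]`. -/
def AopSum {d : ℕ} (ρ : Euc d → ℝ) (h : ℕ → ℝ → ℂ) (lam : ℝ) (s : ℕ)
    (𝔔 : Finset (DyadicCube d)) (F : DyadicCube d → Euc d → ℂ) (x : Euc d) : ℂ :=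
  ∑ Q ∈ 𝔔, Aop ρ h lam (Q.k.toNat + s) (Q.set.indicator (F Q)) x

/-- `Ξ_{s,𝔔}[F,β] = Σ_{ℓ ≥ s} Σ_{Q ∈ 𝔔_{ℓ-s}} β(Q) A_{λ,ℓ}[F_Q 1_Q]`. -/
def XiSum {d : ℕ} (ρ : Euc d → ℝ) (h : ℕ → ℝ → ℂ) (lam : ℝ) (s : ℕ)
    (𝔔 : Finset (DyadicCube d)) (F : DyadicCube d → Euc d → ℂ)
    (β : DyadicCube d → ℂ) (x : Euc d) : ℂ :=
  ∑ Q ∈ 𝔔, β Q * Aop ρ h lam (Q.k.toNat + s) (Q.set.indicator (F Q)) x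

/-- `‖F‖_{ℓ^∞(L^p)} = sup_{Q ∈ 𝔔} ‖F_Q‖_{L^p}`. -/
def supLp {d : ℕ} (p : ℝ) (𝔔 : Finset (DyadicCube d))
    (F : DyadicCube d → Euc d → ℂ) : ℝ≥0∞ :=
  ⨆ Q ∈ 𝔔, eLpNorm (F Q) (ENNReal.ofReal p) volume

/-- `‖β‖_{ℓ^{r,1}(μ)} = ∫_0^∞ μ({Q ∈ 𝔔 : |β(Q)| > α})^{1/r} dα`. -/
def lorentzNorm {d : ℕ} (r : ℝ) (𝔔 : Finset (DyadicCube d))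
    (β : DyadicCube d → ℂ) : ℝ≥0∞ :=
  ∫⁻ α in Set.Ioi (0:ℝ),
    (∑ Q ∈ 𝔔, if α < ‖β Q‖ then volume Q.set else 0) ^ (1 / r)
section PartA

variable {E : Type*} [NormedAddCommGroup E] [NormedSpace ℝ E]
variable {F : Type*} [NormedAddCommGroup F] [NormedSpace ℝ F]

/-- All derivatives up to order `N` are bounded by `B`. -/
def BddD (N : ℕ) (B : ℝ) (f : E → F) : Prop :=
  ∀ i ≤ N, ∀ x, ‖iteratedFDeriv ℝ i f x‖ ≤ B

lemma BddD.mono {N N' : ℕ} {B B' : ℝ} {f : E → F} (h : BddD N B f) (hN : N' ≤ N) (hB : B ≤ B') :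
    BddD N' B' f := fun i hi x => (h i (hi.trans hN) x).trans hB

lemma BddD.nonneg {N : ℕ} {B : ℝ} {f : E → F} (h : BddD N B f) : 0 ≤ B :=
  (norm_nonneg _).trans (h 0 (Nat.zero_le _) 0)

lemma BddD.norm_le {N : ℕ} {B : ℝ} {f : E → F} (h : BddD N B f) (x : E) : ‖f x‖ ≤ B := by
  have := h 0 (Nat.zero_le _) x
  simpa using this

lemma BddD.mul {N : ℕ} {B B' : ℝ} {f g : E → ℝ} (hf : ContDiff ℝ (⊤ : ℕ∞) f)
    (hg : ContDiff ℝ (⊤ : ℕ∞) g) (h : BddD N B f) (h' : BddD N B' g) :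
    BddD N (2 ^ N * B * B') (fun x => f x * g x) := by
  intro i hi x
  have hB := h.nonneg
  have hB' := h'.nonneg
  refine (norm_iteratedFDeriv_mul_le hf hg x (n := i) (by exact_mod_cast le_top)).trans ?_
  calc _ ≤ ∑ j ∈ Finset.range (i + 1), (i.choose j : ℝ) * B * B' := by
        refine Finset.sum_le_sum fun j hj => ?_
        have hj' : j ≤ i := by simpa [Nat.lt_succ_iff] using hj
        gcongr
        · exact h j (by omega) x
        · exact h' (i - j) (by omega) x
    _ = 2 ^ i * B * B' := by
        rw [← Finset.sum_mul, ← Finset.sum_mul]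
        congr 2
        exact_mod_cast Nat.sum_range_choose i
    _ ≤ _ := by
        gcongr
        norm_num

lemma BddD.fderiv_apply {N : ℕ} {B : ℝ} {f : E → F} (hf : ContDiff ℝ (⊤ : ℕ∞) f)
    (h : BddD (N + 1) B f) {u : E} (hu : ‖u‖ ≤ 1) : BddD N B (fun x => fderiv ℝ f x u) := by
  intro i hi x
  have h1 : ContDiff ℝ (⊤ : ℕ∞) (fderiv ℝ f) := hf.fderiv_right (by simp)
  have := norm_iteratedFDeriv_clm_apply_const (𝕜 := ℝ) (f := fderiv ℝ f) (c := u) (x := x) (n := i)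
    (N := (⊤ : ℕ∞)) h1.contDiffAt (by exact_mod_cast le_top)
  refine this.trans ?_
  rw [norm_iteratedFDeriv_fderiv]
  calc _ ≤ 1 * B := by
        gcongr
        exact h (i + 1) (by omega) x
    _ = B := one_mul _

lemma BddD.comp_exists (N : ℕ) (B : ℝ) {ψ : ℝ → ℝ} (hψ : ContDiff ℝ (⊤ : ℕ∞) ψ) :
    ∃ B', ∀ f : E → ℝ, ContDiff ℝ (⊤ : ℕ∞) f → BddD N B f → BddD N B' (fun x => ψ (f x)) := by
  have h1 : ∀ i : ℕ, ∃ C : ℝ, 0 ≤ C ∧ ∀ t ∈ Set.Icc (-B) B, ‖iteratedFDeriv ℝ i ψ t‖ ≤ C := by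
    intro i
    have hc : Continuous (fun t => iteratedFDeriv ℝ i ψ t) :=
      hψ.continuous_iteratedFDeriv (by exact_mod_cast le_top)
    obtain ⟨C, hC⟩ := (isCompact_Icc (a := -B) (b := B)).exists_bound_of_continuousOn hc.continuousOn
    exact ⟨max C 0, le_max_right _ _, fun t ht => (hC t ht).trans (le_max_left _ _)⟩
  choose C hC0 hC using h1
  set CC := ∑ i ∈ Finset.range (N + 1), C i with hCC
  have hCC0 : 0 ≤ CC := Finset.sum_nonneg fun i _ => hC0 i
  set D := max 1 B
  have hD : 1 ≤ D := le_max_left _ _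
  refine ⟨N.factorial * CC * D ^ N, fun f hf hfB i hi x => ?_⟩
  have hx : f x ∈ Set.Icc (-B) B := abs_le.mp (by simpa using hfB.norm_le x)
  have := norm_iteratedFDeriv_comp_le (g := ψ) (f := f) (n := i) (N := (⊤ : ℕ∞)) hψ hf
    (by exact_mod_cast le_top) x (C := CC) (D := D) ?_ ?_
  · refine this.trans ?_
    gcongr
  · intro j hj
    refine (hC j _ hx).trans ?_
    exact Finset.single_le_sum (f := C) (fun i _ => hC0 i) (Finset.mem_range.2 (by omega))
  · intro j hj1 hj
    refine (hfB j (by omega) x).trans ((le_max_right 1 B).trans ?_)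
    exact le_self_pow₀ hD (by omega)

lemma BddD_of_compactSupport [FiniteDimensional ℝ E] (N : ℕ) {f : E → F}
    (hf : ContDiff ℝ (⊤ : ℕ∞) f)
    (hs : HasCompactSupport f) : ∃ B, 0 ≤ B ∧ BddD N B f := by
  have h1 : ∀ i : ℕ, ∃ C : ℝ, ∀ x, ‖iteratedFDeriv ℝ i f x‖ ≤ C := by
    intro i
    exact (hs.iteratedFDeriv i).exists_bound_of_continuous
      (hf.continuous_iteratedFDeriv (by exact_mod_cast le_top))
  choose C hC using h1
  have hC0 : ∀ i, 0 ≤ C i := fun i => (norm_nonneg _).trans (hC i 0)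
  refine ⟨∑ i ∈ Finset.range (N + 1), C i, Finset.sum_nonneg fun i _ => hC0 i, fun i hi x => ?_⟩
  exact (hC i x).trans (Finset.single_le_sum (f := C) (fun i _ => hC0 i)
    (Finset.mem_range.2 (by omega)))

/-- A globally smooth function agreeing with `1/s` for `s ≥ c`. -/
lemma exists_smooth_inv {c : ℝ} (hc : 0 < c) :
    ∃ ψ : ℝ → ℝ, ContDiff ℝ (⊤ : ℕ∞) ψ ∧ ∀ s, c ≤ s → ψ s * s = 1 := by
  refine ⟨fun s => Real.smoothTransition (2 * s / c - 1) * s⁻¹, ?_, ?_⟩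
  · rw [contDiff_iff_contDiffAt]
    intro s
    rcases lt_or_ge s (c / 2) with h | h
    · have : (fun s => Real.smoothTransition (2 * s / c - 1) * s⁻¹) =ᶠ[𝓝 s] fun _ => 0 := by
        filter_upwards [Iio_mem_nhds h] with t ht
        rw [Real.smoothTransition.zero_of_nonpos, zero_mul]
        have : t < c / 2 := ht
        rw [sub_nonpos, div_le_one hc]; linarith
      exact contDiffAt_const.congr_of_eventuallyEq this
    · have hs : s ≠ 0 := by linarith
      refine ContDiffAt.mul ?_ (contDiffAt_id.inv hs)
      exact (Real.smoothTransition.contDiff (n := (⊤:ℕ∞))).contDiffAt.comp s (by fun_prop)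
  · intro s hs
    have hs0 : s ≠ 0 := by linarith
    simp only
    rw [Real.smoothTransition.one_of_one_le, one_mul, inv_mul_cancel₀ hs0]
    rw [le_sub_iff_add_le, le_div_iff₀ hc]; linarith

end PartA

section PartA2
variable {E : Type*} [NormedAddCommGroup E] [InnerProductSpace ℝ E] [FiniteDimensional ℝ E]
  [MeasurableSpace E] [BorelSpace E]

/-- Oscillatory integral. -/
def osc (a : E → ℝ) (f : E → ℝ) : ℂ := ∫ x, (a x : ℂ) * Complex.exp (Complex.I * (f x : ℂ))

lemma norm_cexp_I_mul (t : ℝ) : ‖Complex.exp (Complex.I * (t : ℂ))‖ = 1 := by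
  rw [mul_comm]; exact Complex.norm_exp_ofReal_mul_I t

lemma osc_trivial {a f : E → ℝ} {B : ℝ} {V : ℝ} (hB : ∀ x, |a x| ≤ B) (_hs : HasCompactSupport a)
    (hV : volume (tsupport a) ≤ ENNReal.ofReal V) (hV0 : 0 ≤ V) (hB0 : 0 ≤ B) :
    ‖osc a f‖ ≤ B * V := by
  have h1 : osc a f = ∫ x in tsupport a, (a x : ℂ) * Complex.exp (Complex.I * (f x : ℂ)) := by
    rw [osc, setIntegral_eq_integral_of_forall_compl_eq_zero]
    intro x hx
    rw [image_eq_zero_of_notMem_tsupport hx]; simp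
  rw [h1]
  refine (norm_setIntegral_le_of_norm_le_const (C := B) (lt_of_le_of_lt hV (by simp)) ?_).trans ?_
  · intro x _
    rw [norm_mul, norm_cexp_I_mul, mul_one, Complex.norm_real]
    exact hB x
  · gcongr
    rw [Measure.real]
    exact ENNReal.toReal_le_of_le_ofReal hV0 hV

lemma osc_step {a f g : E → ℝ} {u : E} {μ : ℝ} (hμ : 0 < μ) (ha : ContDiff ℝ (⊤ : ℕ∞) a)
    (hf : ContDiff ℝ (⊤ : ℕ∞) f) (hg : ContDiff ℝ (⊤ : ℕ∞) g) (hs : HasCompactSupport a)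
    (hag : ∀ x ∈ tsupport a, g x * fderiv ℝ f x u = 1) :
    osc a (fun x => μ * f x) = Complex.I / μ *
      osc (fun x => fderiv ℝ (fun y => a y * g y) x u) (fun x => μ * f x) := by
  have hb : ContDiff ℝ (⊤ : ℕ∞) (fun y => a y * g y) := ha.mul hg
  have hbs : HasCompactSupport (fun y => a y * g y) := hs.mul_right
  set b : E → ℂ := fun y => ((a y * g y : ℝ) : ℂ) with hbdef
  have hbc : ContDiff ℝ (⊤ : ℕ∞) b := Complex.ofRealCLM.contDiff.comp hb
  have hbcs : HasCompactSupport b := hbs.comp_left (g := fun t : ℝ => (t : ℂ)) (by simp)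
  set e : E → ℂ := fun x => Complex.exp (Complex.I * ((μ * f x : ℝ) : ℂ)) with hedef
  have hmf : ContDiff ℝ (⊤ : ℕ∞) (fun x => ((μ * f x : ℝ) : ℂ)) :=
    Complex.ofRealCLM.contDiff.comp (contDiff_const.mul hf)
  have he : ContDiff ℝ (⊤ : ℕ∞) e := (contDiff_const.mul hmf).cexp
  have htop : ((⊤ : ℕ∞) : WithTop ℕ∞) ≠ 0 := by simp
  have hfd := hf.differentiable htop
  have hed : ∀ x, fderiv ℝ e x u = e x * (Complex.I * (μ * (fderiv ℝ f x u : ℝ) : ℂ)) := by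
    intro x
    have h1 : HasFDerivAt (fun x => Complex.I * ((μ * f x : ℝ) : ℂ))
        (Complex.I • (Complex.ofRealCLM.comp (μ • fderiv ℝ f x))) x := by
      have := (Complex.ofRealCLM.hasFDerivAt (x := μ * f x)).comp x
        ((hfd x).hasFDerivAt.const_mul μ)
      exact this.const_mul Complex.I
    have h2 := h1.cexp
    rw [h2.fderiv]
    simp [hedef]
  have hbd : ∀ x, fderiv ℝ b x u = ((fderiv ℝ (fun y => a y * g y) x u : ℝ) : ℂ) := by
    intro x
    have := (Complex.ofRealCLM.hasFDerivAt (x := a x * g x)).comp x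
        ((hb.differentiable htop) x).hasFDerivAt
    have h3 : HasFDerivAt b (Complex.ofRealCLM.comp (fderiv ℝ (fun y => a y * g y) x)) x := this
    rw [h3.fderiv]; simp
  have hce : Continuous e := he.continuous
  have hcb : Continuous b := hbc.continuous
  have hcbd : Continuous (fun x => fderiv ℝ b x u) :=
    (hbc.continuous_fderiv htop).clm_apply continuous_const
  have hced : Continuous (fun x => fderiv ℝ e x u) :=
    (he.continuous_fderiv htop).clm_apply continuous_const
  have key := integral_mul_fderiv_eq_neg_fderiv_mul_of_integrable (μ := (volume : Measure E))
    (f := b) (g := e) (v := u)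
    ((hcbd.mul hce).integrable_of_hasCompactSupport
      ((hbcs.fderiv_apply ℝ u).mul_right))
    ((hcb.mul hced).integrable_of_hasCompactSupport hbcs.mul_right)
    ((hcb.mul hce).integrable_of_hasCompactSupport hbcs.mul_right)
    (fun x _ => hbc.differentiable htop x) (fun x _ => he.differentiable htop x)
  have hL : ∫ x, b x * fderiv ℝ e x u = Complex.I * μ * osc a (fun x => μ * f x) := by
    rw [osc, ← integral_const_mul]
    congr 1; ext x
    by_cases hx : x ∈ tsupport a
    · have := hag x hx
      have h' : (g x : ℂ) * (fderiv ℝ f x u : ℝ) = 1 := by exact_mod_cast this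
      rw [hed]
      simp only [hbdef, hedef]
      push_cast
      linear_combination (Complex.I * μ * a x * Complex.exp (Complex.I * (μ * f x))) * h'
    · have : a x = 0 := image_eq_zero_of_notMem_tsupport hx
      simp [hbdef, this]
  have hR : ∫ x, fderiv ℝ b x u * e x =
      osc (fun x => fderiv ℝ (fun y => a y * g y) x u) (fun x => μ * f x) := by
    rw [osc]; congr 1; ext x; rw [hbd]
  rw [hL, hR] at key
  have hμ' : (μ : ℂ) ≠ 0 := by exact_mod_cast hμ.ne'
  field_simp
  linear_combination (-Complex.I) * key + (μ * osc a (fun x => μ * f x)) * Complex.I_sq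

/-- Uniform non-stationary phase estimate. -/
lemma osc_nonstat (N : ℕ) {c : ℝ} (hc : 0 < c) (B V : ℝ) :
    ∃ C : ℝ, 0 ≤ C ∧ ∀ (f a : E → ℝ) (u : E) (μ : ℝ), 0 < μ → ContDiff ℝ (⊤ : ℕ∞) f →
      ContDiff ℝ (⊤ : ℕ∞) a → HasCompactSupport a → ‖u‖ ≤ 1 → BddD N B a →
      BddD N B (fun x => fderiv ℝ f x u) → (∀ x ∈ tsupport a, c ≤ fderiv ℝ f x u) →
      volume (tsupport a) ≤ ENNReal.ofReal V →
      ‖osc a (fun x => μ * f x)‖ ≤ C / μ ^ N := by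
  obtain ⟨ψ, hψ, hψ1⟩ := exists_smooth_inv hc
  obtain ⟨B1, hB1⟩ := BddD.comp_exists (E := E) N B hψ
  have main : ∀ n ≤ N, ∀ B2 : ℝ, ∃ C : ℝ, 0 ≤ C ∧ ∀ (f a : E → ℝ) (u : E) (μ : ℝ), 0 < μ →
      ContDiff ℝ (⊤ : ℕ∞) f →
      ContDiff ℝ (⊤ : ℕ∞) a → HasCompactSupport a → ‖u‖ ≤ 1 → BddD n B2 a →
      BddD N B (fun x => fderiv ℝ f x u) → (∀ x ∈ tsupport a, c ≤ fderiv ℝ f x u) →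
      volume (tsupport a) ≤ ENNReal.ofReal V →
      ‖osc a (fun x => μ * f x)‖ ≤ C / μ ^ n := by
    intro n
    induction n with
    | zero =>
      intro _ B2
      refine ⟨|B2| * |V|, by positivity, ?_⟩
      intro f a u μ hμ hf ha hs hu hBa hBf hcf hV
      rw [pow_zero, div_one]
      refine osc_trivial (fun x => ?_) hs (hV.trans ?_) (abs_nonneg _) (abs_nonneg _)
      · exact (hBa.norm_le x).trans (le_abs_self _)
      · exact ENNReal.ofReal_le_ofReal (le_abs_self _)
    | succ n ih =>
      intro hn B2
      obtain ⟨C, hC0, hC⟩ := ih (by omega) (2 ^ (n + 1) * B2 * B1)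
      refine ⟨C, hC0, ?_⟩
      intro f a u μ hμ hf ha hs hu hBa hBf hcf hV
      have hfu : ContDiff ℝ (⊤ : ℕ∞) (fun x => fderiv ℝ f x u) :=
        (hf.fderiv_right (m := (⊤ : ℕ∞)) (by simp)).clm_apply contDiff_const
      have hg : ContDiff ℝ (⊤ : ℕ∞) (fun x => ψ (fderiv ℝ f x u)) := hψ.comp hfu
      have hBg := (hB1 _ hfu hBf).mono hn le_rfl
      rw [osc_step (g := fun x => ψ (fderiv ℝ f x u)) hμ ha hf hg hs
        (fun x hx => hψ1 _ (hcf x hx))]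
      have hag := ha.mul hg
      have hb2 := BddD.mul ha hg hBa hBg
      have hts : tsupport (fun x => fderiv ℝ (fun y => a y * ψ (fderiv ℝ f y u)) x u) ⊆
          tsupport a := by
        refine (tsupport_fderiv_apply_subset ℝ u).trans ?_
        exact tsupport_mul_subset_left
      have := hC f (fun x => fderiv ℝ (fun y => a y * ψ (fderiv ℝ f y u)) x u) u μ hμ hf
        ((hag.fderiv_right (m := (⊤ : ℕ∞)) (by simp)).clm_apply contDiff_const)
        ((hs.mul_right (f' := fun y => ψ (fderiv ℝ f y u))).fderiv_apply ℝ u)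
        hu (BddD.fderiv_apply hag hb2 hu) hBf (fun x hx => hcf x (hts hx))
        ((measure_mono hts).trans hV)
      rw [norm_mul, norm_div, Complex.norm_I, Complex.norm_real, Real.norm_of_nonneg hμ.le]
      calc _ ≤ 1 / μ * (C / μ ^ n) := by gcongr
        _ = C / μ ^ (n + 1) := by field_simp; try ring
  exact main N le_rfl B
end PartA2

section PartB
variable {d : ℕ} {Ω : Set (Euc d)} {ρ : Euc d → ℝ}

lemma IsMinkowskiGauge.mem_nhds (hρ : IsMinkowskiGauge d Ω ρ) : Ω ∈ 𝓝 (0 : Euc d) :=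
  hρ.isOpen.mem_nhds hρ.zero_mem

lemma IsMinkowskiGauge.cont (hρ : IsMinkowskiGauge d Ω ρ) : Continuous ρ := by
  rw [hρ.eq_gauge]; exact continuous_gauge hρ.convex hρ.mem_nhds

lemma IsMinkowskiGauge.zero (hρ : IsMinkowskiGauge d Ω ρ) : ρ 0 = 0 := by
  rw [hρ.eq_gauge]; exact gauge_zero

lemma IsMinkowskiGauge.nonneg (hρ : IsMinkowskiGauge d Ω ρ) (ξ : Euc d) : 0 ≤ ρ ξ := by
  rw [hρ.eq_gauge]; exact gauge_nonneg _

lemma IsMinkowskiGauge.smul (hρ : IsMinkowskiGauge d Ω ρ) {t : ℝ} (ht : 0 ≤ t) (ξ : Euc d) :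
    ρ (t • ξ) = t * ρ ξ := by
  rw [hρ.eq_gauge, gauge_smul_of_nonneg ht]; simp

lemma IsMinkowskiGauge.add_le (hρ : IsMinkowskiGauge d Ω ρ) (ξ η : Euc d) :
    ρ (ξ + η) ≤ ρ ξ + ρ η := by
  rw [hρ.eq_gauge]
  exact gauge_add_le hρ.convex (absorbent_nhds_zero hρ.mem_nhds) ξ η

lemma IsMinkowskiGauge.ne_zero (hρ : IsMinkowskiGauge d Ω ρ) {ξ : Euc d} (h : 0 < ρ ξ) :
    ξ ≠ 0 := by
  rintro rfl; rw [hρ.zero] at h; exact lt_irrefl _ h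

lemma IsMinkowskiGauge.cdAt (hρ : IsMinkowskiGauge d Ω ρ) {ξ : Euc d} (h : ξ ≠ 0) :
    ContDiffAt ℝ (⊤ : ℕ∞) ρ ξ :=
  hρ.smooth.contDiffAt (isOpen_compl_singleton.mem_nhds h)

lemma IsMinkowskiGauge.diffAt (hρ : IsMinkowskiGauge d Ω ρ) {ξ : Euc d} (h : ξ ≠ 0) :
    DifferentiableAt ℝ ρ ξ := (hρ.cdAt h).differentiableAt (by simp)

/-- two-sided bound by the norm -/
lemma IsMinkowskiGauge.bounds (hρ : IsMinkowskiGauge d Ω ρ) :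
    ∃ m M : ℝ, 0 < m ∧ 0 < M ∧ ∀ ξ, m * ‖ξ‖ ≤ ρ ξ ∧ ρ ξ ≤ M * ‖ξ‖ := by
  obtain ⟨r, hr, hrΩ⟩ := Metric.mem_nhds_iff.1 hρ.mem_nhds
  obtain ⟨R, hR, hΩR⟩ := hρ.isBounded.subset_ball_lt 0 0
  refine ⟨1 / R, 1 / r, by positivity, by positivity, fun ξ => ?_⟩
  rw [hρ.eq_gauge]
  constructor
  · have := gauge_mono (absorbent_nhds_zero hρ.mem_nhds) hΩR ξ
    rw [gauge_ball hR.le] at this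
    rw [one_div, inv_mul_eq_div]; exact this
  · have := gauge_mono (absorbent_nhds_zero (Metric.ball_mem_nhds (0 : Euc d) hr)) hrΩ ξ
    rw [gauge_ball hr.le] at this
    rw [one_div, inv_mul_eq_div]; exact this

/-- Euler identity -/
lemma IsMinkowskiGauge.euler (hρ : IsMinkowskiGauge d Ω ρ) {ξ : Euc d} (h : ξ ≠ 0) :
    fderiv ℝ ρ ξ ξ = ρ ξ := by
  have h1 : HasDerivAt (fun t : ℝ => ρ (t • ξ)) (fderiv ℝ ρ ξ ξ) 1 := by
    have hd : HasFDerivAt ρ (fderiv ℝ ρ ξ) ((1 : ℝ) • ξ) := by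
      rw [one_smul]; exact (hρ.diffAt h).hasFDerivAt
    have hl : HasDerivAt (fun t : ℝ => t • ξ) ξ 1 := by
      simpa using (hasDerivAt_id (1 : ℝ)).smul_const ξ
    exact hd.comp_hasDerivAt 1 hl
  have h2 : HasDerivAt (fun t : ℝ => ρ (t • ξ)) (ρ ξ) 1 := by
    have : HasDerivAt (fun t : ℝ => t * ρ ξ) (ρ ξ) 1 := by
      simpa using (hasDerivAt_id (1 : ℝ)).mul_const (ρ ξ)
    refine this.congr_of_eventuallyEq ?_
    filter_upwards [Ioi_mem_nhds (zero_lt_one : (0 : ℝ) < 1)] with t ht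
    exact hρ.smul (le_of_lt ht) ξ
  exact h1.unique h2

lemma IsMinkowskiGauge.fderiv_le (hρ : IsMinkowskiGauge d Ω ρ) {ξ : Euc d} (h : ξ ≠ 0)
    (v : Euc d) : fderiv ℝ ρ ξ v ≤ ρ v := by
  have h1 : HasDerivAt (fun t : ℝ => ρ (ξ + t • v)) (fderiv ℝ ρ ξ v) 0 := by
    have hd : HasFDerivAt ρ (fderiv ℝ ρ ξ) (ξ + (0 : ℝ) • v) := by
      rw [zero_smul, add_zero]; exact (hρ.diffAt h).hasFDerivAt
    have hl : HasDerivAt (fun t : ℝ => ξ + t • v) v 0 := by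
      simpa using ((hasDerivAt_id (0 : ℝ)).smul_const v).const_add ξ
    exact hd.comp_hasDerivAt 0 hl
  have h2 := h1.hasDerivWithinAt (s := Set.Ioi 0)
  have h3 := (hasDerivWithinAt_iff_tendsto_slope' (by simp)).1 h2
  refine le_of_tendsto h3 ?_
  filter_upwards [self_mem_nhdsWithin] with t ht
  have ht0 : 0 < t := ht
  simp only [slope, zero_smul, add_zero, sub_zero, vsub_eq_sub, smul_eq_mul]
  have := hρ.add_le ξ (t • v)
  rw [hρ.smul ht0.le] at this
  rw [inv_mul_le_iff₀ ht0]; linarith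

lemma IsMinkowskiGauge.fderiv_mono (hρ : IsMinkowskiGauge d Ω ρ) {ξ η : Euc d} (h : ξ ≠ 0)
    (h' : η ≠ 0) : 0 ≤ (fderiv ℝ ρ η - fderiv ℝ ρ ξ) (η - ξ) := by
  have h1 := hρ.fderiv_le h η
  have h2 := hρ.fderiv_le h' ξ
  have h3 := hρ.euler h
  have h4 := hρ.euler h'
  simp only [sub_apply, map_sub]
  linarith

lemma IsMinkowskiGauge.fderiv_smul (hρ : IsMinkowskiGauge d Ω ρ) {ξ : Euc d} (h : ξ ≠ 0)
    {t : ℝ} (ht : 0 < t) : fderiv ℝ ρ (t • ξ) = fderiv ℝ ρ ξ := by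
  have htx : t • ξ ≠ 0 := smul_ne_zero ht.ne' h
  have h0 : ∀ v, fderiv ℝ ρ (t • ξ) v ≤ fderiv ℝ ρ ξ v := by
    intro v
    have h1 : HasDerivAt (fun s : ℝ => ρ (t • ξ + s • (t • v))) (fderiv ℝ ρ (t • ξ) (t • v)) 0 := by
      have hd : HasFDerivAt ρ (fderiv ℝ ρ (t • ξ)) (t • ξ + (0 : ℝ) • (t • v)) := by
        rw [zero_smul, add_zero]; exact (hρ.diffAt htx).hasFDerivAt
      have hl : HasDerivAt (fun s : ℝ => t • ξ + s • (t • v)) (t • v) 0 := by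
        simpa using ((hasDerivAt_id (0 : ℝ)).smul_const (t • v)).const_add (t • ξ)
      exact hd.comp_hasDerivAt 0 hl
    have h2 : HasDerivAt (fun s : ℝ => ρ (t • ξ + s • (t • v))) (t * fderiv ℝ ρ ξ v) 0 := by
      have hd : HasFDerivAt ρ (fderiv ℝ ρ ξ) (ξ + (0 : ℝ) • v) := by
        rw [zero_smul, add_zero]; exact (hρ.diffAt h).hasFDerivAt
      have hl : HasDerivAt (fun s : ℝ => ξ + s • v) v 0 := by
        simpa using ((hasDerivAt_id (0 : ℝ)).smul_const v).const_add ξ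
      have := (hd.comp_hasDerivAt 0 hl).const_mul t
      refine this.congr_of_eventuallyEq (Eventually.of_forall fun s => ?_)
      simp only [Function.comp]
      rw [← hρ.smul ht.le, smul_add, smul_comm]
    have := h1.unique h2
    rw [map_smul, smul_eq_mul] at this
    exact (mul_left_cancel₀ ht.ne' this).le
  ext v
  refine le_antisymm (h0 v) ?_
  have := h0 (-v)
  simp only [map_neg] at this
  linarith

lemma IsMinkowskiGauge.diffAt2 (hρ : IsMinkowskiGauge d Ω ρ) {ξ : Euc d} (h : ξ ≠ 0) :
    DifferentiableAt ℝ (fderiv ℝ ρ) ξ :=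
  ((hρ.cdAt h).fderiv_right (m := (⊤ : ℕ∞)) (by simp)).differentiableAt (by simp)

lemma IsMinkowskiGauge.hess_self (hρ : IsMinkowskiGauge d Ω ρ) {ξ : Euc d} (h : ξ ≠ 0) :
    fderiv ℝ (fderiv ℝ ρ) ξ ξ = 0 := by
  have h1 : HasDerivAt (fun t : ℝ => fderiv ℝ ρ (t • ξ)) (fderiv ℝ (fderiv ℝ ρ) ξ ξ) 1 := by
    have hd : HasFDerivAt (fderiv ℝ ρ) (fderiv ℝ (fderiv ℝ ρ) ξ) ((1 : ℝ) • ξ) := by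
      rw [one_smul]; exact (hρ.diffAt2 h).hasFDerivAt
    have hl : HasDerivAt (fun t : ℝ => t • ξ) ξ 1 := by
      simpa using (hasDerivAt_id (1 : ℝ)).smul_const ξ
    exact hd.comp_hasDerivAt 1 hl
  have h2 : HasDerivAt (fun t : ℝ => fderiv ℝ ρ (t • ξ)) 0 1 := by
    refine (hasDerivAt_const (1 : ℝ) (fderiv ℝ ρ ξ)).congr_of_eventuallyEq ?_
    filter_upwards [Ioi_mem_nhds (zero_lt_one : (0 : ℝ) < 1)] with t ht
    exact hρ.fderiv_smul h ht
  exact h1.unique h2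

lemma IsMinkowskiGauge.hess_nonneg (hρ : IsMinkowskiGauge d Ω ρ) {ξ : Euc d} (h : ξ ≠ 0)
    (v : Euc d) : 0 ≤ fderiv ℝ (fderiv ℝ ρ) ξ v v := by
  have h1 : HasDerivAt (fun t : ℝ => fderiv ℝ ρ (ξ + t • v) v) (fderiv ℝ (fderiv ℝ ρ) ξ v v) 0 := by
    have hd : HasFDerivAt (fderiv ℝ ρ) (fderiv ℝ (fderiv ℝ ρ) ξ) (ξ + (0 : ℝ) • v) := by
      rw [zero_smul, add_zero]; exact (hρ.diffAt2 h).hasFDerivAt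
    have hl : HasDerivAt (fun t : ℝ => ξ + t • v) v 0 := by
      simpa using ((hasDerivAt_id (0 : ℝ)).smul_const v).const_add ξ
    have h3 := hd.comp_hasDerivAt 0 hl
    exact (ContinuousLinearMap.apply ℝ ℝ v).hasFDerivAt.comp_hasDerivAt (0:ℝ) h3
  have h2 := h1.hasDerivWithinAt (s := Set.Ioi 0)
  have h3 := (hasDerivWithinAt_iff_tendsto_slope' (by simp)).1 h2
  refine ge_of_tendsto h3 ?_
  have hne : ∀ᶠ t in 𝓝 (0:ℝ), ξ + t • v ≠ 0 := by
    have : Continuous (fun t : ℝ => ξ + t • v) := by fun_prop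
    exact this.continuousAt.eventually_ne (by simpa using h)
  filter_upwards [self_mem_nhdsWithin, hne.filter_mono nhdsWithin_le_nhds] with t ht hne
  have ht0 : 0 < t := ht
  simp only [slope, zero_smul, add_zero, sub_zero, vsub_eq_sub, smul_eq_mul]
  have := hρ.fderiv_mono h hne
  rw [add_sub_cancel_left, map_smul, smul_eq_mul, sub_apply] at this
  have h5 := nonneg_of_mul_nonneg_right this ht0
  positivity

lemma IsMinkowskiGauge.hess_symm (hρ : IsMinkowskiGauge d Ω ρ) {ξ : Euc d} (h : ξ ≠ 0)
    (v w : Euc d) : fderiv ℝ (fderiv ℝ ρ) ξ v w = fderiv ℝ (fderiv ℝ ρ) ξ w v := by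
  have := ((hρ.cdAt h).of_le (m := 2) (WithTop.coe_le_coe.2 (le_top : (2:ℕ∞) ≤ ⊤))).isSymmSndFDerivAt (by simp)
  exact this v w

lemma IsMinkowskiGauge.hess_pos (hd : 2 ≤ d) (hρ : IsMinkowskiGauge d Ω ρ)
    (hcurv : HasNonvanishingCurvature d ρ)
    {ξ : Euc d} (h : ξ ≠ 0) {v : Euc d} (hv : v ≠ 0) (hvξ : ⟪ξ, v⟫ = 0) :
    0 < fderiv ℝ (fderiv ℝ ρ) ξ v v := by
  refine lt_of_le_of_ne (hρ.hess_nonneg h v) (fun h0 => ?_)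
  set B := fderiv ℝ (fderiv ℝ ρ) ξ with hB
  have hBv : B v = 0 := by
    ext w
    have key : ∀ t : ℝ, 0 ≤ 2 * t * B v w + t ^ 2 * B w w := by
      intro t
      have := hρ.hess_nonneg h (v + t • w)
      rw [← hB] at this
      simp only [map_add, map_smul, add_apply, smul_apply,
        smul_eq_mul, ← h0] at this
      have hs := hρ.hess_symm h v w
      rw [← hB] at hs
      rw [← hs] at this
      nlinarith
    by_contra hne
    have hne' : B v w ≠ 0 := hne
    have hww := hρ.hess_nonneg h w
    rw [← hB] at hww
    have h1 := key (-(B v w) / (1 + B w w))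
    have hp : 0 < 1 + B w w := by linarith
    have h2 : 2 * (-(B v w) / (1 + B w w)) * B v w + (-(B v w) / (1 + B w w)) ^ 2 * B w w
      = - (B v w)^2 * (2 + B w w) / (1 + B w w)^2 := by
      field_simp; ring
    rw [h2] at h1
    have : - (B v w)^2 * (2 + B w w) / (1 + B w w)^2 < 0 := by
      apply div_neg_of_neg_of_pos _ (by positivity)
      have : 0 < (B v w)^2 := by positivity
      nlinarith
    linarith
  have hBξ : B ξ = 0 := hρ.hess_self h
  have hr := hcurv ξ h
  set L : Euc d →ₗ[ℝ] (Euc d →L[ℝ] ℝ) := (B : Euc d →ₗ[ℝ] (Euc d →L[ℝ] ℝ)) with hL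
  have hrk : Module.finrank ℝ (LinearMap.range L) = d - 1 := by
    have : Module.rank ℝ (LinearMap.range L) = ((d - 1 : ℕ) : Cardinal) := hr
    exact Module.finrank_eq_of_rank_eq this
  have hsum := LinearMap.finrank_range_add_finrank_ker L
  rw [hrk, finrank_euclideanSpace_fin] at hsum
  have hk : Module.finrank ℝ (LinearMap.ker L) = 1 := by omega
  have hli : LinearIndependent ℝ ![ξ, v] := by
    rw [LinearIndependent.pair_iff]
    intro a b hab
    have h1 : ⟪ξ, a • ξ + b • v⟫ = (0:ℝ) := by rw [hab]; simp
    have h2 : ⟪v, a • ξ + b • v⟫ = (0:ℝ) := by rw [hab]; simp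
    rw [inner_add_right, inner_smul_right, inner_smul_right, hvξ] at h1
    rw [inner_add_right, inner_smul_right, inner_smul_right, real_inner_comm, hvξ] at h2
    have h3 : ⟪ξ, ξ⟫ ≠ (0:ℝ) := by simpa using h
    have h4 : ⟪v, v⟫ ≠ (0:ℝ) := by simpa using hv
    constructor
    · simpa [h3, h] using h1
    · simpa [h4, hv] using h2
  let g : Fin 2 → LinearMap.ker L := ![⟨ξ, hBξ⟩, ⟨v, hBv⟩]
  have hg : LinearIndependent ℝ g := by
    apply LinearIndependent.of_comp (LinearMap.ker L).subtype
    convert hli using 1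
    ext i : 1
    fin_cases i <;> rfl
  have := hg.fintype_card_le_finrank
  rw [hk] at this
  simp at this
end PartB

section PartC1
variable {E : Type*} [NormedAddCommGroup E] [InnerProductSpace ℝ E] [FiniteDimensional ℝ E]
  [MeasurableSpace E] [BorelSpace E]
variable {F : Type*} [NormedAddCommGroup F] [InnerProductSpace ℝ F] [FiniteDimensional ℝ F]
  [MeasurableSpace F] [BorelSpace F]

open ComplexConjugate in
lemma sq_lemma (J : F →ₗᵢ[ℝ] E) {K : Set E} (hK : IsCompact K) :
    ∃ C : ℝ, 0 ≤ C ∧ ∀ (f : E → ℂ) (m : F → ℝ) (A t : ℝ), Continuous f → (∀ x ∉ K, f x = 0) →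
      Integrable m → (∫ k, m k ≤ A) →
      (∀ k, ‖∫ ξ, f (ξ + J k) * conj (f ξ)‖ ≤ m k) → 0 < t →
      ‖∫ ξ, f ξ‖ ≤ C * (t + A / t) := by
  let p : ContDiffBump (0 : F) := ⟨1, 2, by norm_num, by norm_num⟩
  have hp0 : ∀ h, 0 ≤ p h := fun h => p.nonneg
  have hp1 : ∀ h, p h ≤ 1 := fun h => p.le_one
  have hpc : Continuous p := p.continuous
  have hps : HasCompactSupport p := p.hasCompactSupport
  have hpI : Integrable (fun h => p h) := hpc.integrable_of_hasCompactSupport hps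
  set P := ∫ h, p h with hP
  have hPpos : 0 < P := p.integral_pos
  set K1 : Set F := tsupport p with hK1
  have hK1c : IsCompact K1 := hps
  set K' : Set E := (fun q : E × F => q.1 - J q.2) '' (K ×ˢ K1) with hK'
  have hJc : Continuous J := J.continuous
  have hK'c : IsCompact K' := (hK.prod hK1c).image (by fun_prop)
  set V := (volume K').toReal with hV
  have hV0 : 0 ≤ V := ENNReal.toReal_nonneg
  refine ⟨(V + P) / P, by positivity, fun f m A t hf hfK hm hmA hM ht => ?_⟩
  set G : E → ℂ := fun ξ => ∫ h, (p h : ℂ) * f (ξ + J h) with hG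
  have hGK : ∀ ξ ∉ K', ∀ h, (p h : ℂ) * f (ξ + J h) = 0 := by
    intro ξ hξ h
    by_cases h1 : h ∈ K1
    · have : ξ + J h ∉ K := fun h2 => hξ ⟨(ξ + J h, h), ⟨h2, h1⟩, by simp⟩
      rw [hfK _ this, mul_zero]
    · rw [image_eq_zero_of_notMem_tsupport h1]; simp
  have hGK' : ∀ ξ ∉ K', G ξ = 0 := by
    intro ξ hξ
    simp only [hG]
    simp_rw [hGK ξ hξ]; simp
  have hcu : Continuous (fun q : E × F => (p q.2 : ℂ) * f (q.1 + J q.2)) := by fun_prop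
  have hGc : Continuous G := by
    have h1 : G = fun ξ => ∫ h in K1, (p h : ℂ) * f (ξ + J h) := by
      ext ξ
      rw [setIntegral_eq_integral_of_forall_compl_eq_zero]
      intro h hh
      rw [image_eq_zero_of_notMem_tsupport hh]; simp
    rw [h1]
    exact continuous_parametric_integral_of_continuous hcu hK1c
  have hGs : HasCompactSupport G := HasCompactSupport.intro hK'c hGK'
  have hGI : Integrable G := hGc.integrable_of_hasCompactSupport hGs
  have hfs : HasCompactSupport f := HasCompactSupport.intro hK hfK
  have hfI : Integrable f := hf.integrable_of_hasCompactSupport hfs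
  -- (1)
  have e1 : ∫ ξ, G ξ = P * ∫ ξ, f ξ := by
    simp only [hG]
    rw [integral_integral_swap_of_hasCompactSupport (f := fun ξ h => (p h : ℂ) * f (ξ + J h))]
    · simp_rw [integral_const_mul]
      have : ∀ h : F, ∫ ξ, f (ξ + J h) = ∫ ξ, f ξ := fun h => integral_add_right_eq_self f (J h)
      simp_rw [this, integral_mul_const]
      rw [integral_complex_ofReal]
    · exact hcu
    · refine HasCompactSupport.intro (hK'c.prod hK1c) ?_
      rintro ⟨ξ, h⟩ hq
      by_cases h1 : ξ ∈ K'
      · have : h ∉ K1 := fun h2 => hq ⟨h1, h2⟩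
        simp [image_eq_zero_of_notMem_tsupport this]
      · exact hGK ξ h1 h
  -- (2)
  have hA0 : ∀ h, ‖∫ ξ, f (ξ + J h) * conj (G ξ)‖ ≤ A := by
    intro h
    have e2 : ∀ ξ, f (ξ + J h) * conj (G ξ)
        = ∫ h', f (ξ + J h) * ((p h' : ℂ) * conj (f (ξ + J h'))) := by
      intro ξ
      simp only [hG]
      rw [← integral_conj, ← integral_const_mul]
      congr 1; ext h'
      simp
    simp_rw [e2]
    rw [integral_integral_swap_of_hasCompactSupport
      (f := fun ξ h' => f (ξ + J h) * ((p h' : ℂ) * conj (f (ξ + J h'))))]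
    · have e3 : ∀ h', ∫ ξ, f (ξ + J h) * ((p h' : ℂ) * conj (f (ξ + J h')))
          = p h' * ∫ ξ, f (ξ + J (h - h')) * conj (f ξ) := by
        intro h'
        rw [← integral_add_right_eq_self (fun ξ => f (ξ + J (h - h')) * conj (f ξ)) (J h'),
          ← integral_const_mul]
        congr 1; ext ξ
        have : ξ + J h' + J (h - h') = ξ + J h := by rw [map_sub]; abel
        rw [this]; ring
      simp_rw [e3]
      have hm' : Integrable (fun h' => m (h - h')) := hm.comp_sub_left h
      refine (norm_integral_le_of_norm_le hm' (Eventually.of_forall fun h' => ?_)).trans ?_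
      · rw [norm_mul, Complex.norm_real, Real.norm_of_nonneg (hp0 h')]
        have := hM (h - h')
        calc _ ≤ 1 * m (h - h') := by
              gcongr
              exact hp1 h'
          _ = _ := one_mul _
      · rw [integral_sub_left_eq_self m]; exact hmA
    · have := hcu.comp ((continuous_fst).prodMk continuous_snd : Continuous fun q : E × F => (q.1, q.2))
      simp only [Function.uncurry_def]
      fun_prop
    · refine HasCompactSupport.intro (hK'c.prod hK1c) ?_
      rintro ⟨ξ, h'⟩ hq
      by_cases h1 : ξ ∈ K'
      · have : h' ∉ K1 := fun h2 => hq ⟨h1, h2⟩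
        simp [image_eq_zero_of_notMem_tsupport this]
      · have := congrArg conj (hGK ξ h1 h')
        simp only [map_mul, Complex.conj_ofReal, map_zero] at this
        simp [Function.uncurry, this]
  have hGG : ∫ ξ, ‖G ξ‖ ^ 2 ≤ P * A := by
    have e4 : ((∫ ξ, ‖G ξ‖ ^ 2 : ℝ) : ℂ) = ∫ h, (p h : ℂ) * ∫ ξ, f (ξ + J h) * conj (G ξ) := by
      rw [← integral_complex_ofReal]
      simp_rw [← integral_const_mul]
      rw [← integral_integral_swap_of_hasCompactSupport
        (f := fun ξ h => (p h : ℂ) * (f (ξ + J h) * conj (G ξ)))]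
      · congr 1; ext ξ
        simp_rw [← mul_assoc]
        rw [integral_mul_const]
        rw [show (∫ h, (p h : ℂ) * f (ξ + J h)) = G ξ from rfl, Complex.mul_conj']
        push_cast; rfl
      · simp only [Function.uncurry_def]
        fun_prop
      · refine HasCompactSupport.intro (hK'c.prod hK1c) ?_
        rintro ⟨ξ, h⟩ hq
        by_cases h1 : ξ ∈ K'
        · have : h ∉ K1 := fun h2 => hq ⟨h1, h2⟩
          simp [image_eq_zero_of_notMem_tsupport this]
        · simp [Function.uncurry, hGK' ξ h1]
    have e5 : ∫ ξ, ‖G ξ‖ ^ 2 ≤ ‖((∫ ξ, ‖G ξ‖ ^ 2 : ℝ) : ℂ)‖ := by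
      rw [Complex.norm_real]; exact Real.le_norm_self _
    refine e5.trans ?_
    rw [e4]
    refine (norm_integral_le_of_norm_le (hpI.mul_const A) (Eventually.of_forall fun h => ?_)).trans ?_
    · rw [norm_mul, Complex.norm_real, Real.norm_of_nonneg (hp0 h)]
      exact mul_le_mul_of_nonneg_left (hA0 h) (hp0 h)
    · rw [integral_mul_const]
  -- (3)
  have hfin : ‖∫ ξ, G ξ‖ ≤ t * V + (P * A) / t := by
    have hG2 : Integrable (fun ξ => ‖G ξ‖ ^ 2) :=
      (hGc.norm.pow 2).integrable_of_hasCompactSupport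
        (HasCompactSupport.intro hK'c (fun ξ hξ => by simp [hGK' ξ hξ]))
    have e6 : ∫ ξ, G ξ = ∫ ξ in K', G ξ := by
      rw [setIntegral_eq_integral_of_forall_compl_eq_zero]; exact hGK'
    rw [e6]
    have hti : Integrable (fun _ : E => t) (volume.restrict K') :=
      integrableOn_const (hK'c.measure_lt_top.ne)
    have hbi : IntegrableOn (fun ξ => t + ‖G ξ‖ ^ 2 / t) K' :=
      hti.add (hG2.div_const t).integrableOn
    refine (norm_integral_le_of_norm_le hbi (Eventually.of_forall fun ξ => ?_)).trans ?_
    · have : 0 ≤ (‖G ξ‖ - t) ^ 2 := sq_nonneg _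
      have h2 : 0 ≤ ‖G ξ‖ := norm_nonneg _
      rw [← sub_nonneg]
      have : t + ‖G ξ‖ ^ 2 / t - ‖G ξ‖ = ((‖G ξ‖ - t) ^ 2 + ‖G ξ‖ * t) / t := by field_simp; ring
      rw [this]; positivity
    · rw [integral_add hti (hG2.div_const t).integrableOn]
      rw [setIntegral_const, integral_div]
      have : ∫ ξ in K', ‖G ξ‖ ^ 2 ≤ P * A :=
        (setIntegral_le_integral hG2 (Eventually.of_forall fun ξ => by positivity)).trans hGG
      rw [smul_eq_mul, mul_comm]
      have h3 : volume.real K' = V := rfl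
      rw [h3]
      gcongr
  rw [e1, norm_mul, Complex.norm_real, Real.norm_of_nonneg hPpos.le] at hfin
  have hA : 0 ≤ A := (norm_nonneg _).trans (hA0 0)
  have : ‖∫ ξ, f ξ‖ ≤ (t * V + P * A / t) / P := by
    rw [le_div_iff₀ hPpos, mul_comm]; exact hfin
  refine this.trans ?_
  rw [div_mul_eq_mul_div]
  gcongr
  have h4 : 0 ≤ A / t := by positivity
  have : P * A / t = P * (A / t) := by ring
  rw [this]
  nlinarith [mul_nonneg hPpos.le ht.le, mul_nonneg hV0 h4]
end PartC1

section PartD1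
variable {E : Type*} [NormedAddCommGroup E] [InnerProductSpace ℝ E]
variable {F : Type*} [NormedAddCommGroup F] [NormedSpace ℝ F]

lemma BddD.inner_left {N : ℕ} {B R : ℝ} {w : F → E} (hw : ContDiff ℝ (⊤ : ℕ∞) w)
    (h : BddD N B w) {x : E} (hx : ‖x‖ ≤ R) : BddD N (R * B) (fun ξ => ⟪x, w ξ⟫) := by
  intro i hi ξ
  have h1 := (innerSL ℝ x).norm_iteratedFDeriv_comp_left (f := w) (x := ξ) (n := i)
    (N := (⊤ : ℕ∞)) hw.contDiffAt (by exact_mod_cast le_top)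
  have h2 : (innerSL ℝ x) ∘ w = fun ξ => ⟪x, w ξ⟫ := by ext; simp
  rw [h2, innerSL_apply_norm] at h1
  refine h1.trans ?_
  have := h.nonneg
  have hR : 0 ≤ R := (norm_nonneg _).trans hx
  gcongr
  exact h i hi ξ

lemma BddD.translate {N : ℕ} {B : ℝ} {w : F → E} (h : BddD N B w) (k : F) :
    BddD N B (fun ξ => w (ξ + k)) := by
  intro i hi ξ
  rw [iteratedFDeriv_comp_add_right]; exact h i hi _

lemma BddD.diffquot {N : ℕ} {B : ℝ} {g : F → ℝ} (hg : ContDiff ℝ (⊤ : ℕ∞) g)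
    (h : BddD (N + 1) B g) {k : F} (hk : k ≠ 0) :
    BddD N B (fun ξ => ‖k‖⁻¹ • (g (ξ + k) - g ξ)) := by
  intro i hi ξ
  have hk0 : 0 < ‖k‖ := norm_pos_iff.2 hk
  have hgt : ContDiff ℝ (⊤ : ℕ∞) (fun ξ => g (ξ + k)) := hg.comp (by fun_prop)
  have hin : ((i : ℕ) : WithTop ℕ∞) ≤ ((⊤ : ℕ∞) : WithTop ℕ∞) := by exact_mod_cast le_top
  have e1 : iteratedFDeriv ℝ i (fun ξ => ‖k‖⁻¹ • (g (ξ + k) - g ξ)) ξ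
      = ‖k‖⁻¹ • (iteratedFDeriv ℝ i g (ξ + k) - iteratedFDeriv ℝ i g ξ) := by
    have := iteratedFDeriv_const_smul_apply (𝕜 := ℝ) (a := ‖k‖⁻¹) (f := fun ξ => g (ξ + k) - g ξ)
      (x := ξ) (i := i) (((hgt.sub hg).of_le hin).contDiffAt)
    have h3 := iteratedFDeriv_sub_apply (𝕜 := ℝ) (f := fun ξ => g (ξ + k)) (g := g) (x := ξ)
      (i := i) ((hgt.of_le hin).contDiffAt) ((hg.of_le hin).contDiffAt)
    rw [iteratedFDeriv_comp_add_right] at h3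
    rw [← h3]
    exact this
  rw [e1, norm_smul, norm_inv, norm_norm, inv_mul_le_iff₀ hk0]
  have hd : Differentiable ℝ (iteratedFDeriv ℝ i g) :=
    hg.differentiable_iteratedFDeriv (by exact_mod_cast (ENat.natCast_lt_top i))
  have := Convex.norm_image_sub_le_of_norm_fderiv_le (𝕜 := ℝ) (f := iteratedFDeriv ℝ i g) (C := B)
    (s := Set.univ) (x := ξ) (y := ξ + k)
    (fun x _ => hd x) (fun x _ => by rw [norm_fderiv_iteratedFDeriv]; exact h (i + 1) (by omega) x)
    convex_univ trivial trivial
  rw [add_sub_cancel_left] at this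
  linarith
end PartD1

lemma clm_dist_apply {E G : Type*} [NormedAddCommGroup E] [NormedSpace ℝ E]
    [NormedAddCommGroup G] [NormedSpace ℝ G] (A B : E →L[ℝ] G) (v : E) :
    dist (A v) (B v) ≤ dist A B * ‖v‖ := by
  rw [dist_eq_norm, dist_eq_norm, ← sub_apply]
  exact (A - B).le_opNorm v

lemma clm_dist_apply₂ {E G : Type*} [NormedAddCommGroup E] [NormedSpace ℝ E]
    [NormedAddCommGroup G] [NormedSpace ℝ G] (A B : E →L[ℝ] E →L[ℝ] G) (v v' : E) :
    ‖A v v' - B v v'‖ ≤ dist A B * ‖v‖ * ‖v'‖ := by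
  rw [← dist_eq_norm]
  refine (clm_dist_apply (A v) (B v) v').trans ?_
  gcongr
  exact clm_dist_apply A B v

section PartD2
variable {E : Type*} [NormedAddCommGroup E] [InnerProductSpace ℝ E] [FiniteDimensional ℝ E]
  [MeasurableSpace E] [BorelSpace E]

/-- Local decay at `(x₀, ξ₀)` of order `p`. -/
def LocDecay (w : E → E) (p : ℝ) (x0 ξ0 : E) : Prop :=
  ∃ U ∈ 𝓝 x0, ∃ V : Set E, IsOpen V ∧ ξ0 ∈ V ∧ ∀ b : E → ℝ, ContDiff ℝ (⊤ : ℕ∞) b →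
    HasCompactSupport b → tsupport b ⊆ V → ∃ C : ℝ, 0 ≤ C ∧ ∀ x ∈ U, ∀ μ : ℝ, 1 ≤ μ →
      ‖osc b (fun ξ => μ * ⟪x, w ξ⟫)‖ ≤ C * μ ^ (-p)

lemma fderiv_inner_left {w : E → E} (hw : ContDiff ℝ (⊤ : ℕ∞) w) (x ξ u : E) :
    fderiv ℝ (fun ξ => ⟪x, w ξ⟫) ξ u = ⟪x, fderiv ℝ w ξ u⟫ := by
  have hd : DifferentiableAt ℝ w ξ := hw.differentiable (by simp) ξ
  have h1 : HasFDerivAt (fun ξ => ⟪x, w ξ⟫) ((innerSL ℝ x).comp (fderiv ℝ w ξ)) ξ :=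
    (innerSL ℝ x).hasFDerivAt.comp ξ hd.hasFDerivAt
  rw [h1.fderiv]; simp

lemma locDecay_nonstat {w : E → E} (hw : ContDiff ℝ (⊤ : ℕ∞) w) (hws : HasCompactSupport w)
    {p : ℝ} {n : ℕ} (hp : p ≤ n) {x0 ξ0 u : E}
    (h : 0 < ⟪x0, fderiv ℝ w ξ0 u⟫) (hu : ‖u‖ ≤ 1) : LocDecay w p x0 ξ0 := by
  set c := ⟪x0, fderiv ℝ w ξ0 u⟫ / 2 with hc
  have hc0 : 0 < c := by positivity
  have hcont : Continuous (fun q : E × E => ⟪q.1, fderiv ℝ w q.2 u⟫) := by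
    have h1 : Continuous (fderiv ℝ w) := hw.continuous_fderiv (by simp)
    fun_prop
  have hev : ∀ᶠ q : E × E in 𝓝 (x0, ξ0), c < ⟪q.1, fderiv ℝ w q.2 u⟫ :=
    hcont.continuousAt.eventually_const_lt (by simp only [hc]; linarith)
  rw [nhds_prod_eq, Filter.eventually_prod_iff] at hev
  obtain ⟨pa, hpa, pb, hpb, hab⟩ := hev
  obtain ⟨V, hVpb, hVo, hξV⟩ := mem_nhds_iff.1 hpb
  refine ⟨{x | pa x} ∩ Metric.ball x0 1, Filter.inter_mem hpa (Metric.ball_mem_nhds _ one_pos), V,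
    hVo, hξV, fun b hb hbs hbV => ?_⟩
  obtain ⟨B1, hB10, hB1⟩ := BddD_of_compactSupport (n + 1) hw hws
  obtain ⟨B2, hB20, hB2⟩ := BddD_of_compactSupport n hb hbs
  obtain ⟨C, hC0, hC⟩ := osc_nonstat (E := E) n hc0 (max B2 ((‖x0‖ + 1) * B1))
    (volume (tsupport b)).toReal
  refine ⟨C, hC0, fun x hx μ hμ => ?_⟩
  have hμ0 : 0 < μ := by linarith
  have hxn : ‖x‖ ≤ ‖x0‖ + 1 := by
    have := hx.2
    rw [mem_ball_iff_norm] at this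
    have h3 := norm_le_norm_add_norm_sub' x x0
    linarith
  have hφ : ContDiff ℝ (⊤ : ℕ∞) (fun ξ => ⟪x, w ξ⟫) := contDiff_const.inner ℝ hw
  refine (hC (fun ξ => ⟪x, w ξ⟫) b u μ hμ0 hφ hb hbs hu (hB2.mono le_rfl (le_max_left _ _)) ?_ ?_
    ?_).trans ?_
  · exact ((hB1.inner_left hw hxn).mono le_rfl (le_max_right _ _)).fderiv_apply hφ hu
  · intro ξ hξ
    rw [fderiv_inner_left hw]
    exact (hab hx.1 (hVpb (hbV hξ))).le
  · rw [ENNReal.ofReal_toReal hbs.isCompact.measure_lt_top.ne]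
  · rw [div_eq_mul_inv, ← Real.rpow_natCast, ← Real.rpow_neg hμ0.le]
    gcongr

open ComplexConjugate in
lemma locDecay_stat {w : E → E} (hw : ContDiff ℝ (⊤ : ℕ∞) w) (hws : HasCompactSupport w)
    {F : Type*} [NormedAddCommGroup F] [InnerProductSpace ℝ F] [FiniteDimensional ℝ F]
    [MeasurableSpace F] [BorelSpace F] (J : F →ₗᵢ[ℝ] E)
    {x0 ξ0 : E} {σ c0 : ℝ} (hσ : |σ| = 1) (hc0 : 0 < c0)
    (h : ∀ v : F, c0 * ‖v‖ ^ 2 ≤ σ * ⟪x0, fderiv ℝ (fderiv ℝ w) ξ0 (J v) (J v)⟫) :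
    LocDecay w ((Module.finrank ℝ F : ℝ) / 2) x0 ξ0 := by
  set c := c0 / 2 with hc
  have hcp : 0 < c := by positivity
  have hw1 : ContDiff ℝ (⊤ : ℕ∞) (fderiv ℝ w) := hw.fderiv_right (by simp)
  have hw2 : Continuous (fderiv ℝ (fderiv ℝ w)) := hw1.continuous_fderiv (by simp)
  have hcont : Continuous (fun q : E × E => ‖q.1 - x0‖ * ‖fderiv ℝ (fderiv ℝ w) q.2‖ +
      ‖x0‖ * dist (fderiv ℝ (fderiv ℝ w) q.2) (fderiv ℝ (fderiv ℝ w) ξ0)) := by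
    have h2 : Continuous (fun q : E × E => fderiv ℝ (fderiv ℝ w) q.2) := hw2.comp continuous_snd
    exact (((continuous_fst.sub continuous_const).norm).mul (Continuous.norm (E := E →L[ℝ] E →L[ℝ] E) h2)).add
      (continuous_const.mul (Continuous.dist (α := E →L[ℝ] E →L[ℝ] E) h2 continuous_const))
  have hev : ∀ᶠ q : E × E in 𝓝 (x0, ξ0), ‖q.1 - x0‖ * ‖fderiv ℝ (fderiv ℝ w) q.2‖ +
      ‖x0‖ * dist (fderiv ℝ (fderiv ℝ w) q.2) (fderiv ℝ (fderiv ℝ w) ξ0) < c :=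
    hcont.continuousAt.eventually_lt_const (by
      simp only [dist_self, sub_self, norm_zero, zero_mul, mul_zero, add_zero]
      exact hcp)
  rw [nhds_prod_eq, Filter.eventually_prod_iff] at hev
  obtain ⟨pa, hpa, pb, hpb, hab⟩ := hev
  obtain ⟨δ, hδ, hδpb⟩ := Metric.mem_nhds_iff.1 hpb
  -- lower bound
  have hlow : ∀ x, pa x → ∀ ξ ∈ Metric.ball ξ0 δ, ∀ v : F,
      c * ‖v‖ ^ 2 ≤ σ * ⟪x, fderiv ℝ (fderiv ℝ w) ξ (J v) (J v)⟫ := by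
    intro x hx ξ hξ v
    have h1 := h v
    have h2 := hab hx (hδpb hξ)
    simp only at h2
    set D := fderiv ℝ (fderiv ℝ w) ξ
    set D0 := fderiv ℝ (fderiv ℝ w) ξ0
    have hJ : ‖J v‖ = ‖v‖ := J.norm_map v
    have e : ⟪x, D (J v) (J v)⟫ - ⟪x0, D0 (J v) (J v)⟫
        = ⟪x - x0, D (J v) (J v)⟫ + ⟪x0, D (J v) (J v) - D0 (J v) (J v)⟫ := by
      simp only [inner_sub_left, inner_sub_right]; ring
    have hb1 : |⟪x - x0, D (J v) (J v)⟫| ≤ ‖x - x0‖ * ‖D‖ * ‖v‖ ^ 2 := by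
      refine (abs_real_inner_le_norm _ _).trans ?_
      have := D.le_opNorm₂ (J v) (J v)
      rw [hJ] at this
      calc _ ≤ ‖x - x0‖ * (‖D‖ * ‖v‖ * ‖v‖) := by gcongr
        _ = _ := by ring
    have hb2 : |⟪x0, D (J v) (J v) - D0 (J v) (J v)⟫| ≤ ‖x0‖ * dist D D0 * ‖v‖ ^ 2 := by
      refine (abs_real_inner_le_norm _ _).trans ?_
      have := clm_dist_apply₂ D D0 (J v) (J v)
      rw [hJ] at this
      calc _ ≤ ‖x0‖ * (dist D D0 * ‖v‖ * ‖v‖) := by gcongr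
        _ = _ := by ring
    have hb3 : |σ * (⟪x, D (J v) (J v)⟫ - ⟪x0, D0 (J v) (J v)⟫)| ≤ c * ‖v‖ ^ 2 := by
      rw [abs_mul, hσ, one_mul, e]
      refine (abs_add_le _ _).trans ((add_le_add hb1 hb2).trans ?_)
      rw [← add_mul]; gcongr
    have := (abs_le.1 hb3).1
    rw [mul_sub] at this
    have hcc : c0 * ‖v‖ ^ 2 = 2 * (c * ‖v‖ ^ 2) := by rw [hc]; ring
    linarith
  refine ⟨{x | pa x} ∩ Metric.ball x0 1, Filter.inter_mem hpa (Metric.ball_mem_nhds _ one_pos),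
    Metric.ball ξ0 δ, Metric.isOpen_ball, Metric.mem_ball_self hδ, fun b hb hbs hbV => ?_⟩
  set p := Module.finrank ℝ F with hp
  set n := p + 1 with hn
  obtain ⟨B1, hB10, hB1⟩ := BddD_of_compactSupport (n + 2) hw hws
  obtain ⟨B2, hB20, hB2⟩ := BddD_of_compactSupport n hb hbs
  set V := (volume (tsupport b)).toReal with hV
  have hV0 : 0 ≤ V := ENNReal.toReal_nonneg
  obtain ⟨C1, hC10, hC1⟩ := osc_nonstat (E := E) n hcp
    (max (2 ^ n * B2 * B2) ((‖x0‖ + 1) * B1)) V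
  obtain ⟨C3, hC30, hC3⟩ := sq_lemma J hbs.isCompact
  set C2 : ℝ := 2 ^ n * (C1 + B2 * B2 * V) with hC2
  have hC20 : 0 ≤ C2 := by positivity
  set I0 : ℝ := ∫ k : F, (1 + ‖k‖) ^ (-(n : ℝ)) with hI0
  have hI00 : 0 ≤ I0 := integral_nonneg fun k => by positivity
  have hintg : Integrable (fun k : F => (1 + ‖k‖) ^ (-(n : ℝ))) := by
    apply integrable_one_add_norm
    rw [hn]; push_cast; linarith
  refine ⟨C3 * (1 + C2 * I0), by positivity, fun x hx μ hμ => ?_⟩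
  have hμ0 : 0 < μ := by linarith
  have hxn : ‖x‖ ≤ ‖x0‖ + 1 := by
    have := hx.2
    rw [mem_ball_iff_norm] at this
    have h3 := norm_le_norm_add_norm_sub' x x0
    linarith
  set φ : E → ℝ := fun ξ => ⟪x, w ξ⟫ with hφd
  have hφ : ContDiff ℝ (⊤ : ℕ∞) φ := contDiff_const.inner ℝ hw
  have hφB : BddD (n + 2) ((‖x0‖ + 1) * B1) φ := hB1.inner_left hw hxn
  -- the correlation bound
  have hM : ∀ k : F, ‖∫ ξ, ((b (ξ + J k) : ℂ) * Complex.exp (Complex.I * ((μ * φ (ξ + J k) : ℝ) : ℂ)))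
      * conj ((b ξ : ℂ) * Complex.exp (Complex.I * ((μ * φ ξ : ℝ) : ℂ)))‖
      ≤ C2 * (1 + ‖μ • k‖) ^ (-(n : ℝ)) := by
    intro k
    set a : E → ℝ := fun ξ => b (ξ + J k) * b ξ with ha
    have hbt : ContDiff ℝ (⊤ : ℕ∞) (fun ξ => b (ξ + J k)) := hb.comp (by fun_prop)
    have hac : ContDiff ℝ (⊤ : ℕ∞) a := hbt.mul hb
    have has : HasCompactSupport a := hbs.mul_left
    have hat : tsupport a ⊆ tsupport b := tsupport_mul_subset_right
    have hat' : ∀ ξ ∈ tsupport a, ξ + J k ∈ tsupport b := by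
      have : IsClosed {ξ | ξ + J k ∈ tsupport b} :=
        (isClosed_tsupport b).preimage (by fun_prop)
      have h2 : tsupport a ⊆ {ξ | ξ + J k ∈ tsupport b} := by
        refine closure_minimal (fun ξ hξ => ?_) this
        refine subset_tsupport _ ?_
        simp only [Function.mem_support, ha] at hξ ⊢
        exact left_ne_zero_of_mul hξ
      exact fun ξ hξ => h2 hξ
    have hvol : volume (tsupport a) ≤ ENNReal.ofReal V := by
      rw [ENNReal.ofReal_toReal hbs.isCompact.measure_lt_top.ne]
      exact measure_mono hat
    have e1 : ∫ ξ, ((b (ξ + J k) : ℂ) * Complex.exp (Complex.I * ((μ * φ (ξ + J k) : ℝ) : ℂ)))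
      * conj ((b ξ : ℂ) * Complex.exp (Complex.I * ((μ * φ ξ : ℝ) : ℂ)))
      = osc a (fun ξ => μ * (φ (ξ + J k) - φ ξ)) := by
      rw [osc]
      congr 1; ext ξ
      rw [map_mul, Complex.conj_ofReal, ← Complex.exp_conj, map_mul, Complex.conj_I,
        Complex.conj_ofReal]
      rw [mul_mul_mul_comm, ← Complex.exp_add]
      simp only [ha]
      push_cast
      congr 2
      ring
    rw [e1]
    have hab : ∀ ξ, |a ξ| ≤ B2 * B2 := by
      intro ξ
      simp only [ha, abs_mul]
      have h1 := hB2.norm_le ξ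
      have h2 := hB2.norm_le (ξ + J k)
      rw [Real.norm_eq_abs] at h1 h2
      gcongr
    have htriv := osc_trivial (f := fun ξ => μ * (φ (ξ + J k) - φ ξ)) hab has hvol hV0 (by positivity)
    have hnorm : ‖μ • k‖ = μ * ‖k‖ := by rw [norm_smul, Real.norm_of_nonneg hμ0.le]
    have hpos : 0 < 1 + ‖μ • k‖ := by positivity
    rw [Real.rpow_neg hpos.le, Real.rpow_natCast, ← div_eq_mul_inv, le_div_iff₀ (by positivity)]
    by_cases hk : ‖μ • k‖ ≤ 1
    · calc _ ≤ (B2 * B2 * V) * 2 ^ n := by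
            gcongr
            linarith
        _ ≤ C2 := by rw [hC2]; nlinarith [pow_pos (two_pos : (0:ℝ) < 2) n]
    · push Not at hk
      have hk0 : k ≠ 0 := by rintro rfl; simp at hk; linarith
      have hJk : J k ≠ 0 := by
        intro h0; exact hk0 (J.injective (by rw [h0, map_zero]))
      have hJn : ‖J k‖ = ‖k‖ := J.norm_map k
      have hkn : 0 < ‖k‖ := norm_pos_iff.2 hk0
      set g : E → ℝ := fun ξ => ‖J k‖⁻¹ • (φ (ξ + J k) - φ ξ) with hg
      have hφt : ContDiff ℝ (⊤ : ℕ∞) (fun ξ => φ (ξ + J k)) := hφ.comp (by fun_prop)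
      have hgc : ContDiff ℝ (⊤ : ℕ∞) g := (hφt.sub hφ).const_smul _
      have hgB : BddD (n + 1) ((‖x0‖ + 1) * B1) g := hφB.diffquot hφ hJk
      set u : E := (σ * ‖J k‖⁻¹) • J k with hu
      have hun : ‖u‖ ≤ 1 := by
        rw [hu, norm_smul, Real.norm_eq_abs, abs_mul, hσ, one_mul, abs_inv, abs_norm,
          inv_mul_cancel₀ (norm_ne_zero_iff.2 hJk)]
      have hmain := hC1 g a u (μ * ‖k‖) (by positivity) hgc hac has hun
        ((BddD.mul hbt hb (hB2.translate (J k)) hB2).mono le_rfl (le_max_left _ _))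
        ((hgB.mono le_rfl (le_max_right _ _)).fderiv_apply hgc hun) ?_ hvol
      · have e2 : (fun ξ => μ * (φ (ξ + J k) - φ ξ)) = fun ξ => (μ * ‖k‖) * g ξ := by
          ext ξ
          simp only [hg, hJn, smul_eq_mul]
          field_simp
        rw [e2]
        rw [hnorm] at hk ⊢
        rw [le_div_iff₀ (by positivity)] at hmain
        calc _ ≤ ‖osc a fun ξ => μ * ‖k‖ * g ξ‖ * (2 * (μ * ‖k‖)) ^ n := by
              gcongr
              linarith
          _ = 2 ^ n * (‖osc a fun ξ => μ * ‖k‖ * g ξ‖ * (μ * ‖k‖) ^ n) := by rw [mul_pow]; ring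
          _ ≤ 2 ^ n * C1 := by gcongr
          _ ≤ C2 := by
            rw [hC2]
            have : 0 ≤ B2 * B2 * V := by positivity
            gcongr
            linarith
      · intro ξ hξ
        have e3 : fderiv ℝ g ξ u = ‖J k‖⁻¹ * (⟪x, fderiv ℝ w (ξ + J k) u⟫ - ⟪x, fderiv ℝ w ξ u⟫) := by
          have d1 : HasFDerivAt (fun ξ => φ (ξ + J k)) (fderiv ℝ φ (ξ + J k)) ξ :=
            (hasFDerivAt_comp_add_right (J k)).2 (hφ.differentiable (by simp) (ξ + J k)).hasFDerivAt
          have d2 : HasFDerivAt φ (fderiv ℝ φ ξ) ξ := (hφ.differentiable (by simp) ξ).hasFDerivAt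
          have d3 := (d1.sub d2).const_smul (‖J k‖⁻¹)
          have d4 : fderiv ℝ g ξ = ‖J k‖⁻¹ • (fderiv ℝ φ (ξ + J k) - fderiv ℝ φ ξ) := d3.fderiv
          rw [d4]
          simp only [smul_apply, sub_apply, smul_eq_mul]
          rw [hφd, fderiv_inner_left hw, fderiv_inner_left hw]
        rw [e3]
        simp only [hu, map_smul, inner_smul_right]
        have hseg : ∀ t ∈ Set.Icc (0:ℝ) 1, ξ + t • J k ∈ Metric.ball ξ0 δ := by
          intro t ht
          have h1 : ξ ∈ Metric.ball ξ0 δ := hbV (hat hξ)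
          have h2 : ξ + J k ∈ Metric.ball ξ0 δ := hbV (hat' ξ hξ)
          have := (convex_ball ξ0 δ).add_smul_sub_mem h1 h2 ht
          simpa using this
        set θ : ℝ → ℝ := fun t => σ * ⟪x, fderiv ℝ w (ξ + t • J k) (J k)⟫ with hθ
        have hθd : ∀ t, HasDerivAt θ (σ * ⟪x, fderiv ℝ (fderiv ℝ w) (ξ + t • J k) (J k) (J k)⟫) t := by
          intro t
          have l1 : HasDerivAt (fun t : ℝ => ξ + t • J k) (J k) t := by
            simpa using ((hasDerivAt_id t).smul_const (J k)).const_add ξ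
          have l2 := (hw1.differentiable (by simp) (ξ + t • J k)).hasFDerivAt.comp_hasDerivAt t l1
          have l3 := (ContinuousLinearMap.apply ℝ E (J k)).hasFDerivAt.comp_hasDerivAt t l2
          have l4 := (innerSL ℝ x).hasFDerivAt.comp_hasDerivAt t l3
          simpa [hθ, Function.comp_def] using l4.const_mul σ
        obtain ⟨t, ht, hslope⟩ := exists_hasDerivAt_eq_slope θ _ (zero_lt_one)
          (fun t _ => (hθd t).continuousAt.continuousWithinAt) (fun t _ => hθd t)
        have hl := hlow x hx.1 _ (hseg t ⟨ht.1.le, ht.2.le⟩) k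
        rw [hslope] at hl
        simp only [hθ, one_smul, zero_smul, add_zero, sub_zero, div_one] at hl
        rw [hJn]
        have : ‖k‖⁻¹ * (σ * ‖k‖⁻¹ * ⟪x, fderiv ℝ w (ξ + J k) (J k)⟫ -
          σ * ‖k‖⁻¹ * ⟪x, fderiv ℝ w ξ (J k)⟫) = (σ * ⟪x, fderiv ℝ w (ξ + J k) (J k)⟫ -
            σ * ⟪x, fderiv ℝ w ξ (J k)⟫) / ‖k‖ ^ 2 := by field_simp
        rw [this, le_div_iff₀ (by positivity)]
        exact hl
  have hint2 : Integrable (fun k : F => C2 * (1 + ‖μ • k‖) ^ (-(n : ℝ))) :=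
    (hintg.comp_smul hμ0.ne').const_mul C2
  have hval : ∫ k : F, C2 * (1 + ‖μ • k‖) ^ (-(n : ℝ)) = C2 * ((μ ^ p)⁻¹ * I0) := by
    rw [integral_const_mul, Measure.integral_comp_smul volume (fun k : F => (1 + ‖k‖) ^ (-(n : ℝ)))]
    rw [abs_of_pos (by positivity), smul_eq_mul]
  have hfc : Continuous (fun ξ => (b ξ : ℂ) * Complex.exp (Complex.I * ((μ * φ ξ : ℝ) : ℂ))) := by
    have h1 : Continuous b := hb.continuous
    have h2 : Continuous φ := hφ.continuous
    fun_prop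
  have hfin := hC3 _ _ _ (μ ^ (-((p : ℝ) / 2))) hfc
    (fun ξ hξ => by rw [image_eq_zero_of_notMem_tsupport hξ]; simp) hint2 hval.le hM
    (by positivity)
  refine hfin.trans (le_of_eq ?_)
  have hp2 : (μ ^ p)⁻¹ = μ ^ (-((p : ℝ) / 2)) * μ ^ (-((p : ℝ) / 2)) := by
    rw [← Real.rpow_add hμ0, ← Real.rpow_natCast, ← Real.rpow_neg hμ0.le]
    congr 1; ring
  rw [hp2]
  have : 0 < μ ^ (-((p : ℝ) / 2)) := by positivity
  field_simp
end PartD2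

section PartE1
variable {E : Type*} [NormedAddCommGroup E] [InnerProductSpace ℝ E] [FiniteDimensional ℝ E]
  [MeasurableSpace E] [BorelSpace E]

lemma osc_integrable {b f : E → ℝ} (hb : Continuous b) (hf : Continuous f)
    (hbs : HasCompactSupport b) :
    Integrable (fun ξ => (b ξ : ℂ) * Complex.exp (Complex.I * (f ξ : ℂ))) := by
  refine Continuous.integrable_of_hasCompactSupport (by fun_prop) ?_
  refine HasCompactSupport.intro hbs (fun ξ hξ => ?_)
  rw [image_eq_zero_of_notMem_tsupport hξ]; simp

open scoped Manifold in
lemma decay_fixed {w : E → E} (hw : ContDiff ℝ (⊤ : ℕ∞) w) {p : ℝ} {b : E → ℝ}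
    (hb : ContDiff ℝ (⊤ : ℕ∞) b) (hbs : HasCompactSupport b) (x0 : E)
    (h : ∀ ξ0 ∈ tsupport b, LocDecay w p x0 ξ0) :
    ∃ U ∈ 𝓝 x0, ∃ C : ℝ, 0 ≤ C ∧ ∀ x ∈ U, ∀ μ : ℝ, 1 ≤ μ →
      ‖osc b (fun ξ => μ * ⟪x, w ξ⟫)‖ ≤ C * μ ^ (-p) := by
  have h' : ∀ ξ0 : tsupport b, LocDecay w p x0 ξ0 := fun ξ0 => h ξ0 ξ0.2
  choose U hU V hVo hξV hC using h'
  obtain ⟨t, ht⟩ := hbs.isCompact.elim_finite_subcover V hVo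
    (fun ξ hξ => Set.mem_iUnion.2 ⟨⟨ξ, hξ⟩, hξV ⟨ξ, hξ⟩⟩)
  obtain ⟨f, hf⟩ := SmoothPartitionOfUnity.exists_isSubordinate 𝓘(ℝ, E) (isClosed_tsupport b)
    (fun i : t => V i) (fun i => hVo i) (by
      intro ξ hξ
      have := ht hξ
      simp only [Set.mem_iUnion] at this ⊢
      obtain ⟨i, hi, hm⟩ := this
      exact ⟨⟨i, hi⟩, hm⟩)
  have hfc : ∀ i, ContDiff ℝ (⊤ : ℕ∞) (f i) := fun i => (f i).contMDiff.contDiff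
  have hbi : ∀ i, ContDiff ℝ (⊤ : ℕ∞) (fun ξ => f i ξ * b ξ) := fun i => (hfc i).mul hb
  have hbis : ∀ i, HasCompactSupport (fun ξ => f i ξ * b ξ) := fun i => hbs.mul_left
  have hC' : ∀ i : t, ∃ C : ℝ, 0 ≤ C ∧ ∀ x ∈ U i, ∀ μ : ℝ, 1 ≤ μ →
      ‖osc (fun ξ => f i ξ * b ξ) (fun ξ => μ * ⟪x, w ξ⟫)‖ ≤ C * μ ^ (-p) := fun i =>
    hC i _ (hbi i) (hbis i) ((tsupport_mul_subset_left).trans (hf i))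
  choose C hC0 hCC using hC'
  refine ⟨⋂ i : t, U i, Filter.iInter_mem.2 fun i => hU i, ∑ i, C i,
    Finset.sum_nonneg fun i _ => hC0 i, fun x hx μ hμ => ?_⟩
  have e1 : osc b (fun ξ => μ * ⟪x, w ξ⟫)
      = ∑ i, osc (fun ξ => f i ξ * b ξ) (fun ξ => μ * ⟪x, w ξ⟫) := by
    simp only [osc]
    rw [← integral_finsetSum]
    · congr 1; ext ξ
      rw [← Finset.sum_mul]
      congr 1
      by_cases hξ : ξ ∈ tsupport b
      · have h1 := f.sum_eq_one hξ
        rw [finsum_eq_sum_of_fintype] at h1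
        rw [← Complex.ofReal_sum, ← Finset.sum_mul, h1, one_mul]
      · simp [image_eq_zero_of_notMem_tsupport hξ]
    · intro i _
      have h1 : Continuous w := hw.continuous
      exact osc_integrable (hbi i).continuous (by fun_prop) (hbis i)
  rw [e1, Finset.sum_mul]
  exact norm_sum_le_of_le _ fun i _ => hCC i x (Set.mem_iInter.1 hx i) μ hμ

lemma decay_global {w : E → E} (hw : ContDiff ℝ (⊤ : ℕ∞) w) {p : ℝ} (hp : 0 ≤ p) {b : E → ℝ}
    (hb : ContDiff ℝ (⊤ : ℕ∞) b) (hbs : HasCompactSupport b)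
    (h : ∀ x0 : E, ‖x0‖ = 1 → ∀ ξ0 ∈ tsupport b, LocDecay w p x0 ξ0) :
    ∃ C : ℝ, 0 ≤ C ∧ ∀ x, ‖osc b (fun ξ => ⟪x, w ξ⟫)‖ ≤ C * (1 + ‖x‖) ^ (-p) := by
  have key : ∃ C : ℝ, 0 ≤ C ∧ ∀ x ∈ Metric.sphere (0 : E) 1, ∀ μ : ℝ, 1 ≤ μ →
      ‖osc b (fun ξ => μ * ⟪x, w ξ⟫)‖ ≤ C * μ ^ (-p) := by
    refine (isCompact_sphere (0 : E) 1).induction_on (p := fun S => ∃ C : ℝ, 0 ≤ C ∧ ∀ x ∈ S,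
      ∀ μ : ℝ, 1 ≤ μ → ‖osc b (fun ξ => μ * ⟪x, w ξ⟫)‖ ≤ C * μ ^ (-p)) ?_ ?_ ?_ ?_
    · exact ⟨0, le_rfl, fun x hx => hx.elim⟩
    · rintro s t hst ⟨C, hC0, hC⟩
      exact ⟨C, hC0, fun x hx => hC x (hst hx)⟩
    · rintro s t ⟨C, hC0, hC⟩ ⟨C', hC0', hC'⟩
      refine ⟨max C C', le_max_of_le_left hC0, fun x hx μ hμ => ?_⟩
      have hμ0 : 0 < μ := by linarith
      rcases hx with hx | hx
      · refine (hC x hx μ hμ).trans ?_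
        gcongr; exact le_max_left _ _
      · refine (hC' x hx μ hμ).trans ?_
        gcongr; exact le_max_right _ _
    · intro x0 hx0
      obtain ⟨U, hU, hC⟩ := decay_fixed hw hb hbs x0 (h x0 (by simpa using hx0))
      exact ⟨U, mem_nhdsWithin_of_mem_nhds hU, hC⟩
  obtain ⟨C, hC0, hC⟩ := key
  obtain ⟨B, hB0, hB⟩ := BddD_of_compactSupport 0 hb hbs
  set V := (volume (tsupport b)).toReal with hV
  have hV0 : 0 ≤ V := ENNReal.toReal_nonneg
  refine ⟨2 ^ p * (C + B * V), by positivity, fun x => ?_⟩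
  have h2p : (0:ℝ) < 2 ^ p := by positivity
  have h1x : 0 < 1 + ‖x‖ := by positivity
  rw [Real.rpow_neg h1x.le, ← div_eq_mul_inv, le_div_iff₀ (by positivity)]
  by_cases hx : ‖x‖ ≤ 1
  · have h1 := osc_trivial (f := fun ξ => ⟪x, w ξ⟫) (B := B) (V := V) (fun ξ => hB.norm_le ξ) hbs
      (by rw [ENNReal.ofReal_toReal hbs.isCompact.measure_lt_top.ne]) hV0 hB0
    calc _ ≤ (B * V) * 2 ^ p := by
          gcongr; linarith
      _ ≤ _ := by nlinarith
  · push Not at hx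
    have hx0 : 0 < ‖x‖ := by linarith
    have h1 := hC (‖x‖⁻¹ • x) (by
      simp [norm_smul, hx0.ne']) ‖x‖ hx.le
    have h2 : (fun ξ => ‖x‖ * ⟪‖x‖⁻¹ • x, w ξ⟫) = fun ξ => ⟪x, w ξ⟫ := by
      ext ξ
      rw [real_inner_smul_left, ← mul_assoc, mul_inv_cancel₀ hx0.ne', one_mul]
    rw [h2, Real.rpow_neg hx0.le, ← div_eq_mul_inv, le_div_iff₀ (by positivity)] at h1
    calc _ ≤ ‖osc b fun ξ => ⟪x, w ξ⟫‖ * (2 * ‖x‖) ^ p := by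
          gcongr; linarith
      _ = 2 ^ p * (‖osc b fun ξ => ⟪x, w ξ⟫‖ * ‖x‖ ^ p) := by
          rw [Real.mul_rpow (by norm_num) hx0.le]; ring
      _ ≤ 2 ^ p * C := by gcongr
      _ ≤ _ := by
          have : 0 ≤ B * V := by positivity
          nlinarith
end PartE1

section PartE2
variable {d : ℕ} {Ω : Set (Euc d)} {ρ : Euc d → ℝ}

lemma IsMinkowskiGauge.comp_smooth (hρ : IsMinkowskiGauge d Ω ρ) {G : Type*} [NormedAddCommGroup G]
    [NormedSpace ℝ G] {g : ℝ → G} (hg : ContDiff ℝ (⊤ : ℕ∞) g) (h0 : (0:ℝ) ∉ tsupport g) :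
    ContDiff ℝ (⊤ : ℕ∞) (fun ξ => g (ρ ξ)) := by
  rw [contDiff_iff_contDiffAt]
  intro ξ
  by_cases hξ : ξ = 0
  · have h1 : ∀ᶠ t in 𝓝 (ρ ξ), g t = 0 := by
      rw [hξ, hρ.zero]
      filter_upwards [(isClosed_tsupport g).isOpen_compl.mem_nhds h0] with t ht
      exact image_eq_zero_of_notMem_tsupport ht
    have h2 : ∀ᶠ η in 𝓝 ξ, g (ρ η) = 0 := hρ.cont.continuousAt.eventually h1
    exact (contDiffAt_const (c := (0 : G))).congr_of_eventuallyEq h2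
  · exact hg.contDiffAt.comp ξ (hρ.cdAt hξ)

lemma IsMinkowskiGauge.comp_compact (hρ : IsMinkowskiGauge d Ω ρ) {G : Type*} [NormedAddCommGroup G]
    {g : ℝ → G} (hs : HasCompactSupport g) : HasCompactSupport (fun ξ => g (ρ ξ)) := by
  obtain ⟨m, M, hm, hM, hb⟩ := hρ.bounds
  obtain ⟨R, hR⟩ := hs.isCompact.isBounded.subset_closedBall 0
  refine HasCompactSupport.intro (isCompact_closedBall (0 : Euc d) (R / m)) (fun ξ hξ => ?_)
  refine image_eq_zero_of_notMem_tsupport (fun h => hξ ?_)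
  have h1 := hR h
  rw [mem_closedBall_zero_iff, Real.norm_of_nonneg (hρ.nonneg ξ)] at h1
  rw [mem_closedBall_zero_iff, le_div_iff₀ hm, mul_comm]
  exact (hb ξ).1.trans h1

lemma exists_cutoff : ∃ ζ : ℝ → ℝ, ContDiff ℝ (⊤ : ℕ∞) ζ ∧ HasCompactSupport ζ ∧
    tsupport ζ ⊆ Set.Icc (1/8) (33/8) ∧ (∀ t ∈ Set.Icc (1/4 : ℝ) 4, ζ t = 1) ∧
    (∀ t, 0 ≤ ζ t) ∧ ∀ t, ζ t ≤ 1 := by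
  let p : ContDiffBump (17/8 : ℝ) := ⟨15/8, 2, by norm_num, by norm_num⟩
  refine ⟨p, p.contDiff, p.hasCompactSupport, ?_, ?_, fun t => p.nonneg, fun t => p.le_one⟩
  · rw [p.tsupport_eq, Real.closedBall_eq_Icc]
    have : p.rOut = 2 := rfl
    rw [this]; norm_num
  · intro t ht
    refine p.one_of_mem_closedBall ?_
    rw [Real.closedBall_eq_Icc]
    have : p.rIn = 15/8 := rfl
    rw [this]; norm_num; norm_num at ht; exact ht

/-- A smooth compactly supported extension of `ξ/ρ(ξ)`. -/
lemma IsMinkowskiGauge.exists_w (hρ : IsMinkowskiGauge d Ω ρ) :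
    ∃ w : Euc d → Euc d, ContDiff ℝ (⊤ : ℕ∞) w ∧ HasCompactSupport w ∧
      ∀ ξ, 1/4 ≤ ρ ξ → ρ ξ ≤ 4 → w ξ = (ρ ξ)⁻¹ • ξ := by
  obtain ⟨ζ, hζ, hζs, hζt, hζ1, -, -⟩ := exists_cutoff
  have h0 : (0 : ℝ) ∉ tsupport ζ := fun h => by have := (hζt h).1; norm_num at this
  have hsub : tsupport (fun t : ℝ => ζ t * t⁻¹) ⊆ tsupport ζ := tsupport_mul_subset_left
  have hg : ContDiff ℝ (⊤ : ℕ∞) (fun t : ℝ => ζ t * t⁻¹) := by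
    rw [contDiff_iff_contDiffAt]
    intro t
    by_cases ht : t = 0
    · have h1 : ∀ᶠ s in 𝓝 t, ζ s * s⁻¹ = 0 := by
        rw [ht]
        filter_upwards [(isClosed_tsupport ζ).isOpen_compl.mem_nhds h0] with s hs
        rw [image_eq_zero_of_notMem_tsupport hs, zero_mul]
      exact (contDiffAt_const (c := (0 : ℝ))).congr_of_eventuallyEq h1
    · exact hζ.contDiffAt.mul (contDiffAt_inv ℝ ht)
  have hgs : HasCompactSupport (fun t : ℝ => ζ t * t⁻¹) := hζs.mul_right
  refine ⟨fun ξ => (ζ (ρ ξ) * (ρ ξ)⁻¹) • ξ, ?_, ?_, ?_⟩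
  · exact (hρ.comp_smooth hg (fun h => h0 (hsub h))).smul contDiff_id
  · exact (hρ.comp_compact hgs).smul_right
  · intro ξ h1 h2
    simp only [hζ1 _ ⟨h1, h2⟩, one_mul]

lemma IsMinkowskiGauge.locDecay (hd : 2 ≤ d) (hρ : IsMinkowskiGauge d Ω ρ)
    (hcurv : HasNonvanishingCurvature d ρ) {w : Euc d → Euc d} (hw : ContDiff ℝ (⊤ : ℕ∞) w)
    (hws : HasCompactSupport w) (hwρ : ∀ ξ, 1/4 ≤ ρ ξ → ρ ξ ≤ 4 → w ξ = (ρ ξ)⁻¹ • ξ)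
    {x0 : Euc d} (hx0 : ‖x0‖ = 1) {ξ0 : Euc d} (h1 : 1/4 < ρ ξ0) (h4 : ρ ξ0 < 4) :
    LocDecay w (((d : ℝ) - 1) / 2) x0 ξ0 := by
  by_cases hst : ∃ u, ⟪x0, fderiv ℝ w ξ0 u⟫ ≠ 0
  · obtain ⟨u, hu⟩ := hst
    set a := ⟪x0, fderiv ℝ w ξ0 u⟫ with ha
    have hu0 : u ≠ 0 := by rintro rfl; simp [ha] at hu
    have hun : 0 < ‖u‖ := norm_pos_iff.2 hu0
    refine locDecay_nonstat (n := d) (u := (SignType.sign a * ‖u‖⁻¹ : ℝ) • u) hw hws ?_ ?_ ?_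
    · linarith [(Nat.cast_nonneg d : (0:ℝ) ≤ d)]
    · rw [map_smul, inner_smul_right, ← ha]
      have : (SignType.sign a : ℝ) * a = |a| := sign_mul_self a
      have h5 : (SignType.sign a * ‖u‖⁻¹ : ℝ) * a = |a| * ‖u‖⁻¹ := by rw [← this]; ring
      rw [h5]
      have := abs_pos.2 hu
      positivity
    · rw [norm_smul, norm_mul, norm_inv, norm_norm, mul_assoc, inv_mul_cancel₀ hun.ne', mul_one]
      rcases lt_trichotomy a 0 with h | h | h
      · simp [sign_neg h]
      · exact absurd h hu
      · simp [sign_pos h]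
  · push Not at hst
    have hξ0 : ξ0 ≠ 0 := hρ.ne_zero (by linarith)
    have hρ0 : 0 < ρ ξ0 := by linarith
    set φ : Euc d → ℝ := fun ξ => ⟪x0, w ξ⟫ with hφ
    have hφd : ∀ ξ, HasFDerivAt φ ((innerSL ℝ x0).comp (fderiv ℝ w ξ)) ξ := fun ξ =>
      (innerSL ℝ x0).hasFDerivAt.comp ξ (hw.differentiable (by simp) ξ).hasFDerivAt
    have hO : IsOpen {ξ | 1/4 < ρ ξ ∧ ρ ξ < 4} :=
      (isOpen_lt continuous_const hρ.cont).inter (isOpen_lt hρ.cont continuous_const)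
    have e0 : ∀ ξ, 1/4 < ρ ξ → ρ ξ < 4 → ρ ξ * φ ξ = ⟪x0, ξ⟫ := by
      intro ξ ha hb
      have : ρ ξ ≠ 0 := by linarith
      simp only [hφ]
      rw [hwρ ξ ha.le hb.le, inner_smul_right, ← mul_assoc, mul_inv_cancel₀ this, one_mul]
    have e1 : ∀ ξ, 1/4 < ρ ξ → ρ ξ < 4 → ∀ v,
        ρ ξ * ⟪x0, fderiv ℝ w ξ v⟫ + φ ξ * fderiv ℝ ρ ξ v = ⟪x0, v⟫ := by
      intro ξ ha hb v
      have hξ : ξ ≠ 0 := hρ.ne_zero (by linarith)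
      have d1 := (hρ.diffAt hξ).hasFDerivAt.mul (hφd ξ)
      have d2 : HasFDerivAt (fun ξ => ρ ξ * φ ξ) (innerSL ℝ x0) ξ := by
        refine (innerSL ℝ x0).hasFDerivAt.congr_of_eventuallyEq ?_
        filter_upwards [hO.mem_nhds ⟨ha, hb⟩] with η hη
        exact e0 η hη.1 hη.2
      have := congrArg (fun L : Euc d →L[ℝ] ℝ => L v) (d1.unique d2)
      simpa using this
    have hφ0 : φ ξ0 ≠ 0 := by
      intro h0
      have := e1 ξ0 h1 h4 x0
      rw [hst x0, h0] at this
      simp [hx0] at this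
    have hw1 : ContDiff ℝ (⊤ : ℕ∞) (fderiv ℝ w) := hw.fderiv_right (by simp)
    have e2 : ∀ v, ρ ξ0 * ⟪x0, fderiv ℝ (fderiv ℝ w) ξ0 v v⟫
        = - (φ ξ0 * fderiv ℝ (fderiv ℝ ρ) ξ0 v v) := by
      intro v
      have l1 : HasDerivAt (fun t : ℝ => ξ0 + t • v) v 0 := by
        simpa using ((hasDerivAt_id (0:ℝ)).smul_const v).const_add ξ0
      have z : ξ0 + (0:ℝ) • v = ξ0 := by simp
      have dρ : HasDerivAt (fun t : ℝ => ρ (ξ0 + t • v)) (fderiv ℝ ρ ξ0 v) 0 := by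
        have := (hρ.diffAt hξ0).hasFDerivAt
        rw [← z] at this
        have h := this.comp_hasDerivAt (0:ℝ) l1
        rwa [z] at h
      have dφ : HasDerivAt (fun t : ℝ => φ (ξ0 + t • v)) 0 0 := by
        have := hφd ξ0
        rw [← z] at this
        have h := this.comp_hasDerivAt (0:ℝ) l1
        rw [z] at h
        have hz : ((innerSL ℝ x0).comp (fderiv ℝ w ξ0)) v = 0 := by simp [hst v]
        rw [hz] at h
        exact h
      have dA : HasDerivAt (fun t : ℝ => fderiv ℝ ρ (ξ0 + t • v) v)
          (fderiv ℝ (fderiv ℝ ρ) ξ0 v v) 0 := by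
        have := (hρ.diffAt2 hξ0).hasFDerivAt
        rw [← z] at this
        have h := this.comp_hasDerivAt (0:ℝ) l1
        rw [z] at h
        exact (ContinuousLinearMap.apply ℝ ℝ v).hasFDerivAt.comp_hasDerivAt (0:ℝ) h
      have dB : HasDerivAt (fun t : ℝ => ⟪x0, fderiv ℝ w (ξ0 + t • v) v⟫)
          (⟪x0, fderiv ℝ (fderiv ℝ w) ξ0 v v⟫) 0 := by
        have := (hw1.differentiable (by simp) ξ0).hasFDerivAt
        rw [← z] at this
        have h := this.comp_hasDerivAt (0:ℝ) l1
        rw [z] at h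
        have h3 := (ContinuousLinearMap.apply ℝ (Euc d) v).hasFDerivAt.comp_hasDerivAt (0:ℝ) h
        exact (innerSL ℝ x0).hasFDerivAt.comp_hasDerivAt (0:ℝ) h3
      have dS := (dρ.mul dB).add (dφ.mul dA)
      have dC : HasDerivAt ((fun t : ℝ => ρ (ξ0 + t • v)) * (fun t : ℝ => ⟪x0, fderiv ℝ w (ξ0 + t • v) v⟫)
          + (fun t : ℝ => φ (ξ0 + t • v)) * (fun t : ℝ => fderiv ℝ ρ (ξ0 + t • v) v)) 0 0 := by
        refine (hasDerivAt_const (0:ℝ) (⟪x0, v⟫ : ℝ)).congr_of_eventuallyEq ?_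
        have hc : ContinuousAt (fun t : ℝ => ξ0 + t • v) 0 := l1.continuousAt
        have := hc.eventually (hO.mem_nhds (by
          show ξ0 + (0:ℝ) • v ∈ _
          rw [z]; exact ⟨h1, h4⟩))
        filter_upwards [this] with t ht
        exact e1 _ ht.1 ht.2 v
      have := dS.unique dC
      simp only [z, hst v] at this
      linarith
    -- the subspace
    set H : Submodule ℝ (Euc d) := (ℝ ∙ ξ0)ᗮ with hH
    have hfr : Module.finrank ℝ H = d - 1 := by
      have : Fact (Module.finrank ℝ (Euc d) = (d - 1) + 1) :=
        ⟨by rw [finrank_euclideanSpace_fin]; omega⟩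
      exact Submodule.finrank_orthogonal_span_singleton hξ0
    have hpos : ∀ v : H, v ≠ 0 → 0 < fderiv ℝ (fderiv ℝ ρ) ξ0 v v := by
      intro v hv
      refine hρ.hess_pos hd hcurv hξ0 (by simpa using hv) ?_
      exact Submodule.mem_orthogonal_singleton_iff_inner_right.1 v.2
    obtain ⟨c, hc0, hc⟩ := (isCompact_sphere (0 : H) 1).exists_forall_le' (f := fun v : H =>
      fderiv ℝ (fderiv ℝ ρ) ξ0 v v) (a := 0) (by
        apply Continuous.continuousOn; fun_prop) (fun v hv => hpos v (by
          rintro rfl; simp at hv))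
    have hcv : ∀ v : H, c * ‖v‖ ^ 2 ≤ fderiv ℝ (fderiv ℝ ρ) ξ0 v v := by
      intro v
      by_cases hv : v = 0
      · simp [hv]
      · have hvn : 0 < ‖v‖ := norm_pos_iff.2 hv
        have := hc (‖v‖⁻¹ • v) (by
          rw [mem_sphere_zero_iff_norm, norm_smul, norm_inv, norm_norm]
          exact inv_mul_cancel₀ hvn.ne')
        simp only [Submodule.coe_smul, map_smul, smul_apply, smul_eq_mul] at this
        rw [← mul_assoc, ← mul_inv, inv_mul_eq_div, le_div_iff₀ (by positivity)] at this
        rw [pow_two]; exact this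
    have hfin := locDecay_stat hw hws H.subtypeₗᵢ (x0 := x0) (ξ0 := ξ0)
      (σ := -(SignType.sign (φ ξ0) : ℝ)) (c0 := |φ ξ0| / ρ ξ0 * c) (by
        rw [abs_neg]
        rcases lt_trichotomy (φ ξ0) 0 with h | h | h
        · simp [sign_neg h]
        · exact absurd h hφ0
        · simp [sign_pos h]) (by have := abs_pos.2 hφ0; positivity) (by
        intro v
        have h5 := e2 v
        have h6 : ⟪x0, fderiv ℝ (fderiv ℝ w) ξ0 v v⟫
            = - (φ ξ0 * fderiv ℝ (fderiv ℝ ρ) ξ0 v v) / ρ ξ0 := by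
          rw [eq_div_iff hρ0.ne', mul_comm]; exact h5
        simp only [Submodule.coe_subtypeₗᵢ, Submodule.coe_subtype]
        rw [h6]
        have h7 : (SignType.sign (φ ξ0) : ℝ) * φ ξ0 = |φ ξ0| := sign_mul_self _
        have h8 : -(SignType.sign (φ ξ0) : ℝ) * (-(φ ξ0 * fderiv ℝ (fderiv ℝ ρ) ξ0 v v) / ρ ξ0)
          = |φ ξ0| / ρ ξ0 * fderiv ℝ (fderiv ℝ ρ) ξ0 v v := by rw [← h7]; ring
        rw [h8, mul_assoc]
        have := hcv v
        gcongr)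
    rw [hfr] at hfin
    have : (((d - 1 : ℕ) : ℝ)) = (d : ℝ) - 1 := by
      rw [Nat.cast_sub (by omega)]; simp
    rwa [this] at hfin

/-- The main decay estimate: amplitude `β(ρ)`, phase `⟨x, ξ/ρ(ξ)⟩`. -/
lemma IsMinkowskiGauge.decay (hd : 2 ≤ d) (hρ : IsMinkowskiGauge d Ω ρ)
    (hcurv : HasNonvanishingCurvature d ρ) {β : ℝ → ℝ} (hβ : ContDiff ℝ (⊤ : ℕ∞) β)
    (hβs : tsupport β ⊆ Set.Icc (1/2) 2) :
    ∃ C : ℝ, 0 ≤ C ∧ ∀ x, ‖osc (fun ξ => β (ρ ξ)) (fun ξ => ⟪x, (ρ ξ)⁻¹ • ξ⟫)‖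
      ≤ C * (1 + ‖x‖) ^ (-(((d : ℝ) - 1) / 2)) := by
  obtain ⟨w, hw, hws, hwρ⟩ := hρ.exists_w
  have hβc : HasCompactSupport β :=
    HasCompactSupport.of_support_subset_isCompact isCompact_Icc ((subset_tsupport β).trans hβs)
  have hb : ContDiff ℝ (⊤ : ℕ∞) (fun ξ => β (ρ ξ)) :=
    hρ.comp_smooth hβ (fun h => by have := (hβs h).1; norm_num at this)
  have hbs := hρ.comp_compact hβc
  have hts : ∀ ξ ∈ tsupport (fun ξ => β (ρ ξ)), 1/2 ≤ ρ ξ ∧ ρ ξ ≤ 2 := by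
    have hcl : IsClosed {ξ | ρ ξ ∈ tsupport β} := (isClosed_tsupport β).preimage hρ.cont
    have : tsupport (fun ξ => β (ρ ξ)) ⊆ {ξ | ρ ξ ∈ tsupport β} :=
      closure_minimal (fun ξ hξ => subset_tsupport _ hξ) hcl
    exact fun ξ hξ => hβs (this hξ)
  have hd1 : (0:ℝ) ≤ ((d : ℝ) - 1) / 2 := by
    have : (2:ℝ) ≤ d := by exact_mod_cast hd
    linarith
  obtain ⟨C, hC0, hC⟩ := decay_global hw hd1 hb hbs (fun x0 hx0 ξ0 hξ0 =>
    hρ.locDecay hd hcurv hw hws hwρ hx0 (by linarith [(hts ξ0 hξ0).1]) (by linarith [(hts ξ0 hξ0).2]))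
  refine ⟨C, hC0, fun x => ?_⟩
  have e : osc (fun ξ => β (ρ ξ)) (fun ξ => ⟪x, (ρ ξ)⁻¹ • ξ⟫) = osc (fun ξ => β (ρ ξ)) (fun ξ => ⟪x, w ξ⟫) := by
    simp only [osc]
    congr 1; ext ξ
    by_cases h : ξ ∈ tsupport (fun ξ => β (ρ ξ))
    · have := hts ξ h
      rw [hwρ ξ (by linarith) (by linarith)]
    · have : β (ρ ξ) = 0 := image_eq_zero_of_notMem_tsupport (f := fun ξ => β (ρ ξ)) h
      simp [this]
  rw [e]; exact hC x
end PartE2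

section PartF1
variable {d : ℕ} {Ω : Set (Euc d)} {ρ : Euc d → ℝ}

/-- continuous version of `1/r`. -/
def kap (r : ℝ) : ℝ := (max r (1/4))⁻¹

lemma kap_cont : Continuous kap := by
  unfold kap
  refine Continuous.inv₀ (by fun_prop) (fun r => ?_)
  have := le_max_right r (1/4); linarith

lemma kap_pos (r : ℝ) : 0 < kap r := by
  unfold kap
  have := le_max_right r (1/4); exact inv_pos.2 (by linarith)

lemma kap_eq {r : ℝ} (h : 1/4 ≤ r) : kap r = r⁻¹ := by
  unfold kap; rw [max_eq_left h]

lemma kap_eq' {r : ℝ} (h : r ≤ 1/4) : kap r = 4 := by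
  unfold kap; rw [max_eq_right h]; norm_num

lemma exists_b : ∃ b : ℝ → ℝ, ContDiff ℝ (⊤ : ℕ∞) b ∧ (∀ t, 0 ≤ b t) ∧
    (∀ t, t ∉ Set.Icc (1/2 : ℝ) 2 → b t = 0) ∧ 0 < ∫ t, b t := by
  let p : ContDiffBump (5/4 : ℝ) := ⟨1/4, 1/2, by norm_num, by norm_num⟩
  refine ⟨p, p.contDiff, fun t => p.nonneg, fun t ht => ?_, p.integral_pos⟩
  by_contra h
  have : t ∈ Function.support p := h
  rw [p.support_eq, Real.ball_eq_Ioo] at this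
  have e : p.rOut = 1/2 := rfl
  rw [e] at this
  exact ht ⟨by linarith [this.1], by linarith [this.2]⟩

lemma beta_smooth {b : ℝ → ℝ} (hb : ContDiff ℝ (⊤ : ℕ∞) b)
    (hbs : ∀ t, t ∉ Set.Icc (1/2 : ℝ) 2 → b t = 0) (d : ℕ) :
    ContDiff ℝ (⊤ : ℕ∞) (fun r => b (kap r) * kap r ^ (d+1)) ∧
    tsupport (fun r => b (kap r) * kap r ^ (d+1)) ⊆ Set.Icc (1/2) 2 := by
  have z : ∀ r, r ∉ Set.Icc (1/2 : ℝ) 2 → b (kap r) * kap r ^ (d+1) = 0 := by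
    intro r hr
    rw [hbs, zero_mul]
    intro h
    apply hr
    by_cases h4 : r ≤ 1/4
    · rw [kap_eq' h4] at h; norm_num at h
    · push Not at h4
      rw [kap_eq h4.le] at h
      have h0 : 0 < r := by linarith
      have e1 : 1/2 * r ≤ 1 := by
        have := mul_le_mul_of_nonneg_right h.1 h0.le
        rwa [inv_mul_cancel₀ h0.ne'] at this
      have e2 : 1 ≤ 2 * r := by
        have := mul_le_mul_of_nonneg_right h.2 h0.le
        rwa [inv_mul_cancel₀ h0.ne'] at this
      exact ⟨by linarith, by linarith⟩
  refine ⟨?_, closure_minimal (fun r hr => ?_) isClosed_Icc⟩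
  · rw [contDiff_iff_contDiffAt]
    intro r
    by_cases hr : r < 1/2
    · refine (contDiffAt_const (c := (0:ℝ))).congr_of_eventuallyEq ?_
      filter_upwards [Iio_mem_nhds hr] with t ht
      exact z t (fun h => by have := h.1; simp at ht; linarith)
    · push Not at hr
      have h1 : ContDiffAt ℝ (⊤ : ℕ∞) (fun r : ℝ => b r⁻¹ * r⁻¹ ^ (d+1)) r := by
        have hi : ContDiffAt ℝ (⊤ : ℕ∞) (fun r : ℝ => r⁻¹) r := contDiffAt_inv ℝ (by linarith)
        exact (hb.contDiffAt.comp r hi).mul (hi.pow _)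
      refine h1.congr_of_eventuallyEq ?_
      filter_upwards [Ioi_mem_nhds (show (1/4:ℝ) < r by linarith)] with t ht
      rw [kap_eq (le_of_lt ht)]
  · by_contra h
    exact hr (z r h)

lemma IsMinkowskiGauge.compact_sublevel (hρ : IsMinkowskiGauge d Ω ρ) (R : ℝ) :
    IsCompact {ξ | ρ ξ ≤ R} := by
  obtain ⟨m, M, hm, hM, hb⟩ := hρ.bounds
  refine (isCompact_closedBall (0 : Euc d) (R / m)).of_isClosed_subset
    (isClosed_le hρ.cont continuous_const) (fun ξ hξ => ?_)
  rw [mem_closedBall_zero_iff, le_div_iff₀ hm, mul_comm]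
  exact (hb ξ).1.trans hξ

lemma IsMinkowskiGauge.polar (hd : 2 ≤ d) (hρ : IsMinkowskiGauge d Ω ρ) :
    ∃ (c : ℝ) (β : ℝ → ℝ), 0 < c ∧ ContDiff ℝ (⊤ : ℕ∞) β ∧ tsupport β ⊆ Set.Icc (1/2) 2 ∧
      ∀ (g : ℝ → ℂ), Continuous g → (∀ t, t ∉ Set.Icc (1/2 : ℝ) 2 → g t = 0) → ∀ x : Euc d,
      (c : ℂ) * ∫ ξ, g (ρ ξ) * Complex.exp (Complex.I * ((⟪x, ξ⟫ : ℝ) : ℂ))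
      = ∫ ξ, (β (ρ ξ) : ℂ) * ∫ t : ℝ, ((t ^ (d-1) : ℝ) : ℂ) * g t *
          Complex.exp (Complex.I * ((t * ⟪x, (ρ ξ)⁻¹ • ξ⟫ : ℝ) : ℂ)) := by
  obtain ⟨b, hb, hb0, hbs, hbi⟩ := exists_b
  have hβ := beta_smooth hb hbs d
  refine ⟨∫ t, b t, _, hbi, hβ.1, hβ.2, fun g hg hgs x => ?_⟩
  have hkc := kap_cont
  have hbc := hb.continuous
  have hρc := hρ.cont
  have z1 : ∀ r v : ℝ, r ∈ Set.Icc (1/2:ℝ) 2 → v * kap r ∈ Set.Icc (1/2:ℝ) 2 → v ∈ Set.Icc (0:ℝ) 4 := by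
    intro r v hr hv
    rw [kap_eq (by linarith [hr.1]), ← div_eq_mul_inv] at hv
    have h0 : 0 < r := by linarith [hr.1]
    have := (le_div_iff₀ h0).1 hv.1
    have := (div_le_iff₀ h0).1 hv.2
    exact ⟨by nlinarith [hr.1], by nlinarith [hr.2]⟩
  set A : Euc d → ℝ → ℂ := fun η v => g (ρ η) * Complex.exp (Complex.I * ((⟪x, η⟫ : ℝ) : ℂ)) *
    ((b (v * kap (ρ η)) * kap (ρ η) : ℝ) : ℂ) with hA
  set B : ℝ → Euc d → ℂ := fun v ξ => ((b (kap (ρ ξ)) * kap (ρ ξ) : ℝ) : ℂ) * (((v ^ (d-1) : ℝ) : ℂ) *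
    g (v * ρ ξ) * Complex.exp (Complex.I * ((v * ⟪x, ξ⟫ : ℝ) : ℂ))) with hB
  have s1 : (((∫ t, b t : ℝ)) : ℂ) * ∫ ξ, g (ρ ξ) * Complex.exp (Complex.I * ((⟪x, ξ⟫ : ℝ) : ℂ))
      = ∫ η, ∫ v, A η v := by
    rw [← integral_const_mul]
    congr 1; ext η
    simp only [hA]
    rw [integral_const_mul]
    have : ∫ v : ℝ, ((b (v * kap (ρ η)) * kap (ρ η) : ℝ) : ℂ) = ((∫ t, b t : ℝ) : ℂ) := by
      rw [integral_complex_ofReal]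
      rw [integral_mul_const, Measure.integral_comp_mul_right, abs_of_pos (inv_pos.2 (kap_pos _))]
      congr 1
      rw [smul_eq_mul]; field_simp [(kap_pos (ρ η)).ne']
    rw [this]; ring
  have s2 : ∫ η, ∫ v, A η v = ∫ v, ∫ η, A η v := by
    refine integral_integral_swap_of_hasCompactSupport (by fun_prop) ?_
    refine HasCompactSupport.intro ((hρ.compact_sublevel 2).prod (isCompact_Icc (a := (0:ℝ)) (b := 4)))
      (fun p hp => ?_)
    by_cases h1 : ρ p.1 ∈ Set.Icc (1/2:ℝ) 2
    · by_cases h2 : p.2 * kap (ρ p.1) ∈ Set.Icc (1/2:ℝ) 2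
      · exact absurd (Set.mk_mem_prod h1.2 (z1 _ _ h1 h2)) hp
      · simp [hA, Function.uncurry, hbs _ h2]
    · simp [hA, Function.uncurry, hgs _ h1]
  have s3 : ∀ v, ∫ η, A η v = ∫ ξ, B v ξ := by
    intro v
    by_cases hv : v ≤ 0
    · have e1 : ∀ η, A η v = 0 := by
        intro η
        have := kap_pos (ρ η)
        simp only [hA]
        rw [hbs (v * kap (ρ η)) (fun h => by have := h.1; nlinarith)]; simp
      have e2 : ∀ ξ, B v ξ = 0 := by
        intro ξ
        have := hρ.nonneg ξ
        simp only [hB]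
        rw [hgs (v * ρ ξ) (fun h => by have := h.1; nlinarith)]; simp
      simp [e1, e2]
    · push Not at hv
      have := Measure.integral_comp_smul (volume : Measure (Euc d)) (fun η => A η v) v
      rw [finrank_euclideanSpace_fin, abs_of_pos (by positivity)] at this
      have e : ∫ η, A η v = (v ^ d) • ∫ ξ, A (v • ξ) v := by
        rw [this, smul_smul, mul_inv_cancel₀ (by positivity), one_smul]
      rw [e, ← integral_smul]
      congr 1; ext ξ
      simp only [hA, hB, hρ.smul hv.le, inner_smul_right]
      by_cases h1 : v * ρ ξ ∈ Set.Icc (1/2:ℝ) 2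
      · have hp : 0 < ρ ξ := by
          by_contra h; push Not at h
          have := h1.1; nlinarith
        rw [kap_eq (r := v * ρ ξ) (by linarith [h1.1])]
        have e3 : v * (v * ρ ξ)⁻¹ = (ρ ξ)⁻¹ := by field_simp
        rw [e3]
        by_cases h4 : ρ ξ ≤ 1/4
        · rw [kap_eq' h4, hbs (ρ ξ)⁻¹, hbs 4]
          · simp
          · norm_num
          · intro h
            have := (inv_le_comm₀ hp (by norm_num)).1 h.2
            linarith
        · push Not at h4
          rw [kap_eq h4.le]
          obtain ⟨k, rfl⟩ : ∃ k, d = k + 1 := ⟨d - 1, by omega⟩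
          simp only [Complex.real_smul]
          push_cast
          have : (v : ℂ) ≠ 0 := by exact_mod_cast hv.ne'
          have : (ρ ξ : ℂ) ≠ 0 := by exact_mod_cast hp.ne'
          field_simp
          ring
      · rw [hgs _ h1]; simp
  have s4 : ∫ v, ∫ ξ, B v ξ = ∫ ξ, ∫ v, B v ξ := by
    refine integral_integral_swap_of_hasCompactSupport (by fun_prop) ?_
    refine HasCompactSupport.intro ((isCompact_Icc (a := (0:ℝ)) (b := 4)).prod (hρ.compact_sublevel 2))
      (fun p hp => ?_)
    by_cases h1 : kap (ρ p.2) ∈ Set.Icc (1/2:ℝ) 2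
    · by_cases h2 : p.1 * ρ p.2 ∈ Set.Icc (1/2:ℝ) 2
      · have h4 : 1/4 < ρ p.2 := by
          by_contra h; push Not at h
          rw [kap_eq' h] at h1; norm_num at h1
        rw [kap_eq h4.le] at h1
        have hp0 : 0 < ρ p.2 := by linarith
        have i1 := (inv_le_comm₀ hp0 (by norm_num)).1 h1.2
        have i2 := (le_inv_comm₀ (by norm_num) hp0).1 h1.1
        norm_num at i1 i2
        refine absurd (Set.mk_mem_prod (⟨?_, ?_⟩ : p.1 ∈ Set.Icc (0:ℝ) 4) (show ρ p.2 ≤ 2 from i2)) hp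
        · by_contra h; push Not at h; nlinarith [h2.1]
        · by_contra h; push Not at h; nlinarith [h2.2]
      · simp [hB, Function.uncurry, hgs _ h2]
    · simp [hB, Function.uncurry, hbs _ h1]
  rw [s1, s2]
  simp only [s3]
  rw [s4]
  congr 1; ext ξ
  simp only [hB]
  rw [integral_const_mul]
  by_cases h4 : ρ ξ ≤ 1/4
  · rw [kap_eq' h4, hbs 4 (by norm_num)]; simp
  · push Not at h4
    have hp0 : 0 < ρ ξ := by linarith
    have e := Measure.integral_comp_mul_right (fun t : ℝ => (((t * (ρ ξ)⁻¹) ^ (d-1) : ℝ) : ℂ) * g t *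
          Complex.exp (Complex.I * ((t * ⟪x, (ρ ξ)⁻¹ • ξ⟫ : ℝ) : ℂ))) (ρ ξ)
    have e2 : ∀ v : ℝ, v * ρ ξ * (ρ ξ)⁻¹ = v := fun v => by field_simp
    have e3 : ∀ v : ℝ, v * ρ ξ * ⟪x, (ρ ξ)⁻¹ • ξ⟫ = v * ⟪x, ξ⟫ := fun v => by
      rw [inner_smul_right]; field_simp
    simp only [e2, e3] at e
    rw [e, abs_of_pos (inv_pos.2 hp0), kap_eq h4.le]
    simp only [mul_pow]
    have e5 : ∀ t : ℝ, (((t ^ (d-1) * (ρ ξ)⁻¹ ^ (d-1) : ℝ)) : ℂ) * g t *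
          Complex.exp (Complex.I * ((t * ⟪x, (ρ ξ)⁻¹ • ξ⟫ : ℝ) : ℂ)) =
        (((ρ ξ)⁻¹ ^ (d-1) : ℝ) : ℂ) * (((t ^ (d-1) : ℝ) : ℂ) * g t *
          Complex.exp (Complex.I * ((t * ⟪x, (ρ ξ)⁻¹ • ξ⟫ : ℝ) : ℂ))) := by
      intro t; push_cast; ring
    simp only [e5]
    rw [integral_const_mul, Complex.real_smul]
    obtain ⟨k, rfl⟩ : ∃ k, d = k + 1 := ⟨d - 1, by omega⟩
    simp only [Nat.add_sub_cancel]
    push_cast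
    ring
end PartF1

section PartG0
variable {E : Type*} [NormedAddCommGroup E] [NormedSpace ℝ E]

lemma BddD.const_add_mul {N : ℕ} {B : ℝ} {f : E → ℝ} (hf : ContDiff ℝ (⊤ : ℕ∞) f) (h : BddD N B f)
    {s : ℝ} (hs : |s| ≤ 1) : BddD N (1 + B) (fun x => 1 + s * f x) := by
  intro i hi x
  have e : (fun x => 1 + s * f x) = (fun _ : E => (1:ℝ)) + s • f := by ext; simp
  rw [e, iteratedFDeriv_add_apply (x := x) (f := fun _ : E => (1:ℝ)) (g := s • f)
    (contDiff_const.contDiffAt) ((contDiff_const.smul hf).of_le (mod_cast le_top)).contDiffAt]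
  refine (norm_add_le _ _).trans (add_le_add ?_ ?_)
  · rcases Nat.eq_zero_or_pos i with rfl | h0
    · rw [norm_iteratedFDeriv_zero]; simp
    · rw [iteratedFDeriv_const_of_ne h0.ne']; simp
  · rw [iteratedFDeriv_const_smul_apply ((hf.of_le (mod_cast le_top)).contDiffAt), norm_smul, Real.norm_eq_abs]
    have := h i hi x
    have h0 := norm_nonneg (iteratedFDeriv ℝ i f x)
    nlinarith [abs_nonneg s]

lemma osc_one (N : ℕ) {a : ℝ → ℝ} (ha : ContDiff ℝ (⊤ : ℕ∞) a) (has : HasCompactSupport a) :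
    ∃ C : ℝ, 0 ≤ C ∧ ∀ μ : ℝ, μ ≠ 0 →
      ‖∫ t : ℝ, (a t : ℂ) * Complex.exp (Complex.I * ((μ * t : ℝ) : ℂ))‖ ≤ C / |μ| ^ N := by
  obtain ⟨B, hB0, hB⟩ := BddD_of_compactSupport N ha has
  obtain ⟨C, hC0, hC⟩ := osc_nonstat (E := ℝ) N (one_pos) (max B 1) (volume (tsupport a)).toReal
  have key : ∀ σ : ℝ, |σ| = 1 → ∀ μ : ℝ, 0 < μ →
      ‖∫ t : ℝ, (a t : ℂ) * Complex.exp (Complex.I * ((μ * (σ * t) : ℝ) : ℂ))‖ ≤ C / μ ^ N := by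
    intro σ hσ μ hμ
    have hf : ∀ x : ℝ, fderiv ℝ (fun t : ℝ => σ * t) x σ = 1 := by
      intro x
      have : HasFDerivAt (fun t : ℝ => σ * t) (σ • ContinuousLinearMap.id ℝ ℝ) x :=
        (hasFDerivAt_id x).const_mul σ
      rw [this.fderiv]; simp
      rcases eq_or_eq_neg_of_abs_eq hσ with h | h <;> simp [h]
    refine hC (fun t => σ * t) a σ μ hμ (by fun_prop) ha has (by simp [hσ]) (hB.mono le_rfl (le_max_left _ _)) ?_ ?_ ?_
    · simp only [hf]
      intro i hi x
      rcases Nat.eq_zero_or_pos i with rfl | h0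
      · rw [norm_iteratedFDeriv_zero]; simp
      · rw [iteratedFDeriv_const_of_ne h0.ne']; simp
    · intro x _; rw [hf]
    · rw [ENNReal.ofReal_toReal has.isCompact.measure_lt_top.ne]
  refine ⟨C, hC0, fun μ hμ => ?_⟩
  rcases lt_or_gt_of_ne hμ with h | h
  · have := key (-1) (by simp) (-μ) (by linarith)
    rw [abs_of_neg h]
    simpa using this
  · have := key 1 (by simp) μ h
    rw [abs_of_pos h]
    simpa using this
end PartG0

section PartG1
variable {d : ℕ} {Ω : Set (Euc d)} {ρ : Euc d → ℝ}

lemma IsMinkowskiGauge.decayS (hd : 2 ≤ d) (hρ : IsMinkowskiGauge d Ω ρ)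
    (hcurv : HasNonvanishingCurvature d ρ) :
    ∃ C : ℝ, 0 ≤ C ∧ ∀ (g : ℝ → ℂ), Continuous g → (∀ t, t ∉ Set.Icc (1/2 : ℝ) 2 → g t = 0) →
      ∀ x : Euc d, ‖∫ ξ, g (ρ ξ) * Complex.exp (Complex.I * ((⟪x, ξ⟫ : ℝ) : ℂ))‖
        ≤ C * (1 + ‖x‖) ^ (-(((d : ℝ) - 1) / 2)) * ∫ t, ‖g t‖ := by
  obtain ⟨c, β, hc, hβ, hβs, hP⟩ := hρ.polar hd
  obtain ⟨C, hC0, hC⟩ := hρ.decay hd hcurv hβ hβs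
  have hd1 : (0:ℝ) ≤ ((d : ℝ) - 1) / 2 := by
    have : (2:ℝ) ≤ d := by exact_mod_cast hd
    linarith
  set p := ((d : ℝ) - 1) / 2 with hp
  refine ⟨c⁻¹ * (2 ^ (d-1) * (C * 2 ^ p)), by positivity, fun g hg hgs x => ?_⟩
  have hkc := kap_cont
  have hρc := hρ.cont
  have hβc := hβ.continuous
  have hgi : Integrable g := hg.integrable_of_hasCompactSupport
    (HasCompactSupport.intro (isCompact_Icc (a := (1/2:ℝ)) (b := 2)) hgs)
  have bz : ∀ ξ, ¬ (1/2 ≤ ρ ξ ∧ ρ ξ ≤ 2) → β (ρ ξ) = 0 := fun ξ h =>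
    image_eq_zero_of_notMem_tsupport (fun h' => h (hβs h'))
  have e1 : ∀ ξ, (β (ρ ξ) : ℂ) * ∫ t : ℝ, ((t ^ (d-1) : ℝ) : ℂ) * g t *
          Complex.exp (Complex.I * ((t * ⟪x, (ρ ξ)⁻¹ • ξ⟫ : ℝ) : ℂ)) =
      ∫ t : ℝ, (β (ρ ξ) : ℂ) * (((t ^ (d-1) : ℝ) : ℂ) * g t *
          Complex.exp (Complex.I * ((t * ⟪x, kap (ρ ξ) • ξ⟫ : ℝ) : ℂ))) := by
    intro ξ
    rw [integral_const_mul]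
    by_cases h : 1/2 ≤ ρ ξ ∧ ρ ξ ≤ 2
    · rw [kap_eq (by linarith [h.1])]
    · rw [bz ξ h]; simp
  have e2 := hP g hg hgs x
  simp only [e1] at e2
  rw [integral_integral_swap_of_hasCompactSupport (by fun_prop) (by
    refine HasCompactSupport.intro ((hρ.compact_sublevel 2).prod (isCompact_Icc (a := (1/2:ℝ)) (b := 2)))
      (fun q hq => ?_)
    by_cases h1 : 1/2 ≤ ρ q.1 ∧ ρ q.1 ≤ 2
    · by_cases h2 : q.2 ∈ Set.Icc (1/2:ℝ) 2
      · exact absurd (Set.mk_mem_prod (show ρ q.1 ≤ 2 from h1.2) h2) hq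
      · simp [Function.uncurry, hgs _ h2]
    · simp [Function.uncurry, bz _ h1])] at e2
  have e3 : ∀ t : ℝ, ‖∫ ξ, (β (ρ ξ) : ℂ) * (((t ^ (d-1) : ℝ) : ℂ) * g t *
          Complex.exp (Complex.I * ((t * ⟪x, kap (ρ ξ) • ξ⟫ : ℝ) : ℂ)))‖
          ≤ (2 ^ (d-1) * (C * 2 ^ p)) * (1 + ‖x‖) ^ (-p) * ‖g t‖ := by
    intro t
    by_cases ht : t ∈ Set.Icc (1/2:ℝ) 2
    · have e4 : ∫ ξ, (β (ρ ξ) : ℂ) * (((t ^ (d-1) : ℝ) : ℂ) * g t *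
          Complex.exp (Complex.I * ((t * ⟪x, kap (ρ ξ) • ξ⟫ : ℝ) : ℂ))) =
          (((t ^ (d-1) : ℝ) : ℂ) * g t) * osc (fun ξ => β (ρ ξ)) (fun ξ => ⟪t • x, (ρ ξ)⁻¹ • ξ⟫) := by
        rw [osc, ← integral_const_mul]
        congr 1; ext ξ
        by_cases h : 1/2 ≤ ρ ξ ∧ ρ ξ ≤ 2
        · rw [kap_eq (by linarith [h.1]), real_inner_smul_left]; ring
        · rw [bz ξ h]; simp
      rw [e4, norm_mul, norm_mul]
      have h1 : ‖((t ^ (d-1) : ℝ) : ℂ)‖ ≤ 2 ^ (d-1) := by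
        rw [Complex.norm_real, Real.norm_eq_abs, abs_of_nonneg (by have := ht.1; positivity)]
        exact pow_le_pow_left₀ (by linarith [ht.1]) ht.2 _
      have h2 := hC (t • x)
      have h3 : (1 + ‖t • x‖) ^ (-p) ≤ 2 ^ p * (1 + ‖x‖) ^ (-p) := by
        rw [norm_smul, Real.norm_eq_abs, abs_of_nonneg (by linarith [ht.1])]
        have : (1 + ‖x‖) / 2 ≤ 1 + t * ‖x‖ := by nlinarith [ht.1, norm_nonneg x]
        refine (Real.rpow_le_rpow_of_nonpos (by positivity) this (by linarith)).trans (le_of_eq ?_)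
        rw [Real.div_rpow (by positivity) (by norm_num), Real.rpow_neg (by norm_num : (0:ℝ) ≤ 2)]
        field_simp
      calc _ ≤ (2 ^ (d-1) * ‖g t‖) * (C * (2 ^ p * (1 + ‖x‖) ^ (-p))) := by
            refine mul_le_mul (mul_le_mul_of_nonneg_right h1 (norm_nonneg _))
              (h2.trans (mul_le_mul_of_nonneg_left h3 hC0)) (norm_nonneg _) (by positivity)
        _ = _ := by ring
    · simp [hgs t ht]
  have e5 := norm_integral_le_of_norm_le (hgi.norm.const_mul _) (ae_of_all _ e3)
  rw [← e2, integral_const_mul, norm_mul, Complex.norm_real, Real.norm_eq_abs, abs_of_pos hc] at e5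
  calc _ = c⁻¹ * (c * ‖∫ ξ, g (ρ ξ) * Complex.exp (Complex.I * ((⟪x, ξ⟫ : ℝ) : ℂ))‖) := by field_simp
    _ ≤ c⁻¹ * (2 ^ (d - 1) * (C * 2 ^ p) * (1 + ‖x‖) ^ (-p) * ∫ t, ‖g t‖) :=
        mul_le_mul_of_nonneg_left e5 (by positivity)
    _ = _ := by ring

lemma IsMinkowskiGauge.decayZ (hd : 2 ≤ d) (hρ : IsMinkowskiGauge d Ω ρ)
    {χ : ℝ → ℝ} (hχ : ContDiff ℝ (⊤ : ℕ∞) χ) (hχs : ∀ t, t ∉ Set.Icc (1/2 : ℝ) 2 → χ t = 0) :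
    ∃ c0 : ℝ, 0 < c0 ∧ ∀ N : ℕ, ∃ C : ℝ, 0 ≤ C ∧ ∀ (τ : ℝ) (x : Euc d), τ ≠ 0 → ‖x‖ ≤ c0 * |τ| →
      ‖∫ ξ, (χ (ρ ξ) : ℂ) * Complex.exp (Complex.I * ((τ * ρ ξ : ℝ) : ℂ)) *
        Complex.exp (Complex.I * ((⟪x, ξ⟫ : ℝ) : ℂ))‖ ≤ C / |τ| ^ N := by
  obtain ⟨m, M, hm, hM, hb⟩ := hρ.bounds
  obtain ⟨c, β, hc, hβ, hβs, hP⟩ := hρ.polar hd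
  refine ⟨m / 2, by positivity, fun N => ?_⟩
  have hχc : HasCompactSupport χ := HasCompactSupport.intro (isCompact_Icc (a := (1/2:ℝ)) (b := 2)) hχs
  obtain ⟨C, hC0, hC⟩ := osc_one N (a := fun t => t ^ (d-1) * χ t) (by fun_prop) hχc.mul_left
  have hβc : HasCompactSupport β :=
    HasCompactSupport.of_support_subset_isCompact isCompact_Icc ((subset_tsupport β).trans hβs)
  have hbc : HasCompactSupport (fun ξ => β (ρ ξ)) := hρ.comp_compact hβc
  have hbi : Integrable (fun ξ => β (ρ ξ)) :=
    (hβ.continuous.comp hρ.cont).integrable_of_hasCompactSupport hbc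
  refine ⟨c⁻¹ * ((C * 2 ^ N) * ∫ ξ, ‖β (ρ ξ)‖), by positivity, fun τ x hτ hx => ?_⟩
  have e2 := hP (fun t => (χ t : ℂ) * Complex.exp (Complex.I * ((τ * t : ℝ) : ℂ)))
    (by have := hχ.continuous; fun_prop) (fun t ht => by simp [hχs t ht]) x
  have hτ0 : 0 < |τ| := abs_pos.2 hτ
  have e3 : ∀ ξ, ‖(β (ρ ξ) : ℂ) * ∫ t : ℝ, ((t ^ (d-1) : ℝ) : ℂ) * ((χ t : ℂ) *
      Complex.exp (Complex.I * ((τ * t : ℝ) : ℂ))) *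
          Complex.exp (Complex.I * ((t * ⟪x, (ρ ξ)⁻¹ • ξ⟫ : ℝ) : ℂ))‖
        ≤ ((C * 2 ^ N) / |τ| ^ N) * ‖β (ρ ξ)‖ := by
    intro ξ
    rw [norm_mul, mul_comm, Complex.norm_real]
    by_cases hβ0 : β (ρ ξ) = 0
    · simp [hβ0]
    refine mul_le_mul_of_nonneg_right ?_ (norm_nonneg _)
    have hξ := hβs (subset_tsupport β hβ0)
    set μ := τ + ⟪x, (ρ ξ)⁻¹ • ξ⟫ with hμ
    have i1 : |⟪x, (ρ ξ)⁻¹ • ξ⟫| ≤ |τ| / 2 := by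
      refine (abs_real_inner_le_norm _ _).trans ?_
      rw [norm_smul, norm_inv, Real.norm_eq_abs, abs_of_nonneg (hρ.nonneg ξ)]
      have hp : 0 < ρ ξ := by linarith [hξ.1]
      have : (ρ ξ)⁻¹ * ‖ξ‖ ≤ m⁻¹ := by
        rw [inv_mul_le_iff₀ hp, le_mul_inv_iff₀ hm]; linarith [(hb ξ).1]
      calc ‖x‖ * ((ρ ξ)⁻¹ * ‖ξ‖) ≤ (m / 2 * |τ|) * m⁻¹ := by gcongr
        _ = |τ| / 2 := by field_simp
    have i2 : |τ| / 2 ≤ |μ| := by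
      have := abs_sub_abs_le_abs_sub τ (-⟪x, (ρ ξ)⁻¹ • ξ⟫)
      rw [abs_neg, sub_neg_eq_add] at this
      linarith
    have hμ0 : μ ≠ 0 := by rw [← abs_pos]; linarith
    have := hC μ hμ0
    have e : ∀ t : ℝ, ((t ^ (d-1) : ℝ) : ℂ) * ((χ t : ℂ) *
      Complex.exp (Complex.I * ((τ * t : ℝ) : ℂ))) *
          Complex.exp (Complex.I * ((t * ⟪x, (ρ ξ)⁻¹ • ξ⟫ : ℝ) : ℂ)) =
        ((t ^ (d-1) * χ t : ℝ) : ℂ) * Complex.exp (Complex.I * ((μ * t : ℝ) : ℂ)) := by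
      intro t
      have : Complex.I * ((μ * t : ℝ) : ℂ) = Complex.I * ((τ * t : ℝ) : ℂ) + Complex.I * ((t * ⟪x, (ρ ξ)⁻¹ • ξ⟫ : ℝ) : ℂ) := by
        rw [hμ]; push_cast; ring
      rw [this, Complex.exp_add]; push_cast; ring
    simp only [e]
    refine this.trans ?_
    calc C / |μ| ^ N ≤ C / (|τ| / 2) ^ N := by gcongr
      _ = _ := by rw [div_pow]; field_simp
  have e5 := norm_integral_le_of_norm_le (hbi.norm.const_mul _) (ae_of_all _ e3)
  rw [← e2, integral_const_mul, norm_mul, Complex.norm_real, Real.norm_eq_abs, abs_of_pos hc] at e5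
  rw [← le_inv_mul_iff₀ hc] at e5
  refine e5.trans (le_of_eq ?_)
  field_simp

lemma IsMinkowskiGauge.decayW (hρ : IsMinkowskiGauge d Ω ρ)
    {χ : ℝ → ℝ} (hχ : ContDiff ℝ (⊤ : ℕ∞) χ) (hχs : ∀ t, t ∉ Set.Icc (1/2 : ℝ) 2 → χ t = 0) :
    ∃ C0 : ℝ, 1 ≤ C0 ∧ ∀ N : ℕ, ∃ C : ℝ, 0 ≤ C ∧ ∀ (τ : ℝ) (x : Euc d), x ≠ 0 → C0 * |τ| ≤ ‖x‖ →
      ‖∫ ξ, (χ (ρ ξ) : ℂ) * Complex.exp (Complex.I * ((τ * ρ ξ : ℝ) : ℂ)) *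
        Complex.exp (Complex.I * ((⟪x, ξ⟫ : ℝ) : ℂ))‖ ≤ C / ‖x‖ ^ N := by
  obtain ⟨ζ, hζ, hζc, hζs, hζ1, -, -⟩ := exists_cutoff
  have hr : ContDiff ℝ (⊤ : ℕ∞) (fun ξ => ρ ξ * ζ (ρ ξ)) :=
    hρ.comp_smooth (g := fun t => t * ζ t) (by fun_prop) (fun h => by
      have := (hζs (closure_mono (Function.support_mul_subset_right _ _) h)).1; norm_num at this)
  have hrc : HasCompactSupport (fun ξ => ρ ξ * ζ (ρ ξ)) :=
    hρ.comp_compact (g := fun t => t * ζ t) hζc.mul_left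
  set R := fun ξ => ρ ξ * ζ (ρ ξ) with hR
  obtain ⟨B1, hB10, hB1⟩ := BddD_of_compactSupport 1 hr hrc
  have hχc : HasCompactSupport χ := HasCompactSupport.intro (isCompact_Icc (a := (1/2:ℝ)) (b := 2)) hχs
  have hts : tsupport χ ⊆ Set.Icc (1/2) 2 := closure_minimal (fun r hr => by
    by_contra h; exact hr (hχs r h)) isClosed_Icc
  have ha : ContDiff ℝ (⊤ : ℕ∞) (fun ξ => χ (ρ ξ)) := hρ.comp_smooth hχ (fun h => by
      have := (hts h).1; norm_num at this)
  have hac : HasCompactSupport (fun ξ => χ (ρ ξ)) := hρ.comp_compact hχc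
  refine ⟨2 * B1 + 1, by linarith, fun N => ?_⟩
  obtain ⟨B2, hB20, hB2⟩ := BddD_of_compactSupport (N+1) hr hrc
  obtain ⟨B3, hB30, hB3⟩ := BddD_of_compactSupport N ha hac
  obtain ⟨C, hC0, hC⟩ := osc_nonstat (E := Euc d) N (one_half_pos) (max B3 (1 + B2))
    (volume (tsupport (fun ξ => χ (ρ ξ)))).toReal
  refine ⟨C, hC0, fun τ x hx hτ => ?_⟩
  have hx0 : 0 < ‖x‖ := norm_pos_iff.2 hx
  set u := ‖x‖⁻¹ • x with hu
  have hu1 : ‖u‖ = 1 := by rw [hu, norm_smul, norm_inv, norm_norm, inv_mul_cancel₀ hx0.ne']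
  set s := τ / ‖x‖ with hs
  have hs1 : |s| * (2 * B1 + 1) ≤ 1 := by
    rw [hs, abs_div, abs_of_pos hx0, div_mul_eq_mul_div, div_le_one hx0]; linarith
  have hs2 : |s| ≤ 1 := by nlinarith [abs_nonneg s]
  have hfd : ∀ ξ, fderiv ℝ (fun ξ => ⟪u, ξ⟫ + s * R ξ) ξ u = 1 + s * fderiv ℝ R ξ u := by
    intro ξ
    have h1 : HasFDerivAt (fun ξ => ⟪u, ξ⟫ + s * R ξ) (innerSL ℝ u + s • fderiv ℝ R ξ) ξ :=
      (innerSL ℝ u).hasFDerivAt.add ((hr.differentiable (by simp) ξ).hasFDerivAt.const_mul s)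
    rw [h1.fderiv]
    simp [hu1]
  have := hC (fun ξ => ⟪u, ξ⟫ + s * R ξ) (fun ξ => χ (ρ ξ)) u ‖x‖ hx0
    ((innerSL ℝ u).contDiff.add (contDiff_const.mul hr)) ha hac hu1.le
    (hB3.mono le_rfl (le_max_left _ _)) (by
      simp only [hfd]
      exact (BddD.const_add_mul ((hr.fderiv_right (by simp)).clm_apply contDiff_const)
        (BddD.fderiv_apply hr hB2 hu1.le) hs2).mono le_rfl (le_max_right _ _)) (by
      intro ξ _
      rw [hfd]
      have h1 := (BddD.fderiv_apply hr hB1 hu1.le).norm_le ξ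
      rw [Real.norm_eq_abs] at h1
      have h2 : |s * fderiv ℝ R ξ u| ≤ 1/2 := by
        rw [abs_mul]
        nlinarith [abs_nonneg s]
      linarith [(abs_le.1 h2).1]) (by
      rw [ENNReal.ofReal_toReal hac.isCompact.measure_lt_top.ne])
  refine le_trans (le_of_eq ?_) this
  congr 1
  rw [osc]
  congr 1; ext ξ
  by_cases h : ρ ξ ∈ Set.Icc (1/2:ℝ) 2
  · have e : Complex.I * ((‖x‖ * (⟪u, ξ⟫ + s * R ξ) : ℝ) : ℂ) = Complex.I * ((τ * ρ ξ : ℝ) : ℂ) + Complex.I * ((⟪x, ξ⟫ : ℝ) : ℂ) := by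
      have : ‖x‖ * (⟪u, ξ⟫ + s * R ξ) = τ * ρ ξ + ⟪x, ξ⟫ := by
        rw [hu, real_inner_smul_left, hs, hR]
        simp only
        rw [hζ1 _ ⟨by linarith [h.1], by linarith [h.2]⟩]
        field_simp
        ring
      rw [this]; push_cast; ring
    rw [e, Complex.exp_add, mul_assoc]
  · rw [hχs _ h]; simp
end PartG1

section PartH1

lemma rpow_exp_integrable {lam b : ℝ} (hl : -1 < lam) (hb : 0 < b) :
    IntegrableOn (fun w : ℝ => w ^ lam * Real.exp (-b * w)) (Set.Ioi 0) := by
  have := integrableOn_rpow_mul_exp_neg_mul_rpow (p := 1) hl zero_lt_one hb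
  simpa using this

/-- The Laplace transform of `w^λ` in the half plane. -/
lemma laplace_rpow {lam : ℝ} (hl : 0 < lam) {z : ℂ} (hz : 0 < z.re) :
    ∫ w in Set.Ioi (0:ℝ), ((w ^ lam : ℝ) : ℂ) * Complex.exp (-(z * w)) =
      (1 / z) ^ ((lam + 1 : ℝ) : ℂ) * (Real.Gamma (lam + 1) : ℂ) := by
  have hnorm : ∀ (z : ℂ) (w : ℝ), ‖Complex.exp (-(z * w))‖ = Real.exp (-z.re * w) := by
    intro z w
    rw [Complex.norm_exp]; simp
  have hcm : ∀ {a : ℝ}, 0 < a → Continuous (fun w : ℝ => ((w ^ a : ℝ) : ℂ)) := fun ha =>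
    Complex.continuous_ofReal.comp (Real.continuous_rpow_const ha.le)
  have hdiff : DifferentiableOn ℂ (fun z : ℂ => ∫ w in Set.Ioi (0:ℝ), ((w ^ lam : ℝ) : ℂ) * Complex.exp (-(z * w)))
      {z | 0 < z.re} := by
    intro z0 hz0
    have hz0' : 0 < z0.re := hz0
    refine DifferentiableAt.differentiableWithinAt ?_
    refine (hasDerivAt_integral_of_dominated_loc_of_deriv_le (𝕜 := ℂ)
      (bound := fun w : ℝ => w ^ (lam + 1) * Real.exp (-(z0.re/2) * w))
      (F' := fun z w => ((w ^ lam : ℝ) : ℂ) * (Complex.exp (-(z * w)) * (-w)))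
      (s := {z | z0.re / 2 < z.re}) ?_ ?_ ?_ ?_ ?_ ?_ ?_).2.differentiableAt
    · exact (isOpen_lt continuous_const Complex.continuous_re).mem_nhds (by simp; linarith)
    · refine Eventually.of_forall (fun z => Continuous.aestronglyMeasurable ?_)
      have := hcm hl; fun_prop
    · refine Integrable.mono' (rpow_exp_integrable (lam := lam) (b := z0.re) (by linarith) hz0') (Continuous.aestronglyMeasurable ?_) ?_
      · have := hcm hl; fun_prop
      · refine (ae_restrict_iff' measurableSet_Ioi).2 (ae_of_all _ (fun w hw => ?_))
        have hw' : (0:ℝ) < w := hw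
        rw [norm_mul, hnorm, Complex.norm_real, Real.norm_of_nonneg (by positivity)]
    · refine (Continuous.aestronglyMeasurable ?_)
      have := hcm hl; fun_prop
    · refine (ae_restrict_iff' measurableSet_Ioi).2 (ae_of_all _ (fun w hw z hz => ?_))
      have hw' : (0:ℝ) < w := hw
      have hz' : z0.re / 2 < z.re := hz
      rw [norm_mul, norm_mul, hnorm, Complex.norm_real, Real.norm_of_nonneg (by positivity), norm_neg,
        Complex.norm_real, Real.norm_of_nonneg hw'.le, Real.rpow_add_one hw'.ne', mul_comm (Real.exp _), ← mul_assoc]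
      refine mul_le_mul_of_nonneg_left (Real.exp_le_exp.2 ?_) (by positivity)
      nlinarith
    · exact rpow_exp_integrable (by linarith) (by linarith)
    · refine ae_of_all _ (fun w z _ => ?_)
      refine HasDerivAt.const_mul _ (HasDerivAt.cexp ?_)
      have h := ((hasDerivAt_id z).mul_const (w:ℂ)).neg
      rw [one_mul] at h
      exact h
  have hopen : IsOpen {z : ℂ | 0 < z.re} := isOpen_lt continuous_const Complex.continuous_re
  have hconv : Convex ℝ {z : ℂ | 0 < z.re} := convex_halfSpace_re_gt 0
  have hdiff2 : DifferentiableOn ℂ (fun z : ℂ => (1 / z) ^ ((lam + 1 : ℝ) : ℂ) * (Real.Gamma (lam + 1) : ℂ))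
      {z | 0 < z.re} := by
    intro z0 hz0
    have hz0' : 0 < z0.re := hz0
    have hne : z0 ≠ 0 := by rintro rfl; simp at hz0'
    refine DifferentiableAt.differentiableWithinAt ?_
    refine DifferentiableAt.mul_const (DifferentiableAt.cpow_const ?_ ?_) _
    · exact (differentiableAt_const _).div differentiableAt_id hne
    · left
      rw [one_div, Complex.inv_re]
      exact div_pos hz0' (Complex.normSq_pos.2 hne)
  refine (hdiff.analyticOnNhd hopen).eqOn_of_preconnected_of_frequently_eq (hdiff2.analyticOnNhd hopen)
    hconv.isPreconnected (z₀ := 1) (by simp) ?_ hz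
  have hreal : ∀ r : ℝ, 0 < r → ∫ w in Set.Ioi (0:ℝ), ((w ^ lam : ℝ) : ℂ) * Complex.exp (-((r:ℂ) * w)) =
      (1 / (r:ℂ)) ^ ((lam + 1 : ℝ) : ℂ) * (Real.Gamma (lam + 1) : ℂ) := by
    intro r hr
    have h := Real.integral_rpow_mul_exp_neg_mul_Ioi (a := lam + 1) (r := r) (by linarith) hr
    have e : ∀ w : ℝ, ((w ^ lam : ℝ) : ℂ) * Complex.exp (-((r:ℂ) * w)) =
      ((w ^ (lam + 1 - 1) * Real.exp (-(r * w)) : ℝ) : ℂ) := by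
      intro w; push_cast; simp
    simp only [e]
    rw [integral_complex_ofReal, h]
    push_cast
    rw [Complex.ofReal_cpow (by positivity)]
    push_cast; ring
  have ht : Tendsto (fun n : ℕ => ((1 + 1/((n:ℝ)+1) : ℝ) : ℂ)) atTop (𝓝[≠] 1) := by
    refine tendsto_nhdsWithin_iff.2 ⟨?_, Eventually.of_forall (fun n => ?_)⟩
    · have : Tendsto (fun n : ℕ => (1 + 1/((n:ℝ)+1) : ℝ)) atTop (𝓝 (1 + 0)) :=
        tendsto_const_nhds.add tendsto_one_div_add_atTop_nhds_zero_nat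
      rw [add_zero] at this
      have h := (Complex.continuous_ofReal.tendsto 1).comp this
      rw [Complex.ofReal_one] at h
      exact h
    · simp only [Set.mem_compl_iff, Set.mem_singleton_iff]
      intro h
      have h2 : (1 + 1/((n:ℝ)+1) : ℝ) = 1 := by exact_mod_cast h
      have : (0:ℝ) < 1/((n:ℝ)+1) := by positivity
      linarith
  refine ht.frequently (Eventually.frequently (Eventually.of_forall fun n => ?_))
  exact hreal _ (by positivity)

/-- The Fourier transform of a smooth compactly supported function is Schwartz. -/
lemma FT1_schwartz {f : ℝ → ℂ} (hf : ContDiff ℝ (⊤ : ℕ∞) f) (hs : HasCompactSupport f) :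
    ∃ S : SchwartzMap ℝ ℂ, ∀ v, S v = FT1 f v := by
  have h2 : (2 * Real.pi) ≠ 0 := by positivity
  have g1 : ContDiff ℝ (⊤ : ℕ∞) (fun s : ℝ => ((2 * Real.pi : ℝ) : ℂ) * f (2 * Real.pi * s)) := by fun_prop
  have g2 : HasCompactSupport (fun s : ℝ => ((2 * Real.pi : ℝ) : ℂ) * f (2 * Real.pi * s)) := by
    have := hs.comp_homeomorph (Homeomorph.mulLeft₀ (2 * Real.pi) h2)
    exact HasCompactSupport.mul_left this
  refine ⟨FourierTransform.fourier (g2.toSchwartzMap g1), fun v => ?_⟩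
  rw [SchwartzMap.fourier_coe, Real.fourier_real_eq_integral_exp_smul]
  simp only [HasCompactSupport.toSchwartzMap_toFun, FT1]
  have := Measure.integral_comp_mul_left (fun s : ℝ => f s * Complex.exp (-(Complex.I * (s : ℂ) * (v : ℂ)))) (2 * Real.pi)
  rw [abs_of_pos (by positivity)] at this
  have e : ∫ s : ℝ, f s * Complex.exp (-(Complex.I * (s : ℂ) * (v : ℂ))) =
     (2 * Real.pi) • ∫ s : ℝ, f (2 * Real.pi * s) * Complex.exp (-(Complex.I * ((2 * Real.pi * s : ℝ) : ℂ) * (v : ℂ))) := by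
    rw [this, smul_smul, mul_inv_cancel₀ h2, one_smul]
  rw [e, ← integral_smul]
  congr 1; ext s
  rw [Complex.real_smul, smul_eq_mul]
  have : ((-2 * Real.pi * s * v : ℝ) : ℂ) * Complex.I = -(Complex.I * ((2 * Real.pi * s : ℝ) : ℂ) * (v : ℂ)) := by
    push_cast; ring
  rw [this]; ring

/-- `∫_0^∞ w^λ φ(v+w) dw`. -/
def Jint (lam : ℝ) (φ : ℝ → ℂ) (v : ℝ) : ℂ := ∫ w : ℝ, ((max w 0) ^ lam : ℝ) • φ (v + w)

lemma maxpow_cont {lam : ℝ} (hl : 0 < lam) : Continuous (fun w : ℝ => (max w 0) ^ lam) :=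
  (Real.continuous_rpow_const hl.le).comp (by fun_prop)

lemma Jint_bound {lam : ℝ} (hl : 0 < lam) (φ : SchwartzMap ℝ ℂ) :
    ∃ (C : ℝ) (K : ℕ), 0 ≤ C ∧ ∀ v w : ℝ, ‖((max w 0) ^ lam : ℝ) • φ (v + w)‖
      ≤ C * (1 + |v|) ^ K * (1 + ‖w‖) ^ (-(2:ℝ)) := by
  set n := ⌈lam⌉₊
  obtain ⟨C, hC0, hC⟩ : ∃ C : ℝ, 0 ≤ C ∧ ∀ x, (1 + ‖x‖) ^ (n + 2) * ‖φ x‖ ≤ C := by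
    refine ⟨_, ?_, fun x => by
      simpa using SchwartzMap.one_add_le_sup_seminorm_apply (𝕜 := ℝ) (m := (n+2, 0)) (k := n+2) (n := 0) le_rfl le_rfl φ x⟩
    positivity
  refine ⟨C, n + 2, hC0, fun v w => ?_⟩
  rw [norm_smul, Real.norm_of_nonneg (by positivity)]
  have h1 : (max w 0) ^ lam ≤ (1 + ‖w‖) ^ n := by
    have a1 : max w 0 ≤ 1 + ‖w‖ := by
      rw [Real.norm_eq_abs]
      exact max_le (by linarith [le_abs_self w]) (by positivity)
    calc (max w 0) ^ lam ≤ (1 + ‖w‖) ^ lam := Real.rpow_le_rpow (le_max_right _ _) a1 hl.le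
      _ ≤ (1 + ‖w‖) ^ (n:ℝ) := Real.rpow_le_rpow_of_exponent_le (by linarith [norm_nonneg w]) (Nat.le_ceil _)
      _ = _ := Real.rpow_natCast _ _
  have h2 : (1 + ‖w‖) ≤ (1 + |v|) * (1 + ‖v + w‖) := by
    have : ‖w‖ ≤ ‖v + w‖ + |v| := by
      have := norm_sub_le (v + w) v
      simpa using this
    nlinarith [norm_nonneg (v + w), abs_nonneg v]
  have h3 : (1 + ‖w‖) ^ (-(2:ℝ)) = ((1 + ‖w‖) ^ 2)⁻¹ := by
    rw [Real.rpow_neg (by positivity)]; norm_cast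
  rw [h3, ← div_eq_mul_inv, le_div_iff₀ (by positivity)]
  calc (max w 0) ^ lam * ‖φ (v + w)‖ * (1 + ‖w‖) ^ 2 ≤ (1 + ‖w‖) ^ n * ‖φ (v + w)‖ * (1 + ‖w‖) ^ 2 := by gcongr
    _ = (1 + ‖w‖) ^ (n + 2) * ‖φ (v + w)‖ := by ring
    _ ≤ ((1 + |v|) * (1 + ‖v + w‖)) ^ (n+2) * ‖φ (v + w)‖ := by gcongr
    _ = (1 + |v|) ^ (n+2) * ((1 + ‖v + w‖) ^ (n+2) * ‖φ (v + w)‖) := by rw [mul_pow]; ring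
    _ ≤ (1 + |v|) ^ (n+2) * C := by gcongr; exact hC _
    _ = _ := by ring

lemma int_two : Integrable (fun w : ℝ => (1 + ‖w‖) ^ (-(2:ℝ))) :=
  integrable_one_add_norm (by simp)

lemma Jint_meas {lam : ℝ} (hl : 0 < lam) (φ : SchwartzMap ℝ ℂ) (v : ℝ) :
    Continuous (fun w : ℝ => ((max w 0) ^ lam : ℝ) • φ (v + w)) := by
  have := maxpow_cont hl
  have := φ.continuous
  fun_prop

lemma Jint_integrable {lam : ℝ} (hl : 0 < lam) (φ : SchwartzMap ℝ ℂ) (v : ℝ) :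
    Integrable (fun w : ℝ => ((max w 0) ^ lam : ℝ) • φ (v + w)) := by
  obtain ⟨C, K, hC, h⟩ := Jint_bound hl φ
  exact Integrable.mono' (int_two.const_mul _) (Jint_meas hl φ v).aestronglyMeasurable (ae_of_all _ (h v))

lemma Jint_hasDerivAt {lam : ℝ} (hl : 0 < lam) (φ : SchwartzMap ℝ ℂ) (v : ℝ) :
    HasDerivAt (Jint lam φ) (Jint lam (SchwartzMap.derivCLM ℝ ℂ φ) v) v := by
  obtain ⟨C, K, hC, h⟩ := Jint_bound hl (SchwartzMap.derivCLM ℝ ℂ φ)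
  refine (hasDerivAt_integral_of_dominated_loc_of_deriv_le (𝕜 := ℝ)
    (F := fun v w => ((max w 0) ^ lam : ℝ) • φ (v + w))
    (F' := fun v w => ((max w 0) ^ lam : ℝ) • (SchwartzMap.derivCLM ℝ ℂ φ) (v + w))
    (s := Metric.ball v 1) (bound := fun w => C * (2 + |v|) ^ K * (1 + ‖w‖) ^ (-(2:ℝ)))
    (Metric.ball_mem_nhds v one_pos) ?_ ?_ ?_ ?_ ?_ ?_).2
  · exact Eventually.of_forall fun v => (Jint_meas hl φ v).aestronglyMeasurable
  · exact Jint_integrable hl φ v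
  · exact (Jint_meas hl _ v).aestronglyMeasurable
  · refine ae_of_all _ (fun w x hx => (h x w).trans ?_)
    have : |x| ≤ 1 + |v| := by
      have h1 : |x - v| < 1 := by simpa [Real.dist_eq] using hx
      have := abs_sub_abs_le_abs_sub x v
      linarith
    have : 1 + |x| ≤ 2 + |v| := by linarith
    gcongr
  · exact int_two.const_mul _
  · refine ae_of_all _ (fun w x _ => ?_)
    have := (φ.hasDerivAt (x + w)).comp_add_const x w
    rw [SchwartzMap.derivCLM_apply]
    exact this.const_smul ((max w 0) ^ lam : ℝ)

lemma Jint_contDiff {lam : ℝ} (hl : 0 < lam) (φ : SchwartzMap ℝ ℂ) :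
    ContDiff ℝ (⊤ : ℕ∞) (Jint lam φ) := by
  rw [contDiff_infty]
  intro n
  induction n generalizing φ with
  | zero => 
    rw [Nat.cast_zero, contDiff_zero]
    exact continuous_iff_continuousAt.2 fun v => (Jint_hasDerivAt hl φ v).continuousAt
  | succ n ih =>
    push_cast
    rw [contDiff_succ_iff_deriv]
    refine ⟨fun v => (Jint_hasDerivAt hl φ v).differentiableAt, by simp, ?_⟩
    have : deriv (Jint lam φ) = Jint lam (SchwartzMap.derivCLM ℝ ℂ φ) :=
      funext fun v => (Jint_hasDerivAt hl φ v).deriv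
    rw [this]
    exact ih _
end PartH1

section PartI

lemma HData.Ψ_sm {lam : ℝ} {N0 : ℕ} {χ Φ Ψ : ℝ → ℝ} (h : HData lam N0 χ Φ Ψ) : ContDiff ℝ (⊤ : ℕ∞) Ψ := by
  rw [h.hΨ]; have := h.hΦsm; fun_prop

lemma HData.Ψ_small {lam : ℝ} {N0 : ℕ} {χ Φ Ψ : ℝ → ℝ} (h : HData lam N0 χ Φ Ψ) {x : ℝ} (hx : |x| ≤ 1/2) :
    Ψ x = 0 := by
  rw [h.hΨ]; simp only
  rw [h.hΦone x hx, h.hΦone, sub_self]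
  rw [abs_div, abs_of_pos (zero_lt_two' ℝ)]; linarith [abs_nonneg x]

lemma HData.Ψ_big {lam : ℝ} {N0 : ℕ} {χ Φ Ψ : ℝ → ℝ} (h : HData lam N0 χ Φ Ψ) {x : ℝ} (hx : 2 ≤ |x|) :
    Ψ x = 0 := by
  rw [h.hΨ]; simp only
  rw [h.hΦzero x (by linarith), h.hΦzero, sub_self]
  rw [abs_div, abs_of_pos (zero_lt_two' ℝ)]; linarith

lemma compact_of_abs {β : Type*} [Zero β] {f : ℝ → β} {R : ℝ} (h : ∀ x, R ≤ |x| → f x = 0) :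
    HasCompactSupport f := by
  refine HasCompactSupport.intro (K := Metric.closedBall 0 R) (isCompact_closedBall _ _) (fun x hx => h x ?_)
  simp only [Metric.mem_closedBall, dist_zero_right, Real.norm_eq_abs, not_le] at hx
  exact hx.le

/-- The density of `Jint` of a Fourier transform. -/
def fdens (lam : ℝ) (Ψ : ℝ → ℝ) (τ : ℝ) : ℂ :=
  (Ψ τ : ℂ) * ((1 / (Complex.I * τ)) ^ ((lam + 1 : ℝ) : ℂ) * (Real.Gamma (lam + 1) : ℂ))

lemma one_div_I_mem {τ : ℝ} (h : τ ≠ 0) : 1 / (Complex.I * τ) ∈ Complex.slitPlane := by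
  rw [Complex.mem_slitPlane_iff]
  right
  have : 1 / (Complex.I * τ) = ((-(1/τ) : ℝ) : ℂ) * Complex.I := by
    have h' : (τ:ℂ) ≠ 0 := by exact_mod_cast h
    push_cast; field_simp; simp
  rw [this]; simp [h]

lemma fdens_zero {lam : ℝ} {Ψ : ℝ → ℝ} {τ : ℝ} (h : Ψ τ = 0) : fdens lam Ψ τ = 0 := by
  simp [fdens, h]

lemma fdens_sm (lam : ℝ) {Ψ : ℝ → ℝ} (hs : ContDiff ℝ (⊤ : ℕ∞) Ψ) (h0 : ∀ x, |x| ≤ 1/2 → Ψ x = 0) :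
    ContDiff ℝ (⊤ : ℕ∞) (fdens lam Ψ) := by
  rw [contDiff_iff_contDiffAt]
  intro τ
  by_cases hτ : τ = 0
  · have : fdens lam Ψ =ᶠ[𝓝 τ] fun _ => 0 := by
      filter_upwards [Metric.ball_mem_nhds τ (show (0:ℝ) < 1/2 by norm_num)] with x hx
      rw [hτ, Metric.mem_ball, dist_zero_right, Real.norm_eq_abs] at hx
      exact fdens_zero (h0 x hx.le)
    exact contDiffAt_const.congr_of_eventuallyEq this
  · have e : (fun t : ℝ => (1 / (Complex.I * t)) ^ ((lam + 1 : ℝ) : ℂ)) =ᶠ[𝓝 τ]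
        fun t : ℝ => Complex.exp (Complex.log (1 / (Complex.I * t)) * ((lam + 1 : ℝ) : ℂ)) := by
      filter_upwards [isOpen_ne.mem_nhds hτ] with t ht
      rw [Complex.cpow_def_of_ne_zero]
      exact Complex.slitPlane_ne_zero (one_div_I_mem ht)
    have hof : ContDiffAt ℝ (⊤ : ℕ∞) (fun t : ℝ => (t : ℂ)) τ := Complex.ofRealCLM.contDiff.contDiffAt
    have c1 : ContDiffAt ℝ (⊤ : ℕ∞) (fun t : ℝ => 1 / (Complex.I * (t:ℂ))) τ := by
      simp only [one_div]
      refine ContDiffAt.inv (contDiffAt_const.mul hof) ?_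
      simp [hτ]
    have c2 : ContDiffAt ℝ (⊤ : ℕ∞) (fun t : ℝ => Complex.log (1 / (Complex.I * (t:ℂ)))) τ :=
      ContDiffAt.comp (g := Complex.log) τ ((Complex.contDiffAt_log (n := (⊤ : ℕ∞)) (one_div_I_mem hτ)).restrict_scalars ℝ) c1
    have c3 : ContDiffAt ℝ (⊤ : ℕ∞) (fun t : ℝ => (1 / (Complex.I * (t:ℂ))) ^ ((lam + 1 : ℝ) : ℂ)) τ :=
      ((c2.mul contDiffAt_const).cexp).congr_of_eventuallyEq e
    exact ((Complex.ofRealCLM.contDiff.comp hs).contDiffAt).mul (c3.mul contDiffAt_const)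

lemma Jint_eq_Ioi {lam : ℝ} (hl : 0 < lam) (g : ℝ → ℂ) :
    ∫ w : ℝ, ((max w 0) ^ lam : ℝ) • g w = ∫ w in Set.Ioi (0:ℝ), ((w ^ lam : ℝ) : ℂ) * g w := by
  rw [← integral_indicator measurableSet_Ioi]
  congr 1; ext w
  by_cases hw : 0 < w
  · rw [Set.indicator_of_mem (by exact hw), max_eq_left hw.le, Complex.real_smul]
  · rw [Set.indicator_of_notMem (by exact hw), max_eq_right (not_lt.1 hw), Real.zero_rpow hl.ne', zero_smul]

lemma Jint_delta {lam : ℝ} (hl : 0 < lam) {Ψ : ℝ → ℝ} (hs : ContDiff ℝ (⊤ : ℕ∞) Ψ) (h1 : HasCompactSupport Ψ)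
    (v : ℝ) {δ : ℝ} (hδ : 0 < δ) :
    ∫ w in Set.Ioi (0:ℝ), ((w ^ lam : ℝ) : ℂ) * (Complex.exp (-((δ : ℂ) * w)) * FT1R Ψ (v + w)) =
    ∫ τ : ℝ, (Ψ τ : ℂ) * ((1 / ((δ:ℂ) + Complex.I * τ)) ^ ((lam + 1 : ℝ) : ℂ) * (Real.Gamma (lam + 1) : ℂ))
      * Complex.exp (-(Complex.I * (τ : ℂ) * (v : ℂ))) := by
  have hΨi : Integrable Ψ := hs.continuous.integrable_of_hasCompactSupport h1
  have hwi : IntegrableOn (fun w : ℝ => w ^ lam * Real.exp (-δ * w)) (Set.Ioi 0) :=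
    rpow_exp_integrable (by linarith) hδ
  have hc : Continuous (fun w : ℝ => ((w ^ lam : ℝ) : ℂ)) :=
    Complex.continuous_ofReal.comp (Real.continuous_rpow_const hl.le)
  have hcΨ := hs.continuous
  have e1 : ∀ w : ℝ, ((w ^ lam : ℝ) : ℂ) * (Complex.exp (-((δ : ℂ) * w)) * FT1R Ψ (v + w)) =
      ∫ τ : ℝ, ((w ^ lam : ℝ) : ℂ) * Complex.exp (-((δ : ℂ) * w)) *
        ((Ψ τ : ℂ) * Complex.exp (-(Complex.I * (τ : ℂ) * ((v + w : ℝ) : ℂ)))) := by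
    intro w
    rw [integral_const_mul, mul_assoc]
    rfl
  simp only [e1]
  rw [integral_integral_swap]
  · congr 1; ext τ
    have e2 : ∀ w : ℝ, ((w ^ lam : ℝ) : ℂ) * Complex.exp (-((δ : ℂ) * w)) *
        ((Ψ τ : ℂ) * Complex.exp (-(Complex.I * (τ : ℂ) * ((v + w : ℝ) : ℂ)))) =
        (((w ^ lam : ℝ) : ℂ) * Complex.exp (-(((δ:ℂ) + Complex.I * τ) * w))) *
        ((Ψ τ : ℂ) * Complex.exp (-(Complex.I * (τ : ℂ) * (v : ℂ)))) := by
      intro w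
      have : Complex.exp (-((δ : ℂ) * w)) * Complex.exp (-(Complex.I * (τ : ℂ) * ((v + w : ℝ) : ℂ))) =
        Complex.exp (-(((δ:ℂ) + Complex.I * τ) * w)) * Complex.exp (-(Complex.I * (τ : ℂ) * (v : ℂ))) := by
        rw [← Complex.exp_add, ← Complex.exp_add]; congr 1; push_cast; ring
      linear_combination ((w ^ lam : ℝ) : ℂ) * (Ψ τ : ℂ) * this
    simp only [e2]
    rw [integral_mul_const, laplace_rpow hl (by simpa using hδ)]
    ring
  · have := Integrable.mul_prod hwi hΨi
    refine Integrable.mono' this.norm ?_ ?_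
    · refine Continuous.aestronglyMeasurable ?_
      simp only [Function.uncurry_def]
      have := hc.comp (continuous_fst (X := ℝ) (Y := ℝ))
      exact (this.mul (by fun_prop)).mul (by fun_prop)
    · have hm : MeasurableSet {p : ℝ × ℝ | 0 < p.1} := measurableSet_lt measurable_const measurable_fst
      have hr : ((volume.restrict (Set.Ioi (0:ℝ))).prod (volume : Measure ℝ)) =
          ((volume : Measure ℝ).prod (volume : Measure ℝ)).restrict (Set.Ioi 0 ×ˢ Set.univ) := by
        rw [← Measure.prod_restrict, Measure.restrict_univ]
      rw [hr, ae_restrict_iff' (measurableSet_Ioi.prod MeasurableSet.univ)]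
      refine ae_of_all _ (fun p hp => ?_)
      have hp' : 0 < p.1 := hp.1
      simp only [Function.uncurry_def, norm_mul, Complex.norm_real]
      rw [Complex.norm_exp, Complex.norm_exp]
      have a1 : (-((δ : ℂ) * (p.1 : ℂ))).re = - δ * p.1 := by simp
      have a2 : (-(Complex.I * (p.2 : ℂ) * ((v + p.1 : ℝ) : ℂ))).re = 0 := by simp
      rw [a1, a2, Real.exp_zero, mul_one, Real.norm_of_nonneg (Real.exp_pos _).le]

lemma Jint_FT {lam : ℝ} (hl : 0 < lam) {Ψ : ℝ → ℝ} (hs : ContDiff ℝ (⊤ : ℕ∞) Ψ) (h1 : HasCompactSupport Ψ)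
    (h0 : ∀ x, |x| ≤ 1/2 → Ψ x = 0) (v : ℝ) :
    Jint lam (FT1R Ψ) v = FT1 (fdens lam Ψ) v := by
  have hsC : ContDiff ℝ (⊤ : ℕ∞) (fun s => (Ψ s : ℂ)) := Complex.ofRealCLM.contDiff.comp hs
  have h1C : HasCompactSupport (fun s => (Ψ s : ℂ)) := h1.comp_left (g := fun x : ℝ => (x:ℂ)) Complex.ofReal_zero
  obtain ⟨S, hS⟩ := FT1_schwartz hsC h1C
  have hS' : FT1R Ψ = S := by ext v; exact (hS v).symm
  have hΨi : Integrable Ψ := hs.continuous.integrable_of_hasCompactSupport h1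
  have lim1 : Tendsto (fun δ : ℝ => ∫ w in Set.Ioi (0:ℝ), ((w ^ lam : ℝ) : ℂ) *
      (Complex.exp (-((δ : ℂ) * w)) * FT1R Ψ (v + w))) (𝓝[>] 0) (𝓝 (Jint lam (FT1R Ψ) v)) := by
    rw [Jint, Jint_eq_Ioi hl]
    have hintg : IntegrableOn (fun w : ℝ => ((max w 0) ^ lam : ℝ) • S (v + w)) (Set.Ioi 0) :=
      (Jint_integrable hl S v).integrableOn
    refine tendsto_integral_filter_of_dominated_convergence
      (fun w => ‖((max w 0) ^ lam : ℝ) • S (v + w)‖) ?_ ?_ hintg.norm ?_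
    · refine Eventually.of_forall (fun δ => Continuous.aestronglyMeasurable ?_)
      have hc : Continuous (fun w : ℝ => ((w ^ lam : ℝ) : ℂ)) :=
        Complex.continuous_ofReal.comp (Real.continuous_rpow_const hl.le)
      have := S.continuous
      rw [hS']; fun_prop
    · filter_upwards [self_mem_nhdsWithin] with δ hδ
      refine (ae_restrict_iff' measurableSet_Ioi).2 (ae_of_all _ (fun w hw => ?_))
      have hw' : (0:ℝ) < w := hw
      have hδ' : (0:ℝ) < δ := hδ
      rw [max_eq_left hw'.le, Complex.real_smul, norm_mul, norm_mul, norm_mul, hS']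
      refine mul_le_mul_of_nonneg_left ?_ (norm_nonneg _)
      refine mul_le_of_le_one_left (norm_nonneg _) ?_
      rw [Complex.norm_exp, Real.exp_le_one_iff]
      simp; positivity
    · refine ae_of_all _ (fun w => ?_)
      have : Continuous (fun δ : ℝ => ((w ^ lam : ℝ) : ℂ) * (Complex.exp (-((δ : ℂ) * w)) * FT1R Ψ (v + w))) := by
        fun_prop
      have h := (this.tendsto 0).mono_left (nhdsWithin_le_nhds (s := Set.Ioi 0))
      simpa using h
  have lim2 : Tendsto (fun δ : ℝ => ∫ τ : ℝ, (Ψ τ : ℂ) * ((1 / ((δ:ℂ) + Complex.I * τ)) ^ ((lam + 1 : ℝ) : ℂ) * (Real.Gamma (lam + 1) : ℂ))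
      * Complex.exp (-(Complex.I * (τ : ℂ) * (v : ℂ)))) (𝓝[>] 0) (𝓝 (FT1 (fdens lam Ψ) v)) := by
    refine tendsto_integral_filter_of_dominated_convergence
      (fun τ => ‖Ψ τ‖ * (2 ^ (lam + 1) * ‖Real.Gamma (lam + 1)‖)) ?_ ?_ (hΨi.norm.mul_const _) ?_
    · refine Eventually.of_forall (fun δ => ?_)
      have := hs.continuous.measurable
      refine (Measurable.aestronglyMeasurable ?_)
      fun_prop
    · filter_upwards [self_mem_nhdsWithin] with δ hδ
      refine ae_of_all _ (fun τ => ?_)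
      by_cases hτ : |τ| ≤ 1/2
      · rw [h0 τ hτ]; simp
      · rw [norm_mul, norm_mul, norm_mul, Complex.norm_real, Complex.norm_real, Complex.norm_cpow_real,
          Complex.norm_exp]
        have a2 : (-(Complex.I * (τ : ℂ) * (v : ℂ))).re = 0 := by simp
        rw [a2, Real.exp_zero, mul_one]
        have : ‖1 / ((δ:ℂ) + Complex.I * τ)‖ ≤ 2 := by
          rw [norm_div, norm_one, div_le_iff₀]
          · have := Complex.abs_im_le_norm ((δ:ℂ) + Complex.I * τ)
            simp at this
            push Not at hτ
            linarith
          · have := Complex.abs_im_le_norm ((δ:ℂ) + Complex.I * τ)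
            simp at this
            push Not at hτ
            linarith
        gcongr
    · refine ae_of_all _ (fun τ => ?_)
      by_cases hτ : τ = 0
      · subst hτ
        have : Ψ 0 = 0 := h0 0 (by norm_num)
        simp [this, fdens]
      · have c1 : ContinuousAt (fun δ : ℝ => 1 / ((δ:ℂ) + Complex.I * τ)) 0 := by
          refine ContinuousAt.div continuousAt_const (by fun_prop) (by simp [hτ])
        have c2 : ContinuousAt (fun δ : ℝ => (1 / ((δ:ℂ) + Complex.I * τ)) ^ ((lam + 1 : ℝ) : ℂ)) 0 := by
          refine c1.cpow continuousAt_const ?_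
          simpa using one_div_I_mem hτ
        have c3 := ((continuousAt_const (y := (Ψ τ : ℂ))).mul (c2.mul (continuousAt_const (y := (Real.Gamma (lam + 1) : ℂ))))).mul
          (continuousAt_const (y := Complex.exp (-(Complex.I * (τ : ℂ) * (v : ℂ)))))
        have h : Tendsto (fun δ : ℝ => (Ψ τ : ℂ) * ((1 / ((δ:ℂ) + Complex.I * τ)) ^ ((lam + 1 : ℝ) : ℂ) * (Real.Gamma (lam + 1) : ℂ))
          * Complex.exp (-(Complex.I * (τ : ℂ) * (v : ℂ)))) (𝓝[>] 0)
          (𝓝 ((Ψ τ : ℂ) * ((1 / (((0:ℝ):ℂ) + Complex.I * τ)) ^ ((lam + 1 : ℝ) : ℂ) * (Real.Gamma (lam + 1) : ℂ))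
          * Complex.exp (-(Complex.I * (τ : ℂ) * (v : ℂ))))) := c3.tendsto.mono_left (nhdsWithin_le_nhds (s := Set.Ioi 0))
        rw [Complex.ofReal_zero, zero_add] at h
        exact h
  refine tendsto_nhds_unique lim1 (lim2.congr' ?_)
  filter_upwards [self_mem_nhdsWithin] with δ hδ
  exact (Jint_delta hl hs h1 v hδ).symm

/-- the change of variables in `hfun` at level zero -/
lemma hfun_zero_eq (χ Φ Ψ : ℝ → ℝ) (lam ϱ : ℝ) :
    hfun χ Φ Ψ lam 0 ϱ = ((2 * Real.pi)⁻¹ * χ ϱ : ℝ) • Jint lam (FT1R Φ) (ϱ - 1) := by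
  simp only [hfun, Jint]
  congr 1
  rw [← integral_sub_left_eq_self _ _ (1:ℝ)]
  congr 1; ext w
  congr 2 <;> ring_nf

lemma hfun_succ_eq (χ Φ Ψ : ℝ → ℝ) (lam : ℝ) (ϱ : ℝ) (j : ℕ) :
    hfun χ Φ Ψ lam (j + 1) ϱ = ((2 * Real.pi)⁻¹ * χ ϱ : ℝ) •
      (((2:ℝ) ^ (-(j * lam))) • Jint lam (FT1R Ψ) (2 ^ j * (ϱ - 1))) := by
  simp only [hfun, Jint]
  congr 1
  rw [← integral_sub_left_eq_self _ _ (1:ℝ)]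
  have h2 : (0:ℝ) < 2 ^ j := by positivity
  have := Measure.integral_comp_mul_left (fun w : ℝ => ((max w 0) ^ lam : ℝ) • FT1R Ψ (2 ^ j * (ϱ - 1) + w)) ((2:ℝ) ^ j)
  rw [abs_of_pos (by positivity)] at this
  have e : ∫ w : ℝ, ((max w 0) ^ lam : ℝ) • FT1R Ψ (2 ^ j * (ϱ - 1) + w) = ((2:ℝ) ^ j) •
     ∫ w : ℝ, ((max (2 ^ j * w) 0) ^ lam : ℝ) • FT1R Ψ (2 ^ j * (ϱ - 1) + 2 ^ j * w) := by
    rw [this, smul_smul, mul_inv_cancel₀ h2.ne', one_smul]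
  rw [e, ← integral_smul, ← integral_smul]
  congr 1; ext w
  have e1 : max (2 ^ j * w) 0 = 2 ^ j * max w 0 := by
    rw [mul_max_of_nonneg _ _ h2.le, mul_zero]
  have e2 : ((2:ℝ) ^ j) ^ lam = 2 ^ (j * lam) := by
    rw [Real.rpow_mul (by norm_num), Real.rpow_natCast]
  rw [e1, Real.mul_rpow h2.le (le_max_right _ _), e2, smul_smul, smul_smul, smul_smul]
  have e3 : (2:ℝ) ^ (-(j * lam)) * (2 ^ j * (2 ^ (j * lam) * max w 0 ^ lam)) = (max w 0 ^ lam) * 2 ^ j := by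
    rw [Real.rpow_neg (by norm_num)]; field_simp
  have e4 : 1 - (1 - w) = w := by ring
  have e5 : (2:ℝ) ^ j * (ϱ - (1 - w)) = 2 ^ j * (ϱ - 1) + 2 ^ j * w := by ring
  rw [e4, e5]
  congr 1
  linarith [e3]

end PartI

section PartJ

lemma HData.rep {lam : ℝ} (hl : 0 < lam) {N0 : ℕ} {χ Φ Ψ : ℝ → ℝ} (h : HData lam N0 χ Φ Ψ) :
    ∃ f : ℝ → ℂ, ContDiff ℝ (⊤ : ℕ∞) f ∧ (∀ τ, f τ ≠ 0 → 1/2 ≤ |τ| ∧ |τ| ≤ 2) ∧ HasCompactSupport f ∧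
      ∀ (j : ℕ) (ϱ : ℝ), hfun χ Φ Ψ lam (j + 1) ϱ =
        (((2:ℝ) ^ (-(j * lam)) : ℝ) : ℂ) * ((χ ϱ : ℂ) * FT1 f (2 ^ j * (ϱ - 1))) := by
  have hz : ∀ τ, (((2 * Real.pi)⁻¹ : ℝ) : ℂ) * fdens lam Ψ τ ≠ 0 → 1/2 ≤ |τ| ∧ |τ| ≤ 2 := by
    intro τ hτ
    constructor
    · by_contra hc
      push Not at hc
      exact hτ (by rw [fdens_zero (h.Ψ_small hc.le), mul_zero])
    · by_contra hc
      push Not at hc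
      exact hτ (by rw [fdens_zero (h.Ψ_big hc.le), mul_zero])
  refine ⟨fun τ => (((2 * Real.pi)⁻¹ : ℝ) : ℂ) * fdens lam Ψ τ, ?_, hz, ?_, ?_⟩
  · exact contDiff_const.mul (fdens_sm lam h.Ψ_sm (fun x hx => h.Ψ_small hx))
  · refine compact_of_abs (R := 3) (fun x hx => ?_)
    by_contra hc
    have := hz x hc
    linarith [this.2]
  · intro j ϱ
    rw [hfun_succ_eq, Jint_FT hl h.Ψ_sm (compact_of_abs (R := 2) fun x hx => h.Ψ_big hx) (fun x hx => h.Ψ_small hx)]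
    have : FT1 (fun τ => (((2 * Real.pi)⁻¹ : ℝ) : ℂ) * fdens lam Ψ τ) (2 ^ j * (ϱ - 1)) =
       (((2 * Real.pi)⁻¹ : ℝ) : ℂ) * FT1 (fdens lam Ψ) (2 ^ j * (ϱ - 1)) := by
      simp only [FT1, mul_assoc]
      rw [integral_const_mul]
    rw [this, Complex.real_smul, Complex.real_smul]
    push_cast; ring

lemma FT1_conj (f : ℝ → ℂ) (v : ℝ) :
    (starRingEnd ℂ) (FT1 f v) = FT1 (fun τ => (starRingEnd ℂ) (f τ)) (-v) := by
  simp only [FT1]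
  rw [← integral_conj]
  congr 1; ext s
  rw [map_mul, ← Complex.exp_conj]
  congr 2
  simp

/-- Averaging over the frequency variable. -/
lemma FT1_avg {d : ℕ} {ρ : Euc d → ℝ} (hc : Continuous ρ) {f : ℝ → ℂ} (hf : Continuous f)
    (hfs : HasCompactSupport f) {G : Euc d → ℂ} (hG : Continuous G) (hGs : HasCompactSupport G)
    (a B : ℝ) (h : ∀ τ, f τ ≠ 0 → ‖∫ ξ, G ξ * Complex.exp (Complex.I * (((-(a * τ)) * ρ ξ : ℝ) : ℂ))‖ ≤ B) :
    ‖∫ ξ, G ξ * FT1 f (a * (ρ ξ - 1))‖ ≤ (∫ τ, ‖f τ‖) * B := by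
  have e1 : ∀ ξ, G ξ * FT1 f (a * (ρ ξ - 1)) = ∫ τ : ℝ, G ξ *
      (f τ * Complex.exp (-(Complex.I * (τ : ℂ) * ((a * (ρ ξ - 1) : ℝ) : ℂ)))) := by
    intro ξ
    rw [integral_const_mul]; rfl
  simp only [e1]
  rw [integral_integral_swap_of_hasCompactSupport]
  · have e2 : ∀ τ : ℝ, (∫ ξ, G ξ * (f τ * Complex.exp (-(Complex.I * (τ : ℂ) * ((a * (ρ ξ - 1) : ℝ) : ℂ))))) =
       (f τ * Complex.exp (Complex.I * ((a * τ : ℝ) : ℂ))) *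
         ∫ ξ, G ξ * Complex.exp (Complex.I * (((-(a * τ)) * ρ ξ : ℝ) : ℂ)) := by
      intro τ
      rw [← integral_const_mul]
      congr 1; ext ξ
      have : Complex.exp (-(Complex.I * (τ : ℂ) * ((a * (ρ ξ - 1) : ℝ) : ℂ))) =
        Complex.exp (Complex.I * ((a * τ : ℝ) : ℂ)) * Complex.exp (Complex.I * (((-(a * τ)) * ρ ξ : ℝ) : ℂ)) := by
        rw [← Complex.exp_add]; congr 1; push_cast; ring
      rw [this]; ring
    simp only [e2]
    rw [← integral_mul_const]
    refine norm_integral_le_of_norm_le ((hf.norm.integrable_of_hasCompactSupport hfs.norm).mul_const B) (ae_of_all _ fun τ => ?_)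
    by_cases hτ : f τ = 0
    · simp [hτ]
    · rw [norm_mul, norm_mul, norm_cexp_I_mul, mul_one]
      exact mul_le_mul_of_nonneg_left (h τ hτ) (norm_nonneg _)
  · simp only [Function.uncurry_def]
    fun_prop
  · refine HasCompactSupport.intro (K := tsupport G ×ˢ tsupport f) (hGs.prod hfs) ?_
    rintro ⟨ξ, τ⟩ hp
    rw [Set.mem_prod, not_and_or] at hp
    simp only [Function.uncurry_def]
    rcases hp with hp | hp
    · rw [image_eq_zero_of_notMem_tsupport hp, zero_mul]
    · rw [image_eq_zero_of_notMem_tsupport hp, zero_mul, mul_zero]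

lemma tsupport_sub_of {β : Type*} [Zero β] {g : ℝ → β} (h : ∀ t ∉ Set.Icc (1/2:ℝ) 2, g t = 0) :
    (0:ℝ) ∉ tsupport g ∧ HasCompactSupport g := by
  have : tsupport g ⊆ Set.Icc (1/2:ℝ) 2 := by
    refine closure_minimal (fun t ht => ?_) isClosed_Icc
    by_contra hc; exact ht (h t hc)
  refine ⟨fun h0 => ?_, HasCompactSupport.intro isCompact_Icc h⟩
  have := (this h0).1
  norm_num at this

lemma FT1_norms {f : ℝ → ℂ} (hf : ContDiff ℝ (⊤ : ℕ∞) f) (hfs : HasCompactSupport f) :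
    ContDiff ℝ (⊤ : ℕ∞) (FT1 f) ∧ Integrable (FT1 f) ∧ ∃ M, 0 ≤ M ∧ ∀ v, ‖FT1 f v‖ ≤ M := by
  obtain ⟨S, hS⟩ := FT1_schwartz hf hfs
  have e : FT1 f = S := by ext v; exact (hS v).symm
  rw [e]
  refine ⟨S.smooth _, S.integrable, ?_⟩
  refine ⟨_, ?_, fun x => SchwartzMap.norm_le_seminorm ℝ S x⟩
  positivity

lemma bdd_of_supp {χ : ℝ → ℝ} (hχ : Continuous χ) (hχs : ∀ t ∉ Set.Icc (1/2:ℝ) 2, χ t = 0) :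
    ∃ M, 0 ≤ M ∧ ∀ t, |χ t| ≤ M := by
  obtain ⟨M, hM⟩ := hχ.bounded_above_of_compact_support (tsupport_sub_of hχs).2
  exact ⟨M, (norm_nonneg _).trans (hM 0), hM⟩

end PartJ

section PartK

lemma int_h {χ : ℝ → ℝ} {M : ℝ} (hM0 : 0 ≤ M) (hM : ∀ t, |χ t| ≤ M)
    {H : ℝ → ℂ} (hH : Integrable H) (j : ℕ) :
    (∫ t : ℝ, ‖(χ t : ℂ) * H (2 ^ j * (t - 1))‖) ≤ M * (2 * (∫ v, ‖H v‖) / 2 ^ (j + 1)) := by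
  have h2 : (0:ℝ) < 2 ^ j := by positivity
  have e : (∫ t : ℝ, ‖H (2 ^ j * (t - 1))‖) = (∫ v, ‖H v‖) / 2 ^ j := by
    rw [integral_sub_right_eq_self (fun t : ℝ => ‖H (2 ^ j * t)‖) (1:ℝ)]
    rw [Measure.integral_comp_mul_left (fun t : ℝ => ‖H t‖) ((2:ℝ) ^ j), abs_of_pos (by positivity), smul_eq_mul]
    field_simp
  have hi : Integrable (fun t : ℝ => H (2 ^ j * (t - 1))) := 
    (hH.comp_mul_left' h2.ne').comp_sub_right (1:ℝ)
  calc (∫ t : ℝ, ‖(χ t : ℂ) * H (2 ^ j * (t - 1))‖) ≤ ∫ t : ℝ, M * ‖H (2 ^ j * (t - 1))‖ := by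
        refine integral_mono_of_nonneg (ae_of_all _ fun t => norm_nonneg _) (hi.norm.const_mul M) (ae_of_all _ fun t => ?_)
        simp only
        rw [norm_mul, Complex.norm_real]
        exact mul_le_mul_of_nonneg_right (hM t) (norm_nonneg _)
    _ = M * ((∫ v, ‖H v‖) / 2 ^ j) := by rw [integral_const_mul, e]
    _ = _ := by rw [pow_succ]; field_simp

variable {d : ℕ} {Ω : Set (Euc d)} {ρ : Euc d → ℝ}

lemma IsMinkowskiGauge.Gc (hρ : IsMinkowskiGauge d Ω ρ) {χ : ℝ → ℝ} (hχ : ContDiff ℝ (⊤ : ℕ∞) χ)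
    (hχs : ∀ t ∉ Set.Icc (1/2:ℝ) 2, χ t = 0) (x : Euc d) :
    Continuous (fun ξ : Euc d => (χ (ρ ξ) : ℂ) * Complex.exp (Complex.I * ((⟪x, ξ⟫ : ℝ) : ℂ))) ∧
    HasCompactSupport (fun ξ : Euc d => (χ (ρ ξ) : ℂ) * Complex.exp (Complex.I * ((⟪x, ξ⟫ : ℝ) : ℂ))) := by
  constructor
  · have := hρ.cont
    have := hχ.continuous
    fun_prop
  · refine HasCompactSupport.mul_right (f := fun ξ : Euc d => (χ (ρ ξ) : ℂ)) ?_
    exact (hρ.comp_compact (tsupport_sub_of hχs).2).comp_left (g := fun x : ℝ => (x:ℂ)) Complex.ofReal_zero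

lemma IsMinkowskiGauge.succ_bound (hd : 2 ≤ d) (hρ : IsMinkowskiGauge d Ω ρ) (hcurv : HasNonvanishingCurvature d ρ)
    {χ : ℝ → ℝ} (hχ : ContDiff ℝ (⊤ : ℕ∞) χ) (hχs : ∀ t ∉ Set.Icc (1/2:ℝ) 2, χ t = 0)
    {f : ℝ → ℂ} (hf : ContDiff ℝ (⊤ : ℕ∞) f) (hfs : HasCompactSupport f)
    (hfz : ∀ τ, f τ ≠ 0 → 1/2 ≤ |τ| ∧ |τ| ≤ 2) (N : ℕ) :
    ∃ C, 0 ≤ C ∧ ∀ (j : ℕ) (x : Euc d), ((2:ℝ) ^ (j+1)) ^ (((d:ℝ) + 1) / 2) *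
      ‖∫ ξ, ((χ (ρ ξ) : ℂ) * FT1 f (2 ^ j * (ρ ξ - 1))) * Complex.exp (Complex.I * ((⟪x, ξ⟫ : ℝ) : ℂ))‖ *
        (1 + ‖x‖ / 2 ^ (j+1)) ^ N ≤ C := by
  obtain ⟨cS, hcS, hS⟩ := hρ.decayS hd hcurv
  obtain ⟨c0, hc0, hZ⟩ := hρ.decayZ hd hχ hχs
  obtain ⟨C0, hC0, hW⟩ := hρ.decayW hχ hχs
  obtain ⟨cZ, hcZ, hZ⟩ := hZ d
  obtain ⟨cW, hcW, hW⟩ := hW (N + d)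
  obtain ⟨Mχ, hMχ0, hMχ⟩ := bdd_of_supp hχ.continuous hχs
  obtain ⟨hHc, hHi, -⟩ := FT1_norms hf hfs
  set f1 := ∫ τ, ‖f τ‖ with hf1
  have hf10 : 0 ≤ f1 := integral_nonneg fun _ => norm_nonneg _
  set H1 := ∫ v, ‖FT1 f v‖ with hH1
  have hH10 : 0 ≤ H1 := integral_nonneg fun _ => norm_nonneg _
  set q : ℝ := ((d:ℝ) - 1) / 2 with hq
  have hd2 : (2:ℝ) ≤ d := by exact_mod_cast hd
  set CZ := f1 * cZ * 4 ^ d * (1 + c0) ^ N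
  set CW := f1 * cW * 2 ^ N
  set CS := cS * (c0 / 4) ^ (-q) * (Mχ * (2 * H1)) * (1 + C0) ^ N
  have hCZ : 0 ≤ CZ := by positivity
  have hCW : 0 ≤ CW := by positivity
  have hCS : 0 ≤ CS := by positivity
  refine ⟨CZ + CW + CS, by positivity, fun j x => ?_⟩
  have hR1 : (1:ℝ) ≤ 2 ^ (j+1) := one_le_pow₀ (by norm_num)
  have hRj : (2:ℝ) ^ (j+1) = 2 * 2 ^ j := by ring
  have hRd : ((2:ℝ) ^ (j+1)) ^ (((d:ℝ) + 1) / 2) ≤ (2 ^ (j+1)) ^ d := by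
    rw [← Real.rpow_natCast _ d]
    exact Real.rpow_le_rpow_of_exponent_le hR1 (by linarith)
  obtain ⟨hGc, hGs⟩ := hρ.Gc hχ hχs x
  have havg : ∀ B, (∀ τ, f τ ≠ 0 → ‖∫ ξ, ((χ (ρ ξ) : ℂ) * Complex.exp (Complex.I * ((⟪x, ξ⟫ : ℝ) : ℂ))) *
      Complex.exp (Complex.I * (((-(2^j * τ)) * ρ ξ : ℝ) : ℂ))‖ ≤ B) →
      ‖∫ ξ, ((χ (ρ ξ) : ℂ) * FT1 f (2 ^ j * (ρ ξ - 1))) * Complex.exp (Complex.I * ((⟪x, ξ⟫ : ℝ) : ℂ))‖ ≤ f1 * B := by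
    intro B hB
    have := FT1_avg hρ.cont hf.continuous hfs hGc hGs (2 ^ j) B hB
    convert this using 4
    ring
  have hcomm : ∀ τ : ℝ, ∫ ξ, ((χ (ρ ξ) : ℂ) * Complex.exp (Complex.I * ((⟪x, ξ⟫ : ℝ) : ℂ))) *
      Complex.exp (Complex.I * ((τ * ρ ξ : ℝ) : ℂ)) = ∫ ξ, (χ (ρ ξ) : ℂ) * Complex.exp (Complex.I * ((τ * ρ ξ : ℝ) : ℂ)) *
        Complex.exp (Complex.I * ((⟪x, ξ⟫ : ℝ) : ℂ)) := by
    intro τ; congr 1; ext ξ; ring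
  have habs : ∀ τ : ℝ, |-(2 ^ j * τ)| = 2 ^ j * |τ| := by
    intro τ; rw [abs_neg, abs_mul, abs_of_pos (by positivity)]
  generalize hR : (2:ℝ) ^ (j+1) = R at *
  have hRp : 0 < R := by linarith
  set P := ‖∫ ξ, ((χ (ρ ξ) : ℂ) * FT1 f (2 ^ j * (ρ ξ - 1))) * Complex.exp (Complex.I * ((⟪x, ξ⟫ : ℝ) : ℂ))‖
  have hP0 : 0 ≤ P := norm_nonneg _
  rcases le_or_gt ‖x‖ (c0 * (R / 4)) with hx | hx
  · have h1 : P ≤ f1 * (cZ / (R / 4) ^ d) := by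
      refine havg _ fun τ hτ => ?_
      obtain ⟨a1, a2⟩ := hfz τ hτ
      have a3 : R / 4 ≤ |-(2 ^ j * τ)| := by
        rw [habs]; nlinarith [show (0:ℝ) < 2 ^ j by positivity]
      rw [hcomm]
      refine (hZ _ x ?_ (hx.trans ?_)).trans ?_
      · rw [← abs_pos]; linarith
      · gcongr
      · gcongr
    have h2 : (1 + ‖x‖ / R) ^ N ≤ (1 + c0) ^ N := by
      have : ‖x‖ / R ≤ c0 := by rw [div_le_iff₀ hRp]; nlinarith
      gcongr
    calc R ^ (((d:ℝ) + 1) / 2) * P * (1 + ‖x‖ / R) ^ N ≤ R ^ d * (f1 * (cZ / (R / 4) ^ d)) * (1 + c0) ^ N := by gcongr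
      _ = CZ := by rw [div_pow]; field_simp; rfl
      _ ≤ _ := by linarith
  rcases le_or_gt (C0 * R) ‖x‖ with hx' | hx'
  · have hRx : R ≤ ‖x‖ := by nlinarith
    have hx1 : 1 ≤ ‖x‖ := hR1.trans hRx
    have h1 : P ≤ f1 * (cW / ‖x‖ ^ (N + d)) := by
      refine havg _ fun τ hτ => ?_
      obtain ⟨a1, a2⟩ := hfz τ hτ
      have a3 : |-(2 ^ j * τ)| ≤ R := by
        rw [habs]; nlinarith [show (0:ℝ) < 2 ^ j by positivity]
      rw [hcomm]
      refine (hW _ x (norm_pos_iff.1 (by linarith)) (le_trans ?_ hx'))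
      gcongr
    have h2 : (1 + ‖x‖ / R) ^ N ≤ (2 * ‖x‖) ^ N := by
      have : ‖x‖ / R ≤ ‖x‖ := div_le_self (norm_nonneg _) hR1
      gcongr; linarith
    calc R ^ (((d:ℝ) + 1) / 2) * P * (1 + ‖x‖ / R) ^ N ≤ ‖x‖ ^ d * (f1 * (cW / ‖x‖ ^ (N + d))) * (2 * ‖x‖) ^ N := by
          gcongr
          exact hRd.trans (by gcongr)
      _ = CW := by
          rw [pow_add, mul_pow]; field_simp; rfl
      _ ≤ _ := by linarith
  · have h1 : P ≤ cS * (1 + ‖x‖) ^ (-q) * (Mχ * (2 * H1 / R)) := by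
      refine (hS (fun t => (χ t : ℂ) * FT1 f (2 ^ j * (t - 1))) ?_ ?_ x).trans ?_
      · have := hχ.continuous
        have := hHc.continuous
        fun_prop
      · intro t ht; simp only [hχs t ht, Complex.ofReal_zero, zero_mul]
      · have := int_h hMχ0 hMχ hHi j
        rw [hR] at this
        gcongr
    have h2 : (1 + ‖x‖ / R) ^ N ≤ (1 + C0) ^ N := by
      have : ‖x‖ / R ≤ C0 := by rw [div_le_iff₀ hRp]; exact hx'.le
      gcongr
    have h3 : (1 + ‖x‖) ^ (-q) ≤ (c0 / 4) ^ (-q) * R ^ (-q) := by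
      rw [← Real.mul_rpow (by positivity) hRp.le]
      refine Real.rpow_le_rpow_of_nonpos (by positivity) ?_ (by rw [hq]; linarith)
      nlinarith
    have h4 : R ^ (((d:ℝ) + 1) / 2) * R ^ (-q) = R := by
      rw [← Real.rpow_add hRp, hq]
      ring_nf; exact Real.rpow_one R
    calc R ^ (((d:ℝ) + 1) / 2) * P * (1 + ‖x‖ / R) ^ N ≤
        R ^ (((d:ℝ) + 1) / 2) * (cS * ((c0 / 4) ^ (-q) * R ^ (-q)) * (Mχ * (2 * H1 / R))) * (1 + C0) ^ N := by
          gcongr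
          exact h1.trans (by gcongr)
      _ = (R ^ (((d:ℝ) + 1) / 2) * R ^ (-q)) * (cS * (c0 / 4) ^ (-q) * (Mχ * (2 * H1 / R)) * (1 + C0) ^ N) := by ring
      _ = CS := by rw [h4]; field_simp; simp only [CS]; ring
      _ ≤ _ := by linarith

lemma IsMinkowskiGauge.cross_bound (hd : 2 ≤ d) (hρ : IsMinkowskiGauge d Ω ρ) (hcurv : HasNonvanishingCurvature d ρ)
    {χ : ℝ → ℝ} (hχ : ContDiff ℝ (⊤ : ℕ∞) χ) (hχs : ∀ t ∉ Set.Icc (1/2:ℝ) 2, χ t = 0)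
    {f : ℝ → ℂ} (hf : ContDiff ℝ (⊤ : ℕ∞) f) (hfs : HasCompactSupport f)
    (hfz : ∀ τ, f τ ≠ 0 → 1/2 ≤ |τ| ∧ |τ| ≤ 2) (N : ℕ) :
    ∃ C, 0 ≤ C ∧ ∀ (j j' : ℕ) (x : Euc d), j' ≤ j → 
      ‖∫ ξ, (((χ (ρ ξ) * χ (ρ ξ) : ℝ) : ℂ) * FT1 f (2 ^ j * (ρ ξ - 1)) * (starRingEnd ℂ) (FT1 f (2 ^ j' * (ρ ξ - 1))))
        * Complex.exp (Complex.I * ((⟪x, ξ⟫ : ℝ) : ℂ))‖ *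
        (1 + ‖x‖ / 2 ^ (j+1)) ^ N * 2 ^ (j+1) * (1 + ‖x‖) ^ (((d:ℝ) - 1) / 2) ≤ C := by
  obtain ⟨cS, hcS, hS⟩ := hρ.decayS hd hcurv
  have hχ2 : ContDiff ℝ (⊤ : ℕ∞) (fun t => χ t * χ t) := hχ.mul hχ
  have hχsqs : ∀ t ∉ Set.Icc (1/2:ℝ) 2, χ t * χ t = 0 := fun t ht => by rw [hχs t ht, zero_mul]
  obtain ⟨C0, hC0, hW⟩ := hρ.decayW hχ2 hχsqs
  obtain ⟨cW, hcW, hW⟩ := hW (N + d + 1)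
  obtain ⟨Mχ, hMχ0, hMχ⟩ := bdd_of_supp hχ2.continuous hχsqs
  obtain ⟨hHc, hHi, MH, hMH0, hMH⟩ := FT1_norms hf hfs
  set f1 := ∫ τ, ‖f τ‖ with hf1
  have hf10 : 0 ≤ f1 := integral_nonneg fun _ => norm_nonneg _
  set H1 := ∫ v, ‖FT1 f v‖ with hH1
  have hH10 : 0 ≤ H1 := integral_nonneg fun _ => norm_nonneg _
  set q : ℝ := ((d:ℝ) - 1) / 2 with hq
  have hd2 : (2:ℝ) ≤ d := by exact_mod_cast hd
  set CW := f1 * (f1 * cW) * 2 ^ N * 2 ^ d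
  set CS := cS * (MH * (Mχ * (2 * H1))) * (1 + 2 * C0) ^ N
  have hCW : 0 ≤ CW := by positivity
  have hCS : 0 ≤ CS := by positivity
  refine ⟨CW + CS, by positivity, fun j j' x hjj => ?_⟩
  have hR1 : (1:ℝ) ≤ 2 ^ (j+1) := one_le_pow₀ (by norm_num)
  have hRj : (2:ℝ) ^ (j+1) = 2 * 2 ^ j := by ring
  have hjj2 : (2:ℝ) ^ j' ≤ 2 ^ j := pow_le_pow_right₀ (by norm_num) hjj
  obtain ⟨hGc, hGs⟩ := hρ.Gc hχ2 hχsqs x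
  have hρc := hρ.cont
  have hfbc : Continuous (fun τ => (starRingEnd ℂ) (f τ)) := Complex.continuous_conj.comp hf.continuous
  have hfbs : HasCompactSupport (fun τ => (starRingEnd ℂ) (f τ)) := 
    hfs.comp_left (g := fun z : ℂ => (starRingEnd ℂ) z) (map_zero _)
  have hfb1 : ∫ τ, ‖(starRingEnd ℂ) (f τ)‖ = f1 := by simp [hf1]
  have hHc' := hHc.continuous
  have hcc : ∀ τ : ℝ, Continuous (fun ξ : Euc d => Complex.exp (Complex.I * (((-(2 ^ j * τ)) * ρ ξ : ℝ) : ℂ))) := by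
    intro τ; fun_prop
  have havg : ∀ B, (∀ τ τ', f τ ≠ 0 → f τ' ≠ 0 → ‖∫ ξ, ((χ (ρ ξ) * χ (ρ ξ) : ℝ) : ℂ) * 
      Complex.exp (Complex.I * (((-(2^j * τ) + 2 ^ j' * τ') * ρ ξ : ℝ) : ℂ)) * Complex.exp (Complex.I * ((⟪x, ξ⟫ : ℝ) : ℂ))‖ ≤ B) →
      ‖∫ ξ, (((χ (ρ ξ) * χ (ρ ξ) : ℝ) : ℂ) * FT1 f (2 ^ j * (ρ ξ - 1)) * (starRingEnd ℂ) (FT1 f (2 ^ j' * (ρ ξ - 1))))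
        * Complex.exp (Complex.I * ((⟪x, ξ⟫ : ℝ) : ℂ))‖ ≤ f1 * (f1 * B) := by
    intro B hB
    have h1 := FT1_avg (f := f) hρc hf.continuous hfs (G := fun ξ => (((χ (ρ ξ) * χ (ρ ξ) : ℝ) : ℂ) * 
      Complex.exp (Complex.I * ((⟪x, ξ⟫ : ℝ) : ℂ))) * (starRingEnd ℂ) (FT1 f (2 ^ j' * (ρ ξ - 1))))
      (hGc.mul (Complex.continuous_conj.comp (by fun_prop))) hGs.mul_right (2 ^ j) (f1 * B) ?_
    · convert h1 using 4
      ring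
    intro τ hτ
    have h2 := FT1_avg (f := fun τ => (starRingEnd ℂ) (f τ)) hρc hfbc hfbs (G := fun ξ => (((χ (ρ ξ) * χ (ρ ξ) : ℝ) : ℂ) * 
      Complex.exp (Complex.I * ((⟪x, ξ⟫ : ℝ) : ℂ))) * Complex.exp (Complex.I * (((-(2 ^ j * τ)) * ρ ξ : ℝ) : ℂ)))
      (hGc.mul (hcc τ)) hGs.mul_right (-(2 ^ j')) B ?_
    · rw [hfb1] at h2
      convert h2 using 4 with ξ
      rw [FT1_conj, ← neg_mul]; ring
    intro τ' hτ'
    have h3 := hB τ τ' hτ (by intro h; apply hτ'; rw [h, map_zero])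
    convert h3 using 4 with ξ
    have : Complex.exp (Complex.I * (((-(2^j * τ) + 2 ^ j' * τ') * ρ ξ : ℝ) : ℂ)) =
      Complex.exp (Complex.I * (((-(2 ^ j * τ)) * ρ ξ : ℝ) : ℂ)) * Complex.exp (Complex.I * (((-(-2 ^ j' * τ')) * ρ ξ : ℝ) : ℂ)) := by
      rw [← Complex.exp_add]; congr 1; push_cast; ring
    rw [this]; ring
  generalize hR : (2:ℝ) ^ (j+1) = R at *
  have hRp : 0 < R := by linarith
  set P := ‖∫ ξ, (((χ (ρ ξ) * χ (ρ ξ) : ℝ) : ℂ) * FT1 f (2 ^ j * (ρ ξ - 1)) * (starRingEnd ℂ) (FT1 f (2 ^ j' * (ρ ξ - 1))))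
        * Complex.exp (Complex.I * ((⟪x, ξ⟫ : ℝ) : ℂ))‖
  have hP0 : 0 ≤ P := norm_nonneg _
  rcases le_or_gt (C0 * (2 * R)) ‖x‖ with hx' | hx'
  · have hRx : R ≤ ‖x‖ := by nlinarith
    have hx1 : 1 ≤ ‖x‖ := hR1.trans hRx
    have h1 : P ≤ f1 * (f1 * (cW / ‖x‖ ^ (N + d + 1))) := by
      refine havg _ fun τ τ' hτ hτ' => ?_
      obtain ⟨a1, a2⟩ := hfz τ hτ
      obtain ⟨a1', a2'⟩ := hfz τ' hτ'
      have a3 : |-(2 ^ j * τ) + 2 ^ j' * τ'| ≤ 2 * R := by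
        refine (abs_add_le _ _).trans ?_
        rw [abs_neg, abs_mul, abs_mul, abs_of_pos (show (0:ℝ) < 2 ^ j by positivity), abs_of_pos (show (0:ℝ) < 2 ^ j' by positivity)]
        have b1 : (2:ℝ) ^ j * |τ| ≤ 2 ^ j * 2 := by gcongr
        have b2 : (2:ℝ) ^ j' * |τ'| ≤ 2 ^ j * 2 := by gcongr
        linarith
      refine (hW _ x (norm_pos_iff.1 (by linarith)) (le_trans ?_ hx'))
      gcongr
    have h2 : (1 + ‖x‖ / R) ^ N ≤ (2 * ‖x‖) ^ N := by
      have : ‖x‖ / R ≤ ‖x‖ := div_le_self (norm_nonneg _) hR1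
      gcongr; linarith
    have h3 : (1 + ‖x‖) ^ q ≤ (2 * ‖x‖) ^ d := by
      calc (1 + ‖x‖) ^ q ≤ (1 + ‖x‖) ^ (d:ℝ) := Real.rpow_le_rpow_of_exponent_le (by linarith) (by rw [hq]; linarith)
        _ = (1 + ‖x‖) ^ d := Real.rpow_natCast _ _
        _ ≤ _ := by gcongr; linarith
    calc P * (1 + ‖x‖ / R) ^ N * R * (1 + ‖x‖) ^ q ≤ f1 * (f1 * (cW / ‖x‖ ^ (N + d + 1))) * (2 * ‖x‖) ^ N * ‖x‖ * (2 * ‖x‖) ^ d := by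
          gcongr
      _ = CW := by
          rw [pow_add, pow_add, mul_pow, mul_pow]; field_simp; simp only [CW]; ring
      _ ≤ _ := by linarith
  · have h1 : P ≤ cS * (1 + ‖x‖) ^ (-q) * (MH * (Mχ * (2 * H1 / R))) := by
      refine (hS (fun t => ((χ t * χ t : ℝ) : ℂ) * FT1 f (2 ^ j * (t - 1)) * (starRingEnd ℂ) (FT1 f (2 ^ j' * (t - 1)))) ?_ ?_ x).trans ?_
      · have := hχ.continuous
        exact (by fun_prop : Continuous fun t => ((χ t * χ t : ℝ) : ℂ) * FT1 f (2 ^ j * (t - 1))).mul (Complex.continuous_conj.comp (by fun_prop))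
      · intro t ht; simp only [hχsqs t ht, Complex.ofReal_zero, zero_mul]
      · have := int_h hMχ0 hMχ hHi j
        rw [hR] at this
        gcongr
        refine le_trans ?_ (mul_le_mul_of_nonneg_left this hMH0)
        rw [← integral_const_mul]
        have hχsqc : Continuous (fun t : ℝ => ((χ t * χ t : ℝ) : ℂ)) := Complex.continuous_ofReal.comp hχ2.continuous
        refine integral_mono_of_nonneg (ae_of_all _ fun t => norm_nonneg _) (Integrable.const_mul ?_ _) (ae_of_all _ fun t => ?_)
        · refine Integrable.norm (Continuous.integrable_of_hasCompactSupport (by fun_prop) ?_)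
          exact HasCompactSupport.mul_right ((tsupport_sub_of hχsqs).2.comp_left (g := fun x : ℝ => (x:ℂ)) Complex.ofReal_zero)
        · simp only
          rw [norm_mul, mul_comm]
          gcongr
          rw [RCLike.norm_conj]; exact hMH _
    have h2 : (1 + ‖x‖ / R) ^ N ≤ (1 + 2 * C0) ^ N := by
      have : ‖x‖ / R ≤ 2 * C0 := by rw [div_le_iff₀ hRp]; linarith
      gcongr
    have h4 : (1 + ‖x‖) ^ (-q) * (1 + ‖x‖) ^ q = 1 := by
      rw [← Real.rpow_add (by positivity)]; simp
    calc P * (1 + ‖x‖ / R) ^ N * R * (1 + ‖x‖) ^ q ≤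
        (cS * (1 + ‖x‖) ^ (-q) * (MH * (Mχ * (2 * H1 / R)))) * (1 + 2 * C0) ^ N * R * (1 + ‖x‖) ^ q := by
          gcongr
      _ = ((1 + ‖x‖) ^ (-q) * (1 + ‖x‖) ^ q) * (cS * (MH * (Mχ * (2 * H1))) * (1 + 2 * C0) ^ N) * (R / R) := by ring
      _ = CS := by rw [h4, div_self hRp.ne', one_mul, mul_one]
      _ ≤ _ := by linarith

end PartK

section PartL

variable {d : ℕ} {Ω : Set (Euc d)} {ρ : Euc d → ℝ}

/-- The zero set of a nontrivial Fourier transform of a compactly supported function is null. -/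
lemma invFT_ne_zero {m : Euc d → ℂ} (hm : Continuous m) (hms : HasCompactSupport m) {x0 : Euc d}
    (h0 : (∫ ξ, m ξ * Complex.exp (Complex.I * ((⟪x0, ξ⟫ : ℝ) : ℂ))) ≠ 0) :
    ∀ᵐ x : Euc d, (∫ ξ, m ξ * Complex.exp (Complex.I * ((⟪x, ξ⟫ : ℝ) : ℂ))) ≠ 0 := by
  set g : Euc d → ℂ := fun x => ∫ ξ, m ξ * Complex.exp (Complex.I * ((⟪x, ξ⟫ : ℝ) : ℂ)) with hg
  have hgc : Continuous g := by
    have h1 := continuous_parametric_integral_of_continuous (μ := (volume : Measure (Euc d)))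
      (f := fun x ξ => m ξ * Complex.exp (Complex.I * ((⟪x, ξ⟫ : ℝ) : ℂ))) (s := tsupport m)
      (by simp only [Function.uncurry_def]; fun_prop) hms
    refine h1.congr (fun x => ?_)
    refine setIntegral_eq_integral_of_forall_compl_eq_zero (fun ξ hξ => ?_)
    rw [image_eq_zero_of_notMem_tsupport hξ, zero_mul]
  -- lines
  have hline : ∀ v : Euc d, ∀ᵐ t : ℝ, g (x0 + t • v) ≠ 0 := by
    intro v
    set φ : ℂ → ℂ := fun z => ∫ ξ, (m ξ * Complex.exp (Complex.I * ((⟪x0, ξ⟫ : ℝ) : ℂ))) * 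
      Complex.exp (z * (Complex.I * ((⟪v, ξ⟫ : ℝ) : ℂ))) with hφ
    have hφd : Differentiable ℂ φ := by
      intro z0
      refine (hasDerivAt_integral_of_dominated_loc_of_deriv_le (𝕜 := ℂ)
        (F' := fun z ξ => (m ξ * Complex.exp (Complex.I * ((⟪x0, ξ⟫ : ℝ) : ℂ))) * 
          (Complex.exp (z * (Complex.I * ((⟪v, ξ⟫ : ℝ) : ℂ))) * (Complex.I * ((⟪v, ξ⟫ : ℝ) : ℂ))))
        (bound := fun ξ => ‖m ξ‖ * (Real.exp ((‖z0‖ + 1) * |⟪v, ξ⟫|) * |⟪v, ξ⟫|))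
        (s := Metric.ball z0 1) (Metric.ball_mem_nhds z0 one_pos) ?_ ?_ ?_ ?_ ?_ ?_).2.differentiableAt
      · exact Eventually.of_forall fun z => Continuous.aestronglyMeasurable (by fun_prop)
      · refine Continuous.integrable_of_hasCompactSupport (by fun_prop) (hms.mul_right.mul_right)
      · exact Continuous.aestronglyMeasurable (by fun_prop)
      · refine ae_of_all _ fun ξ z hz => ?_
        rw [norm_mul, norm_mul, norm_mul, norm_cexp_I_mul, mul_one, norm_mul, Complex.norm_I, one_mul, Complex.norm_real,
          Real.norm_eq_abs, Complex.norm_exp]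
        gcongr
        have : (z * (Complex.I * ((⟪v, ξ⟫ : ℝ) : ℂ))).re = - z.im * ⟪v, ξ⟫ := by simp [Complex.mul_re, Complex.mul_im]
        rw [this]
        refine (le_abs_self _).trans ?_
        rw [abs_mul, abs_neg]
        gcongr
        refine (Complex.abs_im_le_norm z).trans ?_
        have hz' : ‖z - z0‖ < 1 := by simpa [dist_eq_norm] using hz
        have := norm_sub_norm_le z z0
        linarith
      · refine Continuous.integrable_of_hasCompactSupport (by fun_prop) (hms.norm.mul_right)
      · refine ae_of_all _ fun ξ z hz => ?_
        have := ((hasDerivAt_id z).mul_const (Complex.I * ((⟪v, ξ⟫ : ℝ) : ℂ))).cexp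
        rw [one_mul] at this
        exact this.const_mul _
    have hφg : ∀ t : ℝ, φ t = g (x0 + t • v) := by
      intro t
      simp only [hφ, hg]
      congr 1; ext ξ
      rw [mul_assoc, ← Complex.exp_add, inner_add_left, inner_smul_left]
      congr 2; push_cast; simp; ring
    have han : AnalyticOnNhd ℝ (fun t : ℝ => φ t) Set.univ := by
      intro t _
      have h1 : AnalyticAt ℂ φ (t:ℂ) := hφd.analyticAt _
      have h2 : AnalyticAt ℝ φ (t:ℂ) := h1.restrictScalars
      exact AnalyticAt.comp (g := φ) (f := fun t : ℝ => (t:ℂ)) h2 (Complex.ofRealCLM.analyticAt t)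
    have hcod := han.preimage_zero_mem_codiscrete (x := 0) (by
      rw [hφg]; simpa using h0)
    have := ae_restrict_le_codiscreteWithin (μ := (volume : Measure ℝ)) (U := Set.univ) MeasurableSet.univ hcod
    rw [Measure.restrict_univ] at this
    filter_upwards [this] with t ht
    rw [← hφg]
    exact ht
  -- Tonelli
  set Z : Set (Euc d) := {x | g x = 0} with hZ
  have hZm : MeasurableSet Z := (isClosed_eq hgc continuous_const).measurableSet
  have hT : MeasurableSet {p : ℝ × Euc d | x0 + p.1 • p.2 ∈ Z} := by
    have : Continuous (fun p : ℝ × Euc d => x0 + p.1 • p.2) := by fun_prop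
    exact this.measurable hZm
  have h1 : ∀ᵐ p ∂((volume : Measure ℝ).prod (volume : Measure (Euc d))), x0 + p.1 • p.2 ∉ Z := by
    have hsw : ∀ᵐ q ∂((volume : Measure (Euc d)).prod (volume : Measure ℝ)), x0 + q.2 • q.1 ∉ Z := by
      have : MeasurableSet {q : Euc d × ℝ | x0 + q.2 • q.1 ∉ Z} := by
        have : Continuous (fun p : Euc d × ℝ => x0 + p.2 • p.1) := by fun_prop
        exact (this.measurable hZm).compl
      rw [Measure.ae_prod_iff_ae_ae this]
      exact ae_of_all _ fun v => hline v
    have := Measure.measurePreserving_swap (μ := (volume : Measure ℝ)) (ν := (volume : Measure (Euc d)))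
    exact this.quasiMeasurePreserving.ae hsw
  have h2 := Measure.ae_ae_of_ae_prod h1
  have h3 : ∃ t : ℝ, t ≠ 0 ∧ ∀ᵐ v : Euc d, x0 + t • v ∉ Z := by
    have h4 : ∀ᵐ t : ℝ, t ≠ 0 := by simp [ae_iff]
    obtain ⟨t, ht⟩ := (h2.and h4).exists
    exact ⟨t, ht.2, ht.1⟩
  obtain ⟨t, ht, hv⟩ := h3
  rw [ae_iff] at hv ⊢
  simp only [not_not] at hv ⊢
  have e : {v : Euc d | x0 + t • v ∈ Z} = (fun v : Euc d => t • v) ⁻¹' ((fun v => x0 + v) ⁻¹' Z) := rfl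
  rw [e, Measure.addHaar_preimage_smul volume ht, measure_preimage_add] at hv
  rcases mul_eq_zero.1 hv with h | h
  · exfalso
    rw [ENNReal.ofReal_eq_zero] at h
    have : 0 < |(t ^ Module.finrank ℝ (Euc d))⁻¹| := abs_pos.2 (inv_ne_zero (pow_ne_zero _ ht))
    linarith
  · exact h

/-- Parseval for translated kernels. -/
lemma parseval_kernel {a b : Euc d → ℂ} (ha : ContDiff ℝ (⊤ : ℕ∞) a) (has : HasCompactSupport a)
    (hb : ContDiff ℝ (⊤ : ℕ∞) b) (hbs : HasCompactSupport b) (y y' : Euc d) :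
    ∫ x, invFTd a (x - y) * (starRingEnd ℂ) (invFTd b (x - y')) =
      (((2 * Real.pi) ^ d)⁻¹ : ℝ) • ∫ ξ, a ξ * (starRingEnd ℂ) (b ξ) * Complex.exp (Complex.I * ((⟪y' - y, ξ⟫ : ℝ) : ℂ)) := by
  have hp : (0:ℝ) < 2 * Real.pi := by positivity
  have hexp : ∀ y : Euc d, ContDiff ℝ (⊤ : ℕ∞) (fun ξ : Euc d => Complex.exp (-(Complex.I * ((⟪y, ξ⟫ : ℝ) : ℂ)))) := by
    intro y
    have : ContDiff ℝ (⊤ : ℕ∞) (fun ξ : Euc d => ((⟪y, ξ⟫ : ℝ) : ℂ)) :=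
      Complex.ofRealCLM.contDiff.comp (innerSL ℝ y).contDiff
    exact (contDiff_const.mul this).neg.cexp
  have key : ∀ {a : Euc d → ℂ} (ha : ContDiff ℝ (⊤ : ℕ∞) a) (has : HasCompactSupport a) (y : Euc d),
      ∃ S : SchwartzMap (Euc d) ℂ, (∀ ξ, S ξ = a ξ * Complex.exp (-(Complex.I * ((⟪y, ξ⟫ : ℝ) : ℂ)))) ∧
        ∀ x, invFTd a (x - y) = (((2 * Real.pi) ^ d)⁻¹ : ℝ) • (FourierTransform.fourier S) ((-(2 * Real.pi)⁻¹ : ℝ) • x) := by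
    intro a ha has y
    have c1 : HasCompactSupport (fun ξ => a ξ * Complex.exp (-(Complex.I * ((⟪y, ξ⟫ : ℝ) : ℂ)))) := has.mul_right
    refine ⟨c1.toSchwartzMap (ha.mul (hexp y)), fun ξ => rfl, fun x => ?_⟩
    rw [SchwartzMap.fourier_coe, Real.fourier_eq', invFTd]
    congr 2; ext ξ
    simp only [HasCompactSupport.toSchwartzMap_toFun, smul_eq_mul]
    have : Complex.exp (Complex.I * ((⟪x - y, ξ⟫ : ℝ) : ℂ)) = Complex.exp (-(Complex.I * ((⟪y, ξ⟫ : ℝ) : ℂ))) * 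
      Complex.exp (((-2 * Real.pi * ⟪ξ, (-(2 * Real.pi)⁻¹ : ℝ) • x⟫ : ℝ) : ℂ) * Complex.I) := by
      rw [← Complex.exp_add, inner_smul_right, inner_sub_left, real_inner_comm x ξ]
      congr 1
      have : -2 * Real.pi * (-(2 * Real.pi)⁻¹ * ⟪x, ξ⟫) = ⟪x, ξ⟫ := by field_simp
      rw [this]; push_cast; ring
    rw [this]; ring
  obtain ⟨A, hA, hA'⟩ := key ha has y
  obtain ⟨B, hB, hB'⟩ := key hb hbs y'
  have e1 : ∀ x, invFTd a (x - y) * (starRingEnd ℂ) (invFTd b (x - y')) = 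
     (((2 * Real.pi) ^ d)⁻¹ : ℝ) • (((2 * Real.pi) ^ d)⁻¹ : ℝ) • 
      (fun z => inner ℂ ((FourierTransform.fourier B) z) ((FourierTransform.fourier A) z)) ((-(2 * Real.pi)⁻¹ : ℝ) • x) := by
    intro x
    rw [hA', hB']
    simp only [RCLike.inner_apply, Complex.real_smul, map_mul, Complex.conj_ofReal]
    ring
  simp only [e1]
  have hcs := Measure.integral_comp_smul (volume : Measure (Euc d))
    (fun z => inner ℂ ((FourierTransform.fourier B) z) ((FourierTransform.fourier A) z)) (-(2 * Real.pi)⁻¹)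
  rw [integral_smul, integral_smul, hcs, SchwartzMap.integral_inner_fourier_fourier]
  rw [finrank_euclideanSpace_fin]
  congr 1
  rw [smul_smul]
  have e2 : ((2 * Real.pi) ^ d)⁻¹ * |((-(2 * Real.pi)⁻¹) ^ d)⁻¹| = 1 := by
    rw [abs_inv, abs_pow, abs_neg, abs_inv, abs_of_pos hp, inv_pow, inv_inv]
    field_simp
  rw [e2, one_smul]
  congr 1; ext ξ
  rw [hA, hB, RCLike.inner_apply, map_mul, ← Complex.exp_conj]
  have : Complex.exp (Complex.I * ((⟪y' - y, ξ⟫ : ℝ) : ℂ)) = 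
    Complex.exp (-(Complex.I * ((⟪y, ξ⟫ : ℝ) : ℂ))) * Complex.exp ((starRingEnd ℂ) (-(Complex.I * ((⟪y', ξ⟫ : ℝ) : ℂ)))) := by
    rw [← Complex.exp_add, inner_sub_left]
    congr 1
    simp; ring
  rw [this]; ring

end PartL

section PartM

variable {d : ℕ} {Ω : Set (Euc d)} {ρ : Euc d → ℝ}

lemma hfun_nice {lam : ℝ} (hl : 0 < lam) {N0 : ℕ} {χ Φ Ψ : ℝ → ℝ} (h : HData lam N0 χ Φ Ψ) (ℓ : ℕ) :
    ContDiff ℝ (⊤ : ℕ∞) (hfun χ Φ Ψ lam ℓ) ∧ ∀ t ∉ Set.Icc (1/2:ℝ) 2, hfun χ Φ Ψ lam ℓ t = 0 := by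
  have hχz : ∀ t ∉ Set.Icc (1/2:ℝ) 2, χ t = 0 := by
    intro t ht
    by_contra hne
    exact ht (Set.Ioo_subset_Icc_self (h.hχsupp hne))
  cases ℓ with
  | zero =>
    constructor
    · have hΦ : ContDiff ℝ (⊤ : ℕ∞) (fun s => (Φ s : ℂ)) := Complex.ofRealCLM.contDiff.comp h.hΦsm
      have hΦs : HasCompactSupport (fun s => (Φ s : ℂ)) :=
        compact_of_abs (R := 1) (fun x hx => by rw [h.hΦzero x hx]; simp)
      obtain ⟨S, hS⟩ := FT1_schwartz hΦ hΦs
      have hS' : (FT1R Φ) = S := by ext v; rw [hS]; rfl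
      have e : hfun χ Φ Ψ lam 0 = fun ϱ => ((2 * Real.pi)⁻¹ * χ ϱ) • Jint lam S (ϱ - 1) := by
        ext ϱ; rw [hfun_zero_eq, hS']
      rw [e]
      exact (contDiff_const.mul h.hχsm).smul ((Jint_contDiff hl S).comp (contDiff_id.sub contDiff_const))
    · intro t ht
      rw [hfun_zero_eq, hχz t ht]; simp
  | succ j =>
    obtain ⟨f, hf, -, hfs, hrep⟩ := HData.rep hl h
    constructor
    · have e : hfun χ Φ Ψ lam (j+1) = fun ϱ => (((2:ℝ) ^ (-(j * lam)) : ℝ) : ℂ) * ((χ ϱ : ℂ) * FT1 f (2 ^ j * (ϱ - 1))) := by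
        ext ϱ; exact hrep j ϱ
      rw [e]
      exact contDiff_const.mul ((Complex.ofRealCLM.contDiff.comp h.hχsm).mul
        ((FT1_norms hf hfs).1.comp (contDiff_const.mul (contDiff_id.sub contDiff_const))))
    · intro t ht
      rw [hrep, hχz t ht]; simp

/-- Rapid decay of the inverse Fourier transform of a test function. -/
lemma invFTd_decay {a : Euc d → ℂ} (ha : ContDiff ℝ (⊤ : ℕ∞) a) (has : HasCompactSupport a) (N : ℕ) :
    ∃ C : ℝ, 0 ≤ C ∧ ∀ x, ‖invFTd a x‖ * (1 + ‖x‖) ^ N ≤ C := by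
  have hp : (0:ℝ) < 2 * Real.pi := by positivity
  set A : SchwartzMap (Euc d) ℂ := has.toSchwartzMap ha with hA
  have hAx : ∀ ξ, A ξ = a ξ := fun ξ => rfl
  have hAF : ∀ x, invFTd a x = (((2 * Real.pi) ^ d)⁻¹ : ℝ) • (FourierTransform.fourier A) ((-(2 * Real.pi)⁻¹ : ℝ) • x) := by
    intro x
    rw [SchwartzMap.fourier_coe, Real.fourier_eq']
    unfold invFTd
    congr 1
    congr 1; ext ξ
    rw [hAx, smul_eq_mul, mul_comm]
    congr 1
    congr 1
    rw [inner_smul_right, real_inner_comm x ξ]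
    have : -2 * Real.pi * (-(2 * Real.pi)⁻¹ * ⟪x, ξ⟫) = ⟪x, ξ⟫ := by field_simp
    rw [this]; push_cast; ring
  set B := FourierTransform.fourier A with hB
  have hb := SchwartzMap.one_add_le_sup_seminorm_apply (𝕜 := ℝ) (m := (N, 0)) (k := N) (n := 0) le_rfl le_rfl B
  set S := 2 ^ (N, 0).1 * ((Finset.Iic (N, 0)).sup fun m => SchwartzMap.seminorm ℝ m.1 m.2) B with hS
  refine ⟨(((2 * Real.pi) ^ d)⁻¹ : ℝ) * ((2 * Real.pi) ^ N * S), ?_, fun x => ?_⟩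
  · have : 0 ≤ S := le_trans (by positivity) (hb 0)
    positivity
  · have h1 := hb ((-(2 * Real.pi)⁻¹ : ℝ) • x)
    rw [norm_iteratedFDeriv_zero, norm_smul, norm_neg, norm_inv, Real.norm_eq_abs, abs_of_pos hp] at h1
    rw [hAF, norm_smul, Real.norm_eq_abs, abs_of_pos (by positivity), mul_assoc]
    refine mul_le_mul_of_nonneg_left ?_ (by positivity)
    refine le_trans ?_ (mul_le_mul_of_nonneg_left h1 (by positivity))
    rw [← mul_assoc, ← mul_pow, mul_comm]
    gcongr
    have h2 : (2 * Real.pi) * (1 + (2 * Real.pi)⁻¹ * ‖x‖) = 2 * Real.pi + ‖x‖ := by field_simp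
    rw [h2]
    linarith [Real.pi_gt_three]

/-- The abstract properties of the family of kernels used in the main estimate. -/
structure KFam (d : ℕ) (K : ℕ → Euc d → ℂ) : Prop where
  cont : ∀ ℓ, Continuous (K ℓ)
  zero_or : ∀ ℓ, (∀ x, K ℓ x = 0) ∨ ∀ᵐ x, K ℓ x ≠ 0
  bound : ∀ N : ℕ, ∃ C : ℝ, 0 ≤ C ∧ ∀ ℓ x, ‖K ℓ x‖ * (1 + ‖x‖ / 2 ^ ℓ) ^ N ≤ C
  cross : ∀ N : ℕ, ∃ C : ℝ, 0 ≤ C ∧ ∀ ℓ ℓ' : ℕ, 1 ≤ ℓ' → ℓ' ≤ ℓ → ∀ y y' : Euc d,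
    ‖∫ x, K ℓ (x - y) * (starRingEnd ℂ) (K ℓ' (x - y'))‖ * (1 + ‖y - y'‖ / 2 ^ ℓ) ^ N *
      (1 + ‖y - y'‖) ^ (((d:ℝ) - 1) / 2) ≤
      C * ((2:ℝ) ^ ℓ) ^ (((d:ℝ) - 1) / 2) * ((2:ℝ) ^ ℓ') ^ (((d:ℝ) + 1) / 2)

lemma exists_KFam (hd : 2 ≤ d) (hρ : IsMinkowskiGauge d Ω ρ) (hcurv : HasNonvanishingCurvature d ρ)
    {lam : ℝ} (hl : 0 < lam) {N0 : ℕ} {χ Φ Ψ : ℝ → ℝ} (h : HData lam N0 χ Φ Ψ) :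
    ∃ K : ℕ → Euc d → ℂ, KFam d K ∧ ∀ ℓ f x, Aop ρ (hfun χ Φ Ψ lam) lam ℓ f x = ∫ y, K ℓ (x - y) * f y := by
  have hχz : ∀ t ∉ Set.Icc (1/2:ℝ) 2, χ t = 0 := by
    intro t ht
    by_contra hne
    exact ht (Set.Ioo_subset_Icc_self (h.hχsupp hne))
  obtain ⟨f, hf, hfz, hfs, hrep⟩ := HData.rep hl h
  set m : ℕ → Euc d → ℂ := fun ℓ ξ => hfun χ Φ Ψ lam ℓ (ρ ξ) with hm
  have hms : ∀ ℓ, ContDiff ℝ (⊤ : ℕ∞) (m ℓ) := fun ℓ =>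
    hρ.comp_smooth (hfun_nice hl h ℓ).1 (tsupport_sub_of (hfun_nice hl h ℓ).2).1
  have hmc : ∀ ℓ, HasCompactSupport (m ℓ) := fun ℓ =>
    hρ.comp_compact (tsupport_sub_of (hfun_nice hl h ℓ).2).2
  set cc : ℕ → ℝ := fun ℓ => (2:ℝ) ^ ((ℓ:ℝ) * (lam + ((d:ℝ) + 1) / 2)) with hcc
  have hccp : ∀ ℓ, 0 < cc ℓ := fun ℓ => by positivity
  have h2p : ∀ ℓ : ℕ, (0:ℝ) < 2 ^ ℓ := fun ℓ => by positivity
  have hcs : ∀ j : ℕ, cc (j+1) * (2:ℝ) ^ (-(j * lam)) = 2 ^ lam * ((2:ℝ) ^ (j+1)) ^ (((d:ℝ)+1)/2) := by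
    intro j
    simp only [hcc]
    rw [← Real.rpow_natCast, ← Real.rpow_mul (by norm_num), ← Real.rpow_add (by norm_num), ← Real.rpow_add (by norm_num)]
    congr 1; push_cast; ring
  have hintg : ∀ j x, (∫ ξ, m (j+1) ξ * Complex.exp (Complex.I * ((⟪x, ξ⟫ : ℝ) : ℂ))) = 
      (((2:ℝ) ^ (-(j * lam)) : ℝ) : ℂ) * ∫ ξ, ((χ (ρ ξ) : ℂ) * FT1 f (2 ^ j * (ρ ξ - 1))) * Complex.exp (Complex.I * ((⟪x, ξ⟫ : ℝ) : ℂ)) := by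
    intro j x
    rw [← integral_const_mul]
    congr 1; ext ξ
    simp only [hm]
    rw [hrep]; ring
  refine ⟨fun ℓ x => cc ℓ • invFTd (m ℓ) x, ⟨?_, ?_, ?_, ?_⟩, ?_⟩
  · intro ℓ
    have h1 := continuous_parametric_integral_of_continuous (μ := (volume : Measure (Euc d)))
      (f := fun x ξ => m ℓ ξ * Complex.exp (Complex.I * ((⟪x, ξ⟫ : ℝ) : ℂ))) (s := tsupport (m ℓ))
      (by have := (hms ℓ).continuous
          simp only [Function.uncurry_def]; fun_prop) (hmc ℓ)
    have h2 : Continuous fun x => ∫ ξ, m ℓ ξ * Complex.exp (Complex.I * ((⟪x, ξ⟫ : ℝ) : ℂ)) := by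
      refine h1.congr (fun x => ?_)
      refine setIntegral_eq_integral_of_forall_compl_eq_zero (fun ξ hξ => ?_)
      rw [image_eq_zero_of_notMem_tsupport hξ, zero_mul]
    exact (h2.const_smul ((((2 * Real.pi) ^ d)⁻¹ : ℝ))).const_smul (cc ℓ)
  · intro ℓ
    by_cases h0 : ∀ x : Euc d, (∫ ξ, m ℓ ξ * Complex.exp (Complex.I * ((⟪x, ξ⟫ : ℝ) : ℂ))) = 0
    · left; intro x
      simp only [invFTd]
      rw [h0 x]; simp
    · right
      push Not at h0
      obtain ⟨x0, hx0⟩ := h0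
      filter_upwards [invFT_ne_zero (hms ℓ).continuous (hmc ℓ) hx0] with x hx
      refine smul_ne_zero (hccp ℓ).ne' ?_
      exact smul_ne_zero (by positivity) hx
  · intro N
    obtain ⟨C0, hC0, h0⟩ := invFTd_decay (hms 0) (hmc 0) N
    obtain ⟨C1, hC1, h1⟩ := IsMinkowskiGauge.succ_bound hd hρ hcurv h.hχsm hχz hf hfs hfz N
    refine ⟨C0 + (((2 * Real.pi) ^ d)⁻¹ : ℝ) * (2 ^ lam * C1), by positivity, fun ℓ x => ?_⟩
    cases ℓ with
    | zero =>
      have : cc 0 = 1 := by simp [hcc]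
      simp only [this, one_smul, pow_zero, div_one]
      have h3 := h0 x
      have : 0 ≤ (((2 * Real.pi) ^ d)⁻¹ : ℝ) * (2 ^ lam * C1) := by positivity
      linarith
    | succ j =>
      have h3 := h1 j x
      simp only [invFTd]
      rw [hintg, norm_smul, norm_smul, norm_mul, Complex.norm_real, Real.norm_of_nonneg (hccp _).le,
        Real.norm_of_nonneg (show (0:ℝ) ≤ (((2 * Real.pi) ^ d)⁻¹ : ℝ) by positivity), 
        Real.norm_of_nonneg (show (0:ℝ) ≤ (2:ℝ) ^ (-(j * lam)) by positivity)]
      set I := ‖∫ ξ, ((χ (ρ ξ) : ℂ) * FT1 f (2 ^ j * (ρ ξ - 1))) * Complex.exp (Complex.I * ((⟪x, ξ⟫ : ℝ) : ℂ))‖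
      calc _ = (((2 * Real.pi) ^ d)⁻¹ : ℝ) * ((cc (j+1) * (2:ℝ) ^ (-(j * lam))) * (I * (1 + ‖x‖ / 2 ^ (j+1)) ^ N)) := by ring
        _ = (((2 * Real.pi) ^ d)⁻¹ : ℝ) * (2 ^ lam * (((2:ℝ) ^ (j+1)) ^ (((d:ℝ)+1)/2) * I * (1 + ‖x‖ / 2 ^ (j+1)) ^ N)) := by
            rw [hcs]; ring
        _ ≤ (((2 * Real.pi) ^ d)⁻¹ : ℝ) * (2 ^ lam * C1) := by gcongr
        _ ≤ _ := by linarith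
  · intro N
    obtain ⟨C1, hC1, h1⟩ := IsMinkowskiGauge.cross_bound hd hρ hcurv h.hχsm hχz hf hfs hfz N
    refine ⟨(((2 * Real.pi) ^ d)⁻¹ : ℝ) * ((2 ^ lam * 2 ^ lam) * C1), by positivity, fun ℓ ℓ' hℓ' hℓ y y' => ?_⟩
    obtain ⟨j', rfl⟩ : ∃ j', ℓ' = j' + 1 := ⟨ℓ' - 1, by omega⟩
    obtain ⟨j, rfl⟩ : ∃ j, ℓ = j + 1 := ⟨ℓ - 1, by omega⟩
    have e1 : (∫ x, cc (j+1) • invFTd (m (j+1)) (x - y) * (starRingEnd ℂ) (cc (j'+1) • invFTd (m (j'+1)) (x - y'))) = 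
       ((cc (j+1) * cc (j'+1) : ℝ) : ℂ) * ∫ x, invFTd (m (j+1)) (x - y) * (starRingEnd ℂ) (invFTd (m (j'+1)) (x - y')) := by
      rw [← integral_const_mul]
      congr 1; ext x
      simp only [Complex.real_smul, map_mul, Complex.conj_ofReal]
      push_cast; ring
    have e2 : (∫ ξ, m (j+1) ξ * (starRingEnd ℂ) (m (j'+1) ξ) * Complex.exp (Complex.I * ((⟪y' - y, ξ⟫ : ℝ) : ℂ))) = 
      (((2:ℝ) ^ (-(j * lam)) * (2:ℝ) ^ (-(j' * lam)) : ℝ) : ℂ) * ∫ ξ, (((χ (ρ ξ) * χ (ρ ξ) : ℝ) : ℂ) * FT1 f (2 ^ j * (ρ ξ - 1)) *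
          (starRingEnd ℂ) (FT1 f (2 ^ j' * (ρ ξ - 1)))) * Complex.exp (Complex.I * ((⟪y' - y, ξ⟫ : ℝ) : ℂ)) := by
      rw [← integral_const_mul]
      congr 1; ext ξ
      simp only [hm]
      rw [hrep, hrep]
      simp only [map_mul, Complex.conj_ofReal]
      push_cast; ring
    have h3 := h1 j j' (y' - y) (by omega)
    beta_reduce
    rw [e1, parseval_kernel (hms _) (hmc _) (hms _) (hmc _), e2]
    rw [norm_mul, norm_smul, norm_mul, Complex.norm_real, Complex.norm_real, Real.norm_of_nonneg (by positivity),
        Real.norm_of_nonneg (show (0:ℝ) ≤ (((2 * Real.pi) ^ d)⁻¹ : ℝ) by positivity), 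
        Real.norm_of_nonneg (by positivity), norm_sub_rev y y']
    set I := ‖∫ ξ, (((χ (ρ ξ) * χ (ρ ξ) : ℝ) : ℂ) * FT1 f (2 ^ j * (ρ ξ - 1)) *
          (starRingEnd ℂ) (FT1 f (2 ^ j' * (ρ ξ - 1)))) * Complex.exp (Complex.I * ((⟪y' - y, ξ⟫ : ℝ) : ℂ))‖
    have e3 : ((2:ℝ) ^ (j+1)) ^ (((d:ℝ)+1)/2) = ((2:ℝ) ^ (j+1)) ^ (((d:ℝ)-1)/2) * 2 ^ (j+1) := by
      conv_rhs => rw [← Real.rpow_add_one (h2p _).ne']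
      congr 1; ring
    calc _ = (((2 * Real.pi) ^ d)⁻¹ : ℝ) * ((cc (j+1) * (2:ℝ) ^ (-(j * lam))) * (cc (j'+1) * (2:ℝ) ^ (-(j' * lam))) * 
          (I * (1 + ‖y' - y‖ / 2 ^ (j+1)) ^ N * (1 + ‖y' - y‖) ^ (((d:ℝ) - 1) / 2))) := by ring
      _ = (((2 * Real.pi) ^ d)⁻¹ : ℝ) * ((2 ^ lam * 2 ^ lam) * (((2:ℝ) ^ (j+1)) ^ (((d:ℝ)-1)/2) * ((2:ℝ) ^ (j'+1)) ^ (((d:ℝ)+1)/2)) * 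
          (I * (1 + ‖y' - y‖ / 2 ^ (j+1)) ^ N * 2 ^ (j+1) * (1 + ‖y' - y‖) ^ (((d:ℝ) - 1) / 2))) := by
            rw [hcs, hcs, e3]; ring
      _ ≤ (((2 * Real.pi) ^ d)⁻¹ : ℝ) * ((2 ^ lam * 2 ^ lam) * (((2:ℝ) ^ (j+1)) ^ (((d:ℝ)-1)/2) * ((2:ℝ) ^ (j'+1)) ^ (((d:ℝ)+1)/2)) * C1) := by gcongr
      _ = _ := by ring
  · intro ℓ f x
    simp only [Aop, mulOp]
    rw [← integral_smul]
    congr 1; ext y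
    rw [smul_mul_assoc]

end PartM

section PartN

variable {d : ℕ}

/-- A finite family of disjoint `cubes` of sidelength `2^k`. -/
structure CubeFam (d : ℕ) {ι : Type*} (T : Finset ι) (E : ι → Set (Euc d)) (c : ι → Euc d) (k : ι → ℕ) : Prop where
  meas : ∀ i ∈ T, MeasurableSet (E i)
  vol : ∀ i ∈ T, volume (E i) = ENNReal.ofReal (((2:ℝ) ^ (k i)) ^ d)
  cmem : ∀ i ∈ T, c i ∈ E i
  diam : ∀ i ∈ T, ∀ y ∈ E i, ∀ z ∈ E i, ‖y - z‖ ≤ d * 2 ^ (k i)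
  disj : (T : Set ι).PairwiseDisjoint E

lemma pow_sum_le {ι : Type*} [DecidableEq ι] (T : Finset ι) (k : ι → ℕ) (w : ι → ℝ) (hw : ∀ i, 0 ≤ w i) (n : ℕ) :
    (∑ i ∈ T, w i) ^ (n + 1) ≤ (n + 1) * ∑ i ∈ T, w i * (∑ j ∈ T with k i ≤ k j, w j) ^ n := by
  induction T using Finset.induction_on_min_value k with
  | empty => simp
  | insert a s ha hmin ih =>
    have hfa : (insert a s).filter (fun j => k a ≤ k j) = insert a s := by
      ext j; simp only [Finset.mem_filter, Finset.mem_insert]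
      constructor
      · exact fun h => h.1
      · rintro (rfl | h)
        · simp
        · exact ⟨Or.inr h, hmin j h⟩
    rw [Finset.sum_insert (f := fun i => w i * (∑ j ∈ insert a s with k i ≤ k j, w j) ^ n) ha, hfa, mul_add]
    have h1 : ∑ i ∈ s, w i * (∑ j ∈ s with k i ≤ k j, w j) ^ n ≤ 
        ∑ i ∈ s, w i * (∑ j ∈ insert a s with k i ≤ k j, w j) ^ n := by
      refine Finset.sum_le_sum fun i _ => ?_
      refine mul_le_mul_of_nonneg_left ?_ (hw i)
      refine pow_le_pow_left₀ (Finset.sum_nonneg fun j _ => hw j) ?_ n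
      refine Finset.sum_le_sum_of_subset_of_nonneg ?_ (fun j _ _ => hw j)
      exact Finset.filter_subset_filter _ (Finset.subset_insert a s)
    have h2 : (∑ i ∈ insert a s, w i) ^ (n + 1) ≤ (∑ i ∈ s, w i) ^ (n + 1) + (n + 1) * (w a * (∑ i ∈ insert a s, w i) ^ n) := by
      rw [Finset.sum_insert ha]
      set b := ∑ i ∈ s, w i with hb
      have hb0 : 0 ≤ b := Finset.sum_nonneg fun j _ => hw j
      have := hw a
      clear_value b
      generalize w a = x at *
      have key : ∀ m : ℕ, (x + b) ^ (m+1) ≤ b ^ (m+1) + (m+1) * (x * (x + b) ^ m) := by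
        intro m
        induction m with
        | zero => simp; linarith
        | succ m ihm =>
          have e : (x + b) ^ (m + 1 + 1) ≤ (b ^ (m + 1) + (m + 1) * (x * (x + b) ^ m)) * (x + b) := by
            rw [pow_succ]; exact mul_le_mul_of_nonneg_right ihm (by positivity)
          refine e.trans ?_
          have h3 : b ^ (m+1) ≤ (x + b) ^ (m+1) := pow_le_pow_left₀ hb0 (by linarith) _
          have h4 : b ^ (m+1) * x ≤ (x + b) ^ (m+1) * x := mul_le_mul_of_nonneg_right h3 this
          push_cast
          have e5 : (x + b) ^ (m+1) = (x+b)^m * (x+b) := pow_succ _ _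
          rw [e5] at h4 ⊢
          have e6 : b ^ (m+1+1) = b^(m+1) * b := pow_succ _ _
          rw [e6]
          nlinarith
      exact key n
    have h3 : (0:ℝ) ≤ n + 1 := by positivity
    have := mul_le_mul_of_nonneg_left h1 h3
    linarith

/-- The tail weight. -/
def wt (N : ℕ) (L : ℝ) (u : Euc d) : ℝ := ((1 + ‖u‖ / L) ^ N)⁻¹

lemma wt_nonneg {N : ℕ} {L : ℝ} (hL : 0 < L) (u : Euc d) : 0 ≤ wt N L u := by unfold wt; positivity

lemma wt_cont {N : ℕ} {L : ℝ} (hL : 0 < L) : Continuous (wt (d := d) N L) := by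
  unfold wt
  refine Continuous.inv₀ (by fun_prop) (fun u => by positivity)

lemma wt_anti {N M : ℕ} (h : N ≤ M) {L : ℝ} (hL : 0 < L) (u : Euc d) : wt M L u ≤ wt N L u := by
  unfold wt
  have : 1 ≤ 1 + ‖u‖ / L := by have : 0 ≤ ‖u‖ / L := by positivity
                               linarith
  gcongr

lemma wt_slow {N : ℕ} {L L' : ℝ} (hL' : 0 < L') (hL : L' ≤ L) (x y c : Euc d) :
    wt N L (x - c) ≤ (1 + ‖x - y‖ / L') ^ N * wt N L (y - c) := by
  have hLp : 0 < L := hL'.trans_le hL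
  unfold wt
  rw [← div_eq_mul_inv, le_div_iff₀ (by positivity), inv_mul_le_iff₀ (by positivity), ← mul_pow]
  gcongr
  have h1 : ‖y - c‖ ≤ ‖x - y‖ + ‖x - c‖ := by
    have : y - c = (x - c) - (x - y) := by abel
    rw [this]; linarith [norm_sub_le (x - c) (x - y)]
  have h2 : ‖y - c‖ / L ≤ ‖x - y‖ / L' + ‖x - c‖ / L := by
    calc ‖y - c‖ / L ≤ (‖x - y‖ + ‖x - c‖) / L := by gcongr
      _ = ‖x - y‖ / L + ‖x - c‖ / L := add_div _ _ _
      _ ≤ _ := by gcongr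
  have h3 : 0 ≤ ‖x - c‖ / L * (‖x - y‖ / L') := by positivity
  nlinarith

/-- `1 + |x-y|/L ≲ 1 + |x-c|/L` when `|y-c| ≤ d L`. -/
lemma one_add_shift {L : ℝ} (hL : 0 < L) {x y c : Euc d} (h : ‖y - c‖ ≤ d * L) :
    1 + ‖x - y‖ / L ≤ (1 + d) * (1 + ‖x - c‖ / L) := by
  have h1 : ‖x - y‖ ≤ ‖x - c‖ + ‖y - c‖ := by
    have : x - y = (x - c) - (y - c) := by abel
    rw [this]; exact norm_sub_le _ _
  have h2 : ‖x - y‖ / L ≤ ‖x - c‖ / L + d := by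
    rw [div_le_iff₀ hL, add_mul, div_mul_cancel₀ _ hL.ne']; linarith
  have h3 : 0 ≤ d * (‖x - c‖ / L) := by positivity
  nlinarith

lemma wt_integral (d : ℕ) : ∃ C : ℝ, 0 ≤ C ∧ ∀ L : ℝ, 0 < L → ∀ c : Euc d, 
    ∫⁻ x, ENNReal.ofReal (wt (d+1) L (x - c)) = ENNReal.ofReal (C * L ^ d) := by
  have hi : Integrable (fun x : Euc d => wt (d+1) 1 x) := by
    have := integrable_one_add_norm (E := Euc d) (μ := volume) (r := (d:ℝ)+1) (by rw [finrank_euclideanSpace_fin]; linarith)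
    refine this.congr (ae_of_all _ fun x => ?_)
    simp only [wt, div_one]
    rw [Real.rpow_neg (by positivity)]
    congr 1
    exact_mod_cast Real.rpow_natCast (1 + ‖x‖) (d+1)
  refine ⟨∫ x : Euc d, wt (d+1) 1 x, integral_nonneg fun x => wt_nonneg one_pos x, fun L hL c => ?_⟩
  rw [lintegral_sub_right_eq_self (fun x => ENNReal.ofReal (wt (d+1) L x)) c]
  have e : ∀ x : Euc d, wt (d+1) L x = wt (d+1) 1 (L⁻¹ • x) := by
    intro x
    simp only [wt, norm_smul, norm_inv, Real.norm_of_nonneg hL.le, div_one]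
    rw [inv_mul_eq_div]
  simp only [e]
  have hi2 : Integrable (fun x : Euc d => wt (d+1) 1 (L⁻¹ • x)) := hi.comp_smul (inv_ne_zero hL.ne')
  rw [← ofReal_integral_eq_lintegral_ofReal hi2 (ae_of_all _ fun x => wt_nonneg one_pos _)]
  rw [Measure.integral_comp_smul, finrank_euclideanSpace_fin, inv_pow, inv_inv, abs_of_pos (by positivity), smul_eq_mul, mul_comm]

/-- The sum of tails. -/
def Ssum {ι : Type*} (T : Finset ι) (c : ι → Euc d) (k : ι → ℕ) (s N : ℕ) (x : Euc d) : ℝ :=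
  ∑ i ∈ T, wt N (2 ^ (k i + s)) (x - c i)

lemma Ssum_nonneg {ι : Type*} (T : Finset ι) (c : ι → Euc d) (k : ι → ℕ) (s N : ℕ) (x : Euc d) :
    0 ≤ Ssum T c k s N x := Finset.sum_nonneg fun i _ => wt_nonneg (by positivity) _

lemma Ssum_cont {ι : Type*} (T : Finset ι) (c : ι → Euc d) (k : ι → ℕ) (s N : ℕ) :
    Continuous (Ssum T c k s N) := by
  unfold Ssum
  refine continuous_finsetSum _ fun i _ => ?_
  exact (wt_cont (by positivity)).comp (by fun_prop)

set_option maxHeartbeats 1600000 in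
lemma Ssum_step (d n N : ℕ) : ∃ C : ℝ, 0 ≤ C ∧ ∀ {ι : Type} [DecidableEq ι] (T : Finset ι) (E : ι → Set (Euc d)) 
    (c : ι → Euc d) (k : ι → ℕ), CubeFam d T E c k → ∀ s : ℕ,
    ∫⁻ x, ENNReal.ofReal (Ssum T c k s (N * n + N + (d + 1)) x ^ (n+1)) ≤ 
      ENNReal.ofReal (C * ((2:ℝ) ^ s) ^ d) * ∑ i ∈ T, ∫⁻ x in E i, ENNReal.ofReal (Ssum T c k s N x ^ n) := by
  obtain ⟨C0, hC0, hI⟩ := wt_integral d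
  refine ⟨(n+1) * ((1 + d) ^ (N * n) * C0), by positivity, ?_⟩
  intro ι _ T E c k hT s
  obtain ⟨M, hM⟩ : ∃ M, M = N * n + N + (d + 1) := ⟨_, rfl⟩
  rw [← hM]
  have hNM : N ≤ M := by rw [hM]; exact le_trans (Nat.le_add_left N (N * n)) (Nat.le_add_right _ _)
  set L : ι → ℝ := fun i => 2 ^ (k i + s) with hL
  have hLp : ∀ i, 0 < L i := fun i => by positivity
  have hdk : ∀ i, (d:ℝ) * 2 ^ (k i) ≤ d * L i := by
    intro i
    have : (2:ℝ) ^ (k i) ≤ L i := pow_le_pow_right₀ (by norm_num) (by omega)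
    gcongr
  -- pointwise bound
  have hpt : ∀ i ∈ T, ∀ y ∈ E i, ∀ x, wt M (L i) (x - c i) * (∑ j ∈ T with k i ≤ k j, wt M (L j) (x - c j)) ^ n ≤ 
     ((1 + d) ^ (N * n) * Ssum T c k s N y ^ n) * wt (d+1) (L i) (x - c i) := by
    intro i hi y hy x
    have h1 : ∑ j ∈ T with k i ≤ k j, wt M (L j) (x - c j) ≤ (1 + ‖x - y‖ / L i) ^ N * Ssum T c k s N y := by
      unfold Ssum
      rw [Finset.mul_sum]
      calc _ ≤ ∑ j ∈ T with k i ≤ k j, (1 + ‖x - y‖ / L i) ^ N * wt N (L j) (y - c j) := by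
            refine Finset.sum_le_sum fun j hj => ?_
            refine (wt_anti hNM (hLp j) _).trans ?_
            refine wt_slow (hLp i) ?_ _ _ _
            exact pow_le_pow_right₀ (by norm_num) (by have := (Finset.mem_filter.1 hj).2; omega)
        _ ≤ _ := by
            refine Finset.sum_le_sum_of_subset_of_nonneg (Finset.filter_subset _ _) fun j _ _ => ?_
            have := wt_nonneg (N := N) (hLp j) (y - c j)
            have := hLp i
            positivity
    have h2 := one_add_shift (hLp i) (x := x) (y := y) (c := c i) ((hT.diam i hi y hy _ (hT.cmem i hi)).trans (hdk i))
    have hS := Ssum_nonneg T c k s N y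
    have hw := wt_nonneg (N := M) (hLp i) (x - c i)
    have hnn : 0 ≤ ∑ j ∈ T with k i ≤ k j, wt M (L j) (x - c j) := Finset.sum_nonneg fun j _ => wt_nonneg (hLp j) _
    have := hLp i
    refine (mul_le_mul_of_nonneg_left (pow_le_pow_left₀ hnn h1 n) hw).trans ?_
    generalize Ssum T c k s N y = S0 at hS ⊢
    calc wt M (L i) (x - c i) * ((1 + ‖x - y‖ / L i) ^ N * S0) ^ n
        ≤ wt M (L i) (x - c i) * ((((1 + d) * (1 + ‖x - c i‖ / L i))) ^ N * S0) ^ n := by gcongr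
      _ = ((1 + d) ^ (N * n) * S0 ^ n) * (wt M (L i) (x - c i) * (1 + ‖x - c i‖ / L i) ^ (N * n)) := by
          rw [mul_pow, mul_pow, mul_pow, ← pow_mul, ← pow_mul]; ring
      _ ≤ _ := by
          refine mul_le_mul_of_nonneg_left ?_ (by positivity)
          have e : wt M (L i) (x - c i) * (1 + ‖x - c i‖ / L i) ^ (N * n) = wt (N + (d+1)) (L i) (x - c i) := by
            unfold wt
            have hpos : (0:ℝ) < 1 + ‖x - c i‖ / L i := by positivity
            rw [show M = N * n + (N + (d+1)) by rw [hM]; ring, pow_add _ (N * n)]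
            field_simp
          rw [e]
          exact wt_anti (by omega) (hLp i) _
  have hterm : ∀ i ∈ T, ∫⁻ x, ENNReal.ofReal (wt M (L i) (x - c i) * (∑ j ∈ T with k i ≤ k j, wt M (L j) (x - c j)) ^ n) ≤ 
      ENNReal.ofReal ((1 + d) ^ (N * n) * C0 * ((2:ℝ) ^ s) ^ d) * ∫⁻ x in E i, ENNReal.ofReal (Ssum T c k s N x ^ n) := by
    intro i hi
    set J := ∫⁻ x, ENNReal.ofReal (wt M (L i) (x - c i) * (∑ j ∈ T with k i ≤ k j, wt M (L j) (x - c j)) ^ n) with hJ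
    have hy : ∀ y ∈ E i, J ≤ ENNReal.ofReal ((1 + d) ^ (N * n) * C0 * (L i) ^ d) * ENNReal.ofReal (Ssum T c k s N y ^ n) := by
      intro y hy
      have hS := Ssum_nonneg T c k s N y
      calc J ≤ ∫⁻ x, ENNReal.ofReal (((1 + d) ^ (N * n) * Ssum T c k s N y ^ n)) * ENNReal.ofReal (wt (d+1) (L i) (x - c i)) := by
            refine lintegral_mono fun x => ?_
            rw [← ENNReal.ofReal_mul (by positivity)]
            exact ENNReal.ofReal_le_ofReal (hpt i hi y hy x)
        _ = ENNReal.ofReal (((1 + d) ^ (N * n) * Ssum T c k s N y ^ n)) * ENNReal.ofReal (C0 * (L i) ^ d) := by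
            rw [lintegral_const_mul' _ _ ENNReal.ofReal_ne_top, hI _ (hLp i)]
        _ = _ := by
            have := hLp i
            rw [← ENNReal.ofReal_mul (by positivity), ← ENNReal.ofReal_mul (by positivity)]
            congr 1; ring
    have h1 : J * volume (E i) ≤ ENNReal.ofReal ((1 + d) ^ (N * n) * C0 * (L i) ^ d) * ∫⁻ y in E i, ENNReal.ofReal (Ssum T c k s N y ^ n) := by
      rw [← setLIntegral_const, ← lintegral_const_mul' _ _ ENNReal.ofReal_ne_top]
      exact setLIntegral_mono' (hT.meas i hi) hy
    rw [hT.vol i hi] at h1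
    have hv : ENNReal.ofReal (((2:ℝ) ^ (k i)) ^ d) ≠ 0 := by
      rw [Ne, ENNReal.ofReal_eq_zero, not_le]; positivity
    have e2 : ENNReal.ofReal ((1 + d) ^ (N * n) * C0 * (L i) ^ d) = 
       ENNReal.ofReal ((1 + d) ^ (N * n) * C0 * ((2:ℝ) ^ s) ^ d) * ENNReal.ofReal (((2:ℝ) ^ (k i)) ^ d) := by
      rw [← ENNReal.ofReal_mul (by positivity)]
      congr 1
      simp only [hL]; rw [pow_add, mul_pow]; ring
    rw [e2, mul_right_comm] at h1
    exact (ENNReal.mul_le_mul_iff_left hv ENNReal.ofReal_ne_top).1 h1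
  calc ∫⁻ x, ENNReal.ofReal (Ssum T c k s M x ^ (n+1)) 
      ≤ ∫⁻ x, ENNReal.ofReal (n+1) * ∑ i ∈ T, ENNReal.ofReal (wt M (L i) (x - c i) * (∑ j ∈ T with k i ≤ k j, wt M (L j) (x - c j)) ^ n) := by
        refine lintegral_mono fun x => ?_
        have hnn : ∀ i ∈ T, 0 ≤ wt M (L i) (x - c i) * (∑ j ∈ T with k i ≤ k j, wt M (L j) (x - c j)) ^ n := fun i _ =>
          mul_nonneg (wt_nonneg (hLp i) _) (pow_nonneg (Finset.sum_nonneg fun j _ => wt_nonneg (hLp j) _) _)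
        rw [← ENNReal.ofReal_sum_of_nonneg hnn, ← ENNReal.ofReal_mul (by positivity)]
        exact ENNReal.ofReal_le_ofReal (pow_sum_le T k (fun i => wt M (L i) (x - c i)) (fun i => wt_nonneg (hLp i) _) n)
    _ = ENNReal.ofReal (n+1) * ∑ i ∈ T, ∫⁻ x, ENNReal.ofReal (wt M (L i) (x - c i) * (∑ j ∈ T with k i ≤ k j, wt M (L j) (x - c j)) ^ n) := by
        rw [lintegral_const_mul' _ _ ENNReal.ofReal_ne_top, lintegral_finsetSum']
        intro i _
        refine (ENNReal.measurable_ofReal.comp ?_).aemeasurable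
        refine Continuous.measurable ?_
        refine ((wt_cont (hLp i)).comp (by fun_prop)).mul (Continuous.pow (continuous_finsetSum _ fun j _ => ?_) n)
        exact (wt_cont (hLp j)).comp (by fun_prop)
    _ ≤ ENNReal.ofReal (n+1) * ∑ i ∈ T, ENNReal.ofReal ((1 + d) ^ (N * n) * C0 * ((2:ℝ) ^ s) ^ d) * ∫⁻ x in E i, ENNReal.ofReal (Ssum T c k s N x ^ n) := by
        gcongr with i hi
        exact hterm i hi
    _ = _ := by
        rw [← Finset.mul_sum, ← mul_assoc, ← ENNReal.ofReal_mul (by positivity)]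
        congr 2; ring

lemma Ssum_pow (d n : ℕ) : ∃ (N : ℕ) (C : ℝ), 0 ≤ C ∧ ∀ {ι : Type} [DecidableEq ι] (T : Finset ι) (E : ι → Set (Euc d)) 
    (c : ι → Euc d) (k : ι → ℕ), CubeFam d T E c k → ∀ s : ℕ,
    ∫⁻ x, ENNReal.ofReal (Ssum T c k s N x ^ (n+1)) ≤ 
      ENNReal.ofReal (C * (((2:ℝ) ^ s) ^ d) ^ (n+1)) * ∑ i ∈ T, volume (E i) := by
  induction n with
  | zero =>
    obtain ⟨C, hC, h⟩ := Ssum_step d 0 0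
    refine ⟨_, C, hC, fun T E c k hT s => (h T E c k hT s).trans ?_⟩
    simp
  | succ n ih =>
    obtain ⟨N, C, hC, h⟩ := ih
    obtain ⟨C', hC', h'⟩ := Ssum_step d (n+1) N
    refine ⟨_, C' * C, by positivity, fun T E c k hT s => (h' T E c k hT s).trans ?_⟩
    have h1 : ∑ i ∈ T, ∫⁻ x in E i, ENNReal.ofReal (Ssum T c k s N x ^ (n+1)) ≤ ∫⁻ x, ENNReal.ofReal (Ssum T c k s N x ^ (n+1)) := by
      rw [← lintegral_biUnion_finset hT.disj hT.meas]
      exact setLIntegral_le_lintegral _ _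
    calc _ ≤ ENNReal.ofReal (C' * ((2:ℝ) ^ s) ^ d) * (ENNReal.ofReal (C * (((2:ℝ) ^ s) ^ d) ^ (n+1)) * ∑ i ∈ T, volume (E i)) := by
            gcongr
            exact h1.trans (h T E c k hT s)
      _ = _ := by
          rw [← mul_assoc, ← ENNReal.ofReal_mul (by positivity)]
          congr 2; ring

end PartN

section PartO

variable {d : ℕ}

/-- Input functions, one for each cube. -/
structure GData {ι : Type*} (T : Finset ι) (E : ι → Set (Euc d)) (g : ι → Euc d → ℂ) (A : ℝ) : Prop where
  integ : ∀ i ∈ T, Integrable (g i)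
  supp : ∀ i ∈ T, ∀ y ∉ E i, g i y = 0
  norm : ∀ i ∈ T, ∫ y, ‖g i y‖ ≤ A
  nonneg : 0 ≤ A

lemma GData.lnorm {ι : Type*} {T : Finset ι} {E : ι → Set (Euc d)} {g : ι → Euc d → ℂ} {A : ℝ} (h : GData T E g A)
    {i : ι} (hi : i ∈ T) : ∫⁻ y, ‖g i y‖ₑ ≤ ENNReal.ofReal A := by
  rw [← ofReal_integral_norm_eq_lintegral_enorm (h.integ i hi)]
  exact ENNReal.ofReal_le_ofReal (h.norm i hi)

/-- Convolution with a kernel. -/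
def Tconv (K g : Euc d → ℂ) (x : Euc d) : ℂ := ∫ y, K (x - y) * g y

lemma Tconv_cont {K g : Euc d → ℂ} (hK : Continuous K) {B : ℝ} (hB : ∀ x, ‖K x‖ ≤ B) (hg : Integrable g) :
    Continuous (Tconv K g) := by
  unfold Tconv
  refine continuous_of_dominated (bound := fun y => B * ‖g y‖) ?_ ?_ (hg.norm.const_mul B) ?_
  · intro x
    exact (Continuous.aestronglyMeasurable (by fun_prop)).mul hg.aestronglyMeasurable
  · intro x
    refine ae_of_all _ fun y => ?_
    rw [norm_mul]; gcongr; exact hB _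
  · exact ae_of_all _ fun y => by fun_prop

lemma Tconv_bdd {K g : Euc d → ℂ} {B : ℝ} (hB : ∀ x, ‖K x‖ ≤ B) (hg : Integrable g) (x : Euc d) :
    ‖Tconv K g x‖ ≤ B * ∫ y, ‖g y‖ := by
  unfold Tconv
  rw [← integral_const_mul]
  refine norm_integral_le_of_norm_le (hg.norm.const_mul B) (ae_of_all _ fun y => ?_)
  rw [norm_mul]; gcongr; exact hB _

lemma Tconv_fubini {K g b : Euc d → ℂ} (hK : Integrable K) (hg : Integrable g) (hb : Continuous b) {B : ℝ}
    (hB : ∀ x, ‖b x‖ ≤ B) : ∫ x, Tconv K g x * b x = ∫ y, g y * ∫ x, K (x - y) * b x := by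
  have h1 : Integrable (fun p : Euc d × Euc d => g p.2 * K (p.1 - p.2)) (volume.prod volume) := by
    have := Integrable.convolution_integrand (ContinuousLinearMap.mul ℝ ℂ) (μ := volume) (ν := volume) hg hK
    simpa using this
  have h2 : Integrable (fun p : Euc d × Euc d => (g p.2 * K (p.1 - p.2)) * b p.1) (volume.prod volume) :=
    h1.mul_bdd (c := B) (Continuous.aestronglyMeasurable (by fun_prop)) (ae_of_all _ fun p => hB _)
  have h3 := integral_integral_swap (f := fun x y => (g y * K (x - y)) * b x) h2
  calc ∫ x, Tconv K g x * b x = ∫ x, ∫ y, (g y * K (x - y)) * b x := by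
        congr 1; ext x
        unfold Tconv
        rw [← integral_mul_const]
        congr 1; ext y; ring
    _ = _ := h3
    _ = _ := by
        congr 1; ext y
        rw [← integral_const_mul]
        congr 1; ext x; ring

lemma wt_integrable {L : ℝ} (hL : 0 < L) : Integrable (wt (d := d) (d+1) L) := by
  obtain ⟨C, hC, h⟩ := wt_integral d
  rw [← lintegral_ofReal_ne_top_iff_integrable (wt_cont hL).aestronglyMeasurable (ae_of_all _ fun x => wt_nonneg hL x)]
  have := h L hL 0
  simp only [sub_zero] at this
  rw [this]; exact ENNReal.ofReal_ne_top

lemma KFam.le_wt {K : ℕ → Euc d → ℂ} (hK : KFam d K) (N : ℕ) : ∃ C : ℝ, 0 ≤ C ∧ ∀ ℓ x, ‖K ℓ x‖ ≤ C * wt N (2 ^ ℓ) x := by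
  obtain ⟨C, hC, h⟩ := hK.bound N
  refine ⟨C, hC, fun ℓ x => ?_⟩
  unfold wt
  rw [← div_eq_mul_inv, le_div_iff₀ (by positivity)]
  exact h ℓ x

lemma KFam.integ {K : ℕ → Euc d → ℂ} (hK : KFam d K) (ℓ : ℕ) : Integrable (K ℓ) := by
  obtain ⟨C, hC, h⟩ := hK.le_wt (d+1)
  exact Integrable.mono' ((wt_integrable (by positivity)).const_mul C) (hK.cont ℓ).aestronglyMeasurable (ae_of_all _ (h ℓ))

lemma KFam.bdd {K : ℕ → Euc d → ℂ} (hK : KFam d K) : ∃ B : ℝ, 0 ≤ B ∧ ∀ ℓ x, ‖K ℓ x‖ ≤ B := by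
  obtain ⟨C, hC, h⟩ := hK.bound 0
  exact ⟨C, hC, fun ℓ x => by simpa using h ℓ x⟩

lemma op_point {K : ℕ → Euc d → ℂ} (hK : KFam d K) (N : ℕ) : ∃ C : ℝ, 0 ≤ C ∧ ∀ {ι : Type} (T : Finset ι) (E : ι → Set (Euc d)) 
    (c : ι → Euc d) (k : ι → ℕ), CubeFam d T E c k → ∀ (s : ℕ) (g : ι → Euc d → ℂ) (A : ℝ), GData T E g A → ∀ x,
    (∀ i ∈ T, ‖Tconv (K (k i + s)) (g i) x‖ ≤ C * A * wt N (2 ^ (k i + s)) (x - c i)) ∧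
    ‖∑ i ∈ T, Tconv (K (k i + s)) (g i) x‖ ≤ C * A * Ssum T c k s N x := by
  obtain ⟨C, hC, h⟩ := hK.le_wt N
  refine ⟨C * (1 + d) ^ N, by positivity, ?_⟩
  intro ι T E c k hT s g A hg x
  have hmain : ∀ i ∈ T, ‖Tconv (K (k i + s)) (g i) x‖ ≤ C * (1 + d) ^ N * A * wt N (2 ^ (k i + s)) (x - c i) := by
    intro i hi
    set L : ℝ := 2 ^ (k i + s) with hL
    have hLp : 0 < L := by positivity
    have hw := wt_nonneg (N := N) hLp (x - c i)
    have hb : ∀ y, ‖K (k i + s) (x - y) * g i y‖ ≤ (C * (1 + d) ^ N * wt N L (x - c i)) * ‖g i y‖ := by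
      intro y
      by_cases hy : y ∈ E i
      · rw [norm_mul]
        refine mul_le_mul_of_nonneg_right ?_ (norm_nonneg _)
        refine (h _ _).trans ?_
        rw [mul_assoc]
        refine mul_le_mul_of_nonneg_left ?_ hC
        have h2 : 1 + ‖x - c i‖ / L ≤ (1 + d) * (1 + ‖x - y‖ / L) := by
          refine one_add_shift hLp ((hT.diam i hi _ (hT.cmem i hi) y hy).trans ?_)
          have : (2:ℝ) ^ (k i) ≤ L := pow_le_pow_right₀ (by norm_num) (by omega)
          gcongr
        unfold wt
        rw [← div_eq_mul_inv, le_div_iff₀ (by positivity), inv_mul_le_iff₀ (by positivity), ← mul_pow, mul_comm]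
        gcongr
      · rw [hg.supp i hi y hy]; simp
    have := norm_integral_le_of_norm_le ((hg.integ i hi).norm.const_mul _) (ae_of_all _ hb)
    rw [integral_const_mul] at this
    refine this.trans ?_
    calc _ ≤ (C * (1 + d) ^ N * wt N L (x - c i)) * A := mul_le_mul_of_nonneg_left (hg.norm i hi) (by positivity)
      _ = _ := by ring
  refine ⟨hmain, ?_⟩
  unfold Ssum
  rw [Finset.mul_sum]
  exact norm_sum_le_of_le _ hmain

lemma op_Ln {K : ℕ → Euc d → ℂ} (hK : KFam d K) (n : ℕ) : ∃ C : ℝ, 0 ≤ C ∧ ∀ {ι : Type} [DecidableEq ι] (T : Finset ι) (E : ι → Set (Euc d)) 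
    (c : ι → Euc d) (k : ι → ℕ), CubeFam d T E c k → ∀ (s : ℕ) (g : ι → Euc d → ℂ) (A : ℝ), GData T E g A → 
    ∫⁻ x, ‖∑ i ∈ T, Tconv (K (k i + s)) (g i) x‖ₑ ^ (n+1) ≤ 
      ENNReal.ofReal (C * (((2:ℝ) ^ s) ^ d) ^ (n+1) * A ^ (n+1)) * ∑ i ∈ T, volume (E i) := by
  obtain ⟨N, C1, hC1, h1⟩ := Ssum_pow d n
  obtain ⟨C2, hC2, h2⟩ := op_point hK N
  refine ⟨C2 ^ (n+1) * C1, by positivity, ?_⟩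
  intro ι _ T E c k hT s g A hg
  have hA := hg.nonneg
  calc _ ≤ ∫⁻ x, ENNReal.ofReal ((C2 * A) ^ (n+1)) * ENNReal.ofReal (Ssum T c k s N x ^ (n+1)) := by
        refine lintegral_mono fun x => ?_
        rw [← ENNReal.ofReal_mul (by positivity), ← mul_pow, ENNReal.ofReal_pow (mul_nonneg (by positivity) (Ssum_nonneg _ _ _ _ _ _)),
          ← ofReal_norm]
        gcongr
        exact (h2 T E c k hT s g A hg x).2
    _ = ENNReal.ofReal ((C2 * A) ^ (n+1)) * ∫⁻ x, ENNReal.ofReal (Ssum T c k s N x ^ (n+1)) := 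
        lintegral_const_mul' _ _ ENNReal.ofReal_ne_top
    _ ≤ ENNReal.ofReal ((C2 * A) ^ (n+1)) * (ENNReal.ofReal (C1 * (((2:ℝ) ^ s) ^ d) ^ (n+1)) * ∑ i ∈ T, volume (E i)) := by
        gcongr; exact h1 T E c k hT s
    _ = _ := by
        rw [← mul_assoc, ← ENNReal.ofReal_mul (by positivity)]
        congr 2; ring

/-- The weight for the `L²` estimate. -/
def Vw (ℓ : ℕ) (u : Euc d) : ℝ := (1 + ‖u‖) ^ (-(((d:ℝ) - 1) / 2)) * wt (d+1) (2 ^ ℓ) u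

lemma Vw_nonneg (ℓ : ℕ) (u : Euc d) : 0 ≤ Vw ℓ u := by
  unfold Vw
  have := wt_nonneg (N := d+1) (L := 2 ^ ℓ) (by positivity) u
  positivity

lemma Vw_integral (hd : 2 ≤ d) : ∃ C : ℝ, 0 ≤ C ∧ ∀ (ℓ : ℕ) (y : Euc d), 
    ∫⁻ z, ENNReal.ofReal (Vw ℓ (y - z)) ≤ ENNReal.ofReal (C * ((2:ℝ) ^ ℓ) ^ (((d:ℝ) + 1) / 2)) := by
  set a : ℝ := ((d:ℝ) - 1) / 2 with ha
  have hd' : (2:ℝ) ≤ d := by exact_mod_cast hd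
  have hap : 0 < a := by rw [ha]; linarith
  have : Nonempty (Fin d) := ⟨⟨0, by omega⟩⟩
  have : Nontrivial (Euc d) := inferInstance
  have hi : Integrable (fun v : Euc d => ‖v‖ ^ (-a) * wt (d+1) 1 v) := by
    have := (integrable_fun_norm_addHaar (E := Euc d) (volume : Measure (Euc d)) (f := fun r : ℝ => r ^ (-a) * ((1 + r / 1) ^ (d+1))⁻¹)).2 ?_
    · exact this
    · rw [finrank_euclideanSpace_fin]
      have h1 : Integrable (fun r : ℝ => (1 + ‖r‖) ^ (-(a + 2 : ℝ))) := 
        integrable_one_add_norm (E := ℝ) (by simp; linarith)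
      refine Integrable.mono' h1.integrableOn ?_ ?_
      · refine ContinuousOn.aestronglyMeasurable ?_ measurableSet_Ioi
        intro r hr
        have hr' : (0:ℝ) < r := hr
        refine ContinuousAt.continuousWithinAt ?_
        have : ContinuousAt (fun r : ℝ => r ^ (-a)) r := Real.continuousAt_rpow_const _ _ (Or.inl hr'.ne')
        have h3 : ContinuousAt (fun r : ℝ => ((1 + r / 1) ^ (d+1))⁻¹) r := by
          refine ContinuousAt.inv₀ (by fun_prop) (by positivity)
        simp only [smul_eq_mul]
        exact (continuousAt_id.pow _).mul (this.mul h3)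
      · refine (ae_restrict_mem measurableSet_Ioi).mono fun r hr => ?_
        have hr' : (0:ℝ) < r := hr
        rw [smul_eq_mul, Real.norm_of_nonneg (by positivity), Real.norm_of_nonneg hr'.le, div_one]
        have e1 : r ^ (d-1) * (r ^ (-a) * ((1 + r) ^ (d+1))⁻¹) = r ^ a * (1 + r) ^ (-((d:ℝ) + 1)) := by
          rw [← mul_assoc, ← Real.rpow_natCast r, ← Real.rpow_add hr']
          congr 1
          · congr 1; rw [Nat.cast_sub (by omega)]; rw [ha]; push_cast; ring
          · rw [Real.rpow_neg (by positivity)]; congr 1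
            exact_mod_cast (Real.rpow_natCast (1+r) (d+1)).symm
        rw [e1]
        calc r ^ a * (1 + r) ^ (-((d:ℝ) + 1)) ≤ (1 + r) ^ a * (1 + r) ^ (-((d:ℝ) + 1)) := by
              gcongr; linarith
          _ = (1 + r) ^ (-(a + 2)) := by
              rw [← Real.rpow_add (by positivity)]
              congr 1; rw [ha]; ring
  refine ⟨∫ v : Euc d, ‖v‖ ^ (-a) * wt (d+1) 1 v, integral_nonneg fun v => mul_nonneg (by positivity) (wt_nonneg one_pos v), fun ℓ y => ?_⟩
  set L : ℝ := 2 ^ ℓ with hL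
  have hLp : 0 < L := by positivity
  rw [lintegral_sub_left_eq_self (fun u => ENNReal.ofReal (Vw ℓ u)) y]
  have hi2 : Integrable (fun u : Euc d => (fun v : Euc d => ‖v‖ ^ (-a) * wt (d+1) 1 v) (L⁻¹ • u)) := hi.comp_smul (inv_ne_zero hLp.ne')
  have hi3 : Integrable (fun u : Euc d => L ^ (-a) * (fun v : Euc d => ‖v‖ ^ (-a) * wt (d+1) 1 v) (L⁻¹ • u)) := hi2.const_mul _
  have hle : ∀ u : Euc d, u ≠ 0 → Vw ℓ u ≤ L ^ (-a) * (fun v : Euc d => ‖v‖ ^ (-a) * wt (d+1) 1 v) (L⁻¹ • u) := by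
    intro u hu
    have hup : 0 < ‖u‖ := norm_pos_iff.2 hu
    have e : wt (d+1) 1 (L⁻¹ • u) = wt (d+1) L u := by
      simp only [wt, norm_smul, norm_inv, Real.norm_of_nonneg hLp.le, div_one]
      rw [inv_mul_eq_div]
    beta_reduce
    rw [e, norm_smul, norm_inv, Real.norm_of_nonneg hLp.le, ← mul_assoc, ← Real.mul_rpow hLp.le (by positivity), 
      mul_inv_cancel_left₀ hLp.ne']
    unfold Vw
    refine mul_le_mul_of_nonneg_right ?_ (wt_nonneg hLp u)
    exact Real.rpow_le_rpow_of_nonpos hup (by linarith) (by linarith)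
  calc _ ≤ ∫⁻ u : Euc d, ENNReal.ofReal (L ^ (-a) * (fun v : Euc d => ‖v‖ ^ (-a) * wt (d+1) 1 v) (L⁻¹ • u)) := by
        refine lintegral_mono_ae ?_
        have : ∀ᵐ u : Euc d, u ≠ 0 := by
          rw [ae_iff]; simp
        filter_upwards [this] with u hu
        exact ENNReal.ofReal_le_ofReal (hle u hu)
    _ = ENNReal.ofReal (∫ u : Euc d, L ^ (-a) * (fun v : Euc d => ‖v‖ ^ (-a) * wt (d+1) 1 v) (L⁻¹ • u)) := by
        rw [ofReal_integral_eq_lintegral_ofReal hi3]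
        refine ae_of_all _ fun u => mul_nonneg (by positivity) (mul_nonneg (by positivity) (wt_nonneg one_pos _))
    _ ≤ _ := by
        refine ENNReal.ofReal_le_ofReal (le_of_eq ?_)
        have hcs := Measure.integral_comp_smul (volume : Measure (Euc d)) (fun v : Euc d => ‖v‖ ^ (-a) * wt (d+1) 1 v) L⁻¹
        rw [integral_const_mul, hcs, finrank_euclideanSpace_fin, inv_pow, inv_inv, abs_of_pos (by positivity), smul_eq_mul,
          ← mul_assoc, mul_comm]
        congr 1
        rw [← Real.rpow_natCast L, ← Real.rpow_add hLp]
        congr 1; rw [ha]; ring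

end PartO

section PartP

variable {d : ℕ}

lemma Vw_cont (ℓ : ℕ) : Continuous (Vw (d := d) ℓ) := by
  unfold Vw
  have h1 : Continuous (wt (d := d) (d+1) (2 ^ ℓ)) := wt_cont (by positivity)
  refine Continuous.mul ?_ h1
  exact Continuous.rpow_const (by fun_prop) (fun u => Or.inl (by positivity))

lemma Vw_slow (hd : 2 ≤ d) {k' ℓ : ℕ} (hk : k' ≤ ℓ) {y y' z : Euc d} (h : ‖z - y'‖ ≤ d * 2 ^ k') :
    Vw ℓ (y - y') ≤ ((1 + d) ^ (((d:ℝ) - 1) / 2) * (1 + d) ^ (d+1)) * ((2:ℝ) ^ k') ^ (((d:ℝ) - 1) / 2) * Vw ℓ (y - z) := by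
  set a : ℝ := ((d:ℝ) - 1) / 2 with ha
  have hd' : (2:ℝ) ≤ d := by exact_mod_cast hd
  have hap : 0 < a := by rw [ha]; linarith
  set L : ℝ := 2 ^ ℓ with hL
  have hLp : 0 < L := by positivity
  have hk1 : (1:ℝ) ≤ 2 ^ k' := one_le_pow₀ (by norm_num)
  have hkL : (2:ℝ) ^ k' ≤ L := pow_le_pow_right₀ (by norm_num) hk
  have h1 : 1 + ‖y - z‖ ≤ ((1 + d) * 2 ^ k') * (1 + ‖y - y'‖) := by
    have e : y - z = (y - y') - (z - y') := by abel
    have h2 : ‖y - z‖ ≤ ‖y - y'‖ + d * 2 ^ k' := by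
      rw [e]; exact (norm_sub_le _ _).trans (by linarith)
    have h3 := norm_nonneg (y - y')
    generalize ‖y - y'‖ = t at *
    have h4 : t ≤ 2 ^ k' * t := le_mul_of_one_le_left h3 hk1
    have h5 : 0 ≤ d * (2 ^ k' * t) := by positivity
    nlinarith
  have h2 : 1 + ‖y - z‖ / L ≤ (1 + d) * (1 + ‖y - y'‖ / L) := 
    one_add_shift hLp (h.trans (by gcongr))
  have hA : (1 + ‖y - y'‖) ^ (-a) ≤ ((1 + d) ^ a * ((2:ℝ) ^ k') ^ a) * (1 + ‖y - z‖) ^ (-a) := by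
    rw [Real.rpow_neg (by positivity), Real.rpow_neg (by positivity), ← div_eq_mul_inv, le_div_iff₀ (by positivity), 
      inv_mul_le_iff₀ (by positivity), ← Real.mul_rpow (by positivity) (by positivity), ← Real.mul_rpow (by positivity) (by positivity), mul_comm (1 + ‖y - y'‖)]
    exact Real.rpow_le_rpow (by positivity) h1 hap.le
  have hB : wt (d+1) L (y - y') ≤ (1 + d) ^ (d+1) * wt (d+1) L (y - z) := by
    unfold wt
    rw [← div_eq_mul_inv, le_div_iff₀ (by positivity), inv_mul_le_iff₀ (by positivity), ← mul_pow, mul_comm (1 + ‖y - y'‖ / L)]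
    gcongr
  unfold Vw
  calc _ ≤ (((1 + d) ^ a * ((2:ℝ) ^ k') ^ a) * (1 + ‖y - z‖) ^ (-a)) * ((1 + d) ^ (d+1) * wt (d+1) L (y - z)) := by
        refine mul_le_mul hA hB (wt_nonneg hLp _) (by positivity)
    _ = _ := by ring

/-- Off-diagonal kernel estimate, averaged over the small cube. -/
lemma cross_avg (hd : 2 ≤ d) {K : ℕ → Euc d → ℂ} (hK : KFam d K) : ∃ C : ℝ, 0 ≤ C ∧ ∀ {ι : Type} (T : Finset ι) (E : ι → Set (Euc d)) 
    (c : ι → Euc d) (k : ι → ℕ), CubeFam d T E c k → ∀ s : ℕ, 1 ≤ s → ∀ i j, j ∈ T → k j ≤ k i → ∀ y, ∀ y' ∈ E j,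
    ‖∫ x, K (k i + s) (x - y) * (starRingEnd ℂ) (K (k j + s) (x - y'))‖ₑ ≤ 
      ENNReal.ofReal (C * ((2:ℝ) ^ (k i + s)) ^ (((d:ℝ) - 1) / 2) * ((2:ℝ) ^ s) ^ (((d:ℝ) + 1) / 2)) * 
        ∫⁻ z in E j, ENNReal.ofReal (Vw (k i + s) (y - z)) := by
  obtain ⟨C, hC, h⟩ := hK.cross (d+1)
  set B : ℝ := (1 + d) ^ (((d:ℝ) - 1) / 2) * (1 + d) ^ (d+1) with hB
  have hBp : 0 < B := by positivity
  refine ⟨C * B, by positivity, ?_⟩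
  intro ι T E c k hT s hs i j hj hij y y' hy'
  have h1 := h (k i + s) (k j + s) (by omega) (by omega) y y'
  set I := ∫ x, K (k i + s) (x - y) * (starRingEnd ℂ) (K (k j + s) (x - y')) with hI
  set P : ℝ := ((2:ℝ) ^ (k i + s)) ^ (((d:ℝ) - 1) / 2) with hP
  have hPp : 0 < P := by positivity
  have h2 : ‖I‖ ≤ C * P * ((2:ℝ) ^ (k j + s)) ^ (((d:ℝ) + 1) / 2) * Vw (k i + s) (y - y') := by
    unfold Vw wt
    rw [Real.rpow_neg (by positivity), ← mul_inv, ← div_eq_mul_inv, le_div_iff₀ (by positivity)]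
    calc _ = _ := by ring
      _ ≤ _ := h1
  have e1 : ((2:ℝ) ^ (k j + s)) ^ (((d:ℝ) + 1) / 2) * ((2:ℝ) ^ (k j)) ^ (((d:ℝ) - 1) / 2) = 
      ((2:ℝ) ^ s) ^ (((d:ℝ) + 1) / 2) * ((2:ℝ) ^ (k j)) ^ d := by
    rw [pow_add, Real.mul_rpow (by positivity) (by positivity), ← Real.rpow_natCast ((2:ℝ) ^ (k j)) d,
      show (d:ℝ) = ((d:ℝ) + 1) / 2 + ((d:ℝ) - 1) / 2 by ring, Real.rpow_add (by positivity)]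
    ring_nf
  have h3 : ∀ z ∈ E j, ‖I‖ₑ ≤ ENNReal.ofReal (C * B * P * ((2:ℝ) ^ s) ^ (((d:ℝ) + 1) / 2) * ((2:ℝ) ^ (k j)) ^ d) * ENNReal.ofReal (Vw (k i + s) (y - z)) := by
    intro z hz
    rw [← ENNReal.ofReal_mul (by positivity), ← ofReal_norm]
    refine ENNReal.ofReal_le_ofReal (h2.trans ?_)
    have h4 := Vw_slow hd (k' := k j) (ℓ := k i + s) (by omega) (y := y) (hT.diam j hj z hz y' hy')
    calc _ ≤ C * P * ((2:ℝ) ^ (k j + s)) ^ (((d:ℝ) + 1) / 2) * (B * ((2:ℝ) ^ (k j)) ^ (((d:ℝ) - 1) / 2) * Vw (k i + s) (y - z)) := 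
          mul_le_mul_of_nonneg_left h4 (by positivity)
      _ = C * B * P * (((2:ℝ) ^ (k j + s)) ^ (((d:ℝ) + 1) / 2) * ((2:ℝ) ^ (k j)) ^ (((d:ℝ) - 1) / 2)) * Vw (k i + s) (y - z) := by ring
      _ = _ := by rw [e1]; ring
  have h5 : ‖I‖ₑ * volume (E j) ≤ ENNReal.ofReal (C * B * P * ((2:ℝ) ^ s) ^ (((d:ℝ) + 1) / 2) * ((2:ℝ) ^ (k j)) ^ d) * 
      ∫⁻ z in E j, ENNReal.ofReal (Vw (k i + s) (y - z)) := by
    rw [← setLIntegral_const, ← lintegral_const_mul' _ _ ENNReal.ofReal_ne_top]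
    exact setLIntegral_mono' (hT.meas j hj) h3
  rw [hT.vol j hj, ENNReal.ofReal_mul (by positivity), mul_right_comm] at h5
  have hv : ENNReal.ofReal (((2:ℝ) ^ (k j)) ^ d) ≠ 0 := by
    rw [Ne, ENNReal.ofReal_eq_zero, not_le]; positivity
  exact (ENNReal.mul_le_mul_iff_left hv ENNReal.ofReal_ne_top).1 h5

lemma enorm_conj (z : ℂ) : ‖(starRingEnd ℂ) z‖ₑ = ‖z‖ₑ := by
  rw [← ofReal_norm, ← ofReal_norm, RCLike.norm_conj]

lemma pair_bound {K K' g g' : Euc d → ℂ} (hKc : Continuous K) (hK'c : Continuous K') (hK : Integrable K) (hK' : Integrable K')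
    {B B' : ℝ} (hB : ∀ x, ‖K x‖ ≤ B) (hB' : ∀ x, ‖K' x‖ ≤ B') (hg : Integrable g) (hg' : Integrable g') :
    ‖∫ x, Tconv K g x * (starRingEnd ℂ) (Tconv K' g' x)‖ₑ ≤ 
      ∫⁻ y, ‖g y‖ₑ * ∫⁻ y', ‖g' y'‖ₑ * ‖∫ x, K (x - y) * (starRingEnd ℂ) (K' (x - y'))‖ₑ := by
  rw [Tconv_fubini hK hg (b := fun x => (starRingEnd ℂ) (Tconv K' g' x)) (Complex.continuous_conj.comp (Tconv_cont hK'c hB' hg'))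
    (B := B' * ∫ y, ‖g' y‖) (fun x => by rw [RCLike.norm_conj]; exact Tconv_bdd hB' hg' x)]
  refine (enorm_integral_le_lintegral_enorm _).trans (lintegral_mono fun y => ?_)
  rw [enorm_mul]
  gcongr
  have e1 : (∫ x, K (x - y) * (starRingEnd ℂ) (Tconv K' g' x)) = (starRingEnd ℂ) (∫ x, Tconv K' g' x * (starRingEnd ℂ) (K (x - y))) := by
    rw [← integral_conj]
    congr 1; ext x
    rw [map_mul, Complex.conj_conj, mul_comm]
  have hcc : Continuous (fun x => (starRingEnd ℂ) (K (x - y))) := Complex.continuous_conj.comp (hKc.comp (by fun_prop))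
  rw [e1, enorm_conj, Tconv_fubini hK' hg' hcc (B := B) (fun x => by rw [RCLike.norm_conj]; exact hB _)]
  refine (enorm_integral_le_lintegral_enorm _).trans (lintegral_mono fun y' => ?_)
  rw [enorm_mul]
  gcongr
  rw [← enorm_conj, ← integral_conj]
  refine le_of_eq ?_
  congr 2; ext x
  rw [map_mul, Complex.conj_conj, mul_comm]

end PartP

section PartQ

variable {d : ℕ}

lemma op_L2 (hd : 2 ≤ d) {K : ℕ → Euc d → ℂ} (hK : KFam d K) : ∃ C : ℝ, 0 ≤ C ∧ ∀ {ι : Type} [DecidableEq ι] (T : Finset ι) (E : ι → Set (Euc d)) 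
    (c : ι → Euc d) (k : ι → ℕ), CubeFam d T E c k → ∀ (s : ℕ), 1 ≤ s → ∀ (g : ι → Euc d → ℂ) (A : ℝ), GData T E g A → 
    ∫⁻ x, ‖∑ i ∈ T, Tconv (K (k i + s)) (g i) x‖ₑ ^ 2 ≤ 
      ENNReal.ofReal (C * ((2:ℝ) ^ s) ^ ((3 * (d:ℝ) + 1) / 2) * A ^ 2) * ∑ i ∈ T, volume (E i) := by
  obtain ⟨C1, hC1, h1⟩ := cross_avg hd hK
  obtain ⟨C2, hC2, h2⟩ := Vw_integral hd
  obtain ⟨C3, hC3, h3⟩ := op_point hK (d+1)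
  obtain ⟨B, hB0, hB⟩ := hK.bdd
  refine ⟨2 * (C1 * C2), by positivity, ?_⟩
  intro ι _ T E c k hT s hs g A hg
  have hA := hg.nonneg
  set t : ι → Euc d → ℂ := fun i => Tconv (K (k i + s)) (g i) with ht
  have htc : ∀ i ∈ T, Continuous (t i) := fun i hi => Tconv_cont (hK.cont _) (hB _) (hg.integ i hi)
  have hti : ∀ i ∈ T, Integrable (t i) := by
    intro i hi
    have hw : Integrable (fun x => wt (d+1) (2 ^ (k i + s)) (x - c i)) := (wt_integrable (d := d) (L := 2 ^ (k i + s)) (by positivity)).comp_sub_right (c i)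
    exact Integrable.mono' (hw.const_mul (C3 * A)) (htc i hi).aestronglyMeasurable 
      (ae_of_all _ fun x => (h3 T E c k hT s g A hg x).1 i hi)
  have htt : ∀ i ∈ T, ∀ j ∈ T, Integrable (fun x => t i x * (starRingEnd ℂ) (t j x)) := by
    intro i hi j hj
    refine (hti i hi).mul_bdd (c := B * ∫ y, ‖g j y‖) (Complex.continuous_conj.comp (htc j hj)).aestronglyMeasurable ?_
    exact ae_of_all _ fun x => by rw [RCLike.norm_conj]; exact Tconv_bdd (hB _) (hg.integ j hj) x
  set P : ι → ι → ℝ≥0∞ := fun i j => ‖∫ x, t i x * (starRingEnd ℂ) (t j x)‖ₑ with hP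
  have hPsymm : ∀ i j, P i j = P j i := by
    intro i j
    simp only [hP]
    rw [← enorm_conj, ← integral_conj]
    congr 2; ext x
    rw [map_mul, Complex.conj_conj, mul_comm]
  -- expand the square
  have hexp : ∫⁻ x, ‖∑ i ∈ T, t i x‖ₑ ^ 2 ≤ ∑ i ∈ T, ∑ j ∈ T, P i j := by
    have hpt : ∀ x, (((‖∑ i ∈ T, t i x‖ ^ 2 : ℝ)) : ℂ) = ∑ i ∈ T, ∑ j ∈ T, t i x * (starRingEnd ℂ) (t j x) := by
      intro x
      rw [← Finset.sum_mul_sum, ← map_sum, Complex.mul_conj, Complex.normSq_eq_norm_sq]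
    have hI : Integrable (fun x => ∑ i ∈ T, ∑ j ∈ T, t i x * (starRingEnd ℂ) (t j x)) :=
      integrable_finsetSum _ fun i hi => integrable_finsetSum _ fun j hj => htt i hi j hj
    have hI' : Integrable (fun x => ‖∑ i ∈ T, t i x‖ ^ 2) := by
      have := hI.norm
      refine this.congr (ae_of_all _ fun x => ?_)
      beta_reduce
      rw [← hpt, Complex.norm_real, Real.norm_of_nonneg (by positivity)]
    have e1 : ∫⁻ x, ‖∑ i ∈ T, t i x‖ₑ ^ 2 = ENNReal.ofReal (∫ x, ‖∑ i ∈ T, t i x‖ ^ 2) := by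
      rw [ofReal_integral_eq_lintegral_ofReal hI' (ae_of_all _ fun x => by positivity)]
      congr 1; ext x
      rw [ENNReal.ofReal_pow (norm_nonneg _), ofReal_norm]
    have e2 : ((∫ x, ‖∑ i ∈ T, t i x‖ ^ 2 : ℝ) : ℂ) = ∑ i ∈ T, ∑ j ∈ T, ∫ x, t i x * (starRingEnd ℂ) (t j x) := by
      rw [← integral_complex_ofReal]
      simp only [hpt]
      rw [integral_finsetSum _ fun i hi => integrable_finsetSum _ fun j hj => htt i hi j hj]
      refine Finset.sum_congr rfl fun i hi => ?_
      rw [integral_finsetSum _ fun j hj => htt i hi j hj]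
    have e3 : ENNReal.ofReal (∫ x, ‖∑ i ∈ T, t i x‖ ^ 2) = ‖((∫ x, ‖∑ i ∈ T, t i x‖ ^ 2 : ℝ) : ℂ)‖ₑ := by
      rw [← ofReal_norm, Complex.norm_real, Real.norm_of_nonneg (integral_nonneg fun x => by positivity)]
    rw [e1, e3, e2]
    refine (enorm_sum_le _ _).trans (Finset.sum_le_sum fun i _ => enorm_sum_le _ _)
  -- order the pairs
  have hord : ∑ i ∈ T, ∑ j ∈ T, P i j ≤ 2 * ∑ i ∈ T, ∑ j ∈ T with k j ≤ k i, P i j := by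
    have a1 : ∑ i ∈ T, ∑ j ∈ T, P i j ≤ ∑ i ∈ T, ∑ j ∈ T, ((if k j ≤ k i then P i j else 0) + (if k i ≤ k j then P j i else 0)) := by
      refine Finset.sum_le_sum fun i _ => Finset.sum_le_sum fun j _ => ?_
      rcases le_total (k j) (k i) with h | h
      · rw [if_pos h]; exact le_self_add
      · rw [if_pos h, hPsymm i j]; exact le_add_self
    refine a1.trans (le_of_eq ?_)
    simp only [Finset.sum_add_distrib]
    rw [Finset.sum_comm (f := fun i j => if k i ≤ k j then P j i else 0), two_mul]
    simp only [Finset.sum_filter]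
  have hrow : ∀ i ∈ T, ∑ j ∈ T with k j ≤ k i, P i j ≤ ENNReal.ofReal ((C1 * C2) * ((2:ℝ) ^ s) ^ ((3 * (d:ℝ) + 1) / 2) * A ^ 2) * volume (E i) := by
    intro i hi
    set L : ℝ := 2 ^ (k i + s) with hL
    have hLp : 0 < L := by positivity
    set D : ℝ := C1 * L ^ (((d:ℝ) - 1) / 2) * ((2:ℝ) ^ s) ^ (((d:ℝ) + 1) / 2) with hD
    have hD0 : 0 ≤ D := by positivity
    have hPij : ∀ j ∈ T.filter (fun j => k j ≤ k i), P i j ≤ ∫⁻ y, ‖g i y‖ₑ * (ENNReal.ofReal (A * D) * ∫⁻ z in E j, ENNReal.ofReal (Vw (k i + s) (y - z))) := by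
      intro j hj
      obtain ⟨hj, hji⟩ := Finset.mem_filter.1 hj
      refine (pair_bound (hK.cont _) (hK.cont _) (hK.integ _) (hK.integ _) (hB _) (hB _) (hg.integ i hi) (hg.integ j hj)).trans ?_
      refine lintegral_mono fun y => ?_
      gcongr
      set W := ∫⁻ z in E j, ENNReal.ofReal (Vw (k i + s) (y - z)) with hW
      calc _ ≤ ∫⁻ y', ‖g j y'‖ₑ * (ENNReal.ofReal D * W) := by
            refine lintegral_mono fun y' => ?_
            by_cases hy' : y' ∈ E j
            · gcongr
              exact h1 T E c k hT s hs i j hj hji y y' hy'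
            · rw [hg.supp j hj y' hy']; simp
        _ = (∫⁻ y', ‖g j y'‖ₑ) * (ENNReal.ofReal D * W) := 
            lintegral_mul_const'' _ (hg.integ j hj).aestronglyMeasurable.enorm
        _ ≤ ENNReal.ofReal A * (ENNReal.ofReal D * W) := by gcongr; exact hg.lnorm hj
        _ = _ := by rw [← mul_assoc, ← ENNReal.ofReal_mul hA]
    have hmeas : ∀ j, Measurable fun y => ∫⁻ z in E j, ENNReal.ofReal (Vw (k i + s) (y - z)) := by
      intro j
      have hm : Measurable fun p : Euc d × Euc d => ENNReal.ofReal (Vw (k i + s) (p.1 - p.2)) :=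
        ENNReal.measurable_ofReal.comp ((Vw_cont _).comp (by fun_prop : Continuous fun p : Euc d × Euc d => p.1 - p.2)).measurable
      exact hm.lintegral_prod_right' (ν := volume.restrict (E j))
    calc _ ≤ ∑ j ∈ T with k j ≤ k i, ∫⁻ y, ‖g i y‖ₑ * (ENNReal.ofReal (A * D) * ∫⁻ z in E j, ENNReal.ofReal (Vw (k i + s) (y - z))) :=
          Finset.sum_le_sum hPij
      _ = ∫⁻ y, ∑ j ∈ T with k j ≤ k i, ‖g i y‖ₑ * (ENNReal.ofReal (A * D) * ∫⁻ z in E j, ENNReal.ofReal (Vw (k i + s) (y - z))) := by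
          rw [lintegral_finsetSum']
          intro j _
          exact (hg.integ i hi).aestronglyMeasurable.enorm.mul ((hmeas j).const_mul _).aemeasurable
      _ ≤ ∫⁻ y, ‖g i y‖ₑ * (ENNReal.ofReal (A * D) * ENNReal.ofReal (C2 * L ^ (((d:ℝ) + 1) / 2))) := by
          refine lintegral_mono fun y => ?_
          beta_reduce
          rw [← Finset.mul_sum, ← Finset.mul_sum]
          gcongr
          rw [← lintegral_biUnion_finset (hT.disj.subset (Finset.filter_subset _ T)) (fun j hj => hT.meas j (Finset.mem_filter.1 hj).1)]
          exact (setLIntegral_le_lintegral _ _).trans (h2 _ _)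
      _ = (∫⁻ y, ‖g i y‖ₑ) * (ENNReal.ofReal (A * D) * ENNReal.ofReal (C2 * L ^ (((d:ℝ) + 1) / 2))) :=
            lintegral_mul_const'' _ (hg.integ i hi).aestronglyMeasurable.enorm
      _ ≤ ENNReal.ofReal A * (ENNReal.ofReal (A * D) * ENNReal.ofReal (C2 * L ^ (((d:ℝ) + 1) / 2))) := by
            gcongr; exact hg.lnorm hi
      _ = _ := by
          rw [hT.vol i hi, ← ENNReal.ofReal_mul (by positivity), ← ENNReal.ofReal_mul (by positivity), ← ENNReal.ofReal_mul (by positivity)]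
          congr 1
          have e1 : L ^ (((d:ℝ) - 1) / 2) * L ^ (((d:ℝ) + 1) / 2) = ((2:ℝ) ^ (k i)) ^ d * ((2:ℝ) ^ s) ^ (d:ℝ) := by
            rw [← Real.rpow_add hLp, Real.rpow_natCast, ← mul_pow, ← pow_add, ← Real.rpow_natCast L]
            congr 1; ring
          have e2 : ((2:ℝ) ^ s) ^ ((3 * (d:ℝ) + 1) / 2) = ((2:ℝ) ^ s) ^ (d:ℝ) * ((2:ℝ) ^ s) ^ (((d:ℝ) + 1) / 2) := by
            rw [← Real.rpow_add (by positivity)]; congr 1; ring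
          rw [e2]
          calc _ = A ^ 2 * C1 * C2 * ((2:ℝ) ^ s) ^ (((d:ℝ) + 1) / 2) * (L ^ (((d:ℝ) - 1) / 2) * L ^ (((d:ℝ) + 1) / 2)) := by
                rw [hD]; ring
            _ = _ := by rw [e1]; ring
  refine hexp.trans (hord.trans ?_)
  calc _ ≤ 2 * ∑ i ∈ T, ENNReal.ofReal ((C1 * C2) * ((2:ℝ) ^ s) ^ ((3 * (d:ℝ) + 1) / 2) * A ^ 2) * volume (E i) := by
        gcongr with i hi; exact hrow i hi
    _ = _ := by
        rw [← Finset.mul_sum, ← mul_assoc]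
        congr 1
        rw [show (2:ℝ≥0∞) = ENNReal.ofReal 2 by simp, ← ENNReal.ofReal_mul (by norm_num)]
        congr 1; ring

end PartQ

section PartR

variable {d : ℕ}

lemma cube_side {Q : DyadicCube d} (h : 0 ≤ Q.k) : (2:ℝ) ^ Q.k = (2:ℝ) ^ Q.k.toNat := by
  conv_lhs => rw [← Int.toNat_of_nonneg h]
  rw [zpow_natCast]

lemma cube_meas (Q : DyadicCube d) : MeasurableSet Q.set := by
  have : Q.set = ⋂ i, (fun x : Euc d => x i) ⁻¹' (Set.Ico ((2:ℝ)^Q.k*(Q.m i:ℝ)) ((2:ℝ)^Q.k*((Q.m i:ℝ)+1))) := by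
    ext x; simp [DyadicCube.set]
  rw [this]
  refine MeasurableSet.iInter fun i => ?_
  exact measurableSet_Ico.preimage (by fun_prop)

lemma cube_vol {Q : DyadicCube d} (h : 0 ≤ Q.k) :
    volume Q.set = ENNReal.ofReal (((2:ℝ) ^ Q.k.toNat) ^ d) := by
  have hpre : (WithLp.toLp 2 : (Fin d → ℝ) → Euc d) ⁻¹' Q.set =
      Set.pi Set.univ fun i => Set.Ico ((2:ℝ)^Q.k*(Q.m i:ℝ)) ((2:ℝ)^Q.k*((Q.m i:ℝ)+1)) := by
    ext x; simp [DyadicCube.set]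
  rw [← (PiLp.volume_preserving_toLp (Fin d)).measure_preimage (cube_meas Q).nullMeasurableSet, hpre,
    Real.volume_pi_Ico]
  have : ∀ i : Fin d, ENNReal.ofReal ((2:ℝ)^Q.k*((Q.m i:ℝ)+1) - (2:ℝ)^Q.k*(Q.m i:ℝ)) =
      ENNReal.ofReal ((2:ℝ) ^ Q.k.toNat) := by
    intro i
    rw [← cube_side h]; congr 1; ring
  simp only [this, Finset.prod_const, Finset.card_univ, Fintype.card_fin]
  rw [ENNReal.ofReal_pow (by positivity) d]

lemma cube_fam (𝔔 : Finset (DyadicCube d)) (h0 : ∀ Q ∈ 𝔔, 0 ≤ Q.k)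
    (hdis : (𝔔 : Set (DyadicCube d)).Pairwise fun Q Q' => Disjoint Q.set Q'.set) :
    CubeFam d 𝔔 (fun Q => Q.set) (fun Q => WithLp.toLp 2 fun i => (2:ℝ)^Q.k * (Q.m i : ℝ))
      (fun Q => Q.k.toNat) where
  meas := fun Q _ => cube_meas Q
  vol := fun Q hQ => cube_vol (h0 Q hQ)
  cmem := by
    intro Q _ i
    have h2 : (0:ℝ) < (2:ℝ)^Q.k := by positivity
    refine ⟨le_refl _, ?_⟩
    simp only
    nlinarith
  diam := by
    intro Q hQ y hy z hz
    have hi : ∀ i, |(y - z) i| ≤ (2:ℝ) ^ Q.k.toNat := by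
      intro i
      have h1 := hy i
      have h2 := hz i
      rw [cube_side (h0 Q hQ)] at h1 h2
      rw [Set.mem_Ico] at h1 h2
      rw [PiLp.sub_apply, abs_le]
      constructor <;> nlinarith [h1.1, h1.2, h2.1, h2.2]
    rw [EuclideanSpace.norm_eq]
    apply Real.sqrt_le_iff.2
    refine ⟨by positivity, ?_⟩
    have h3 : ∑ i, ‖(y - z) i‖ ^ 2 ≤ ∑ _i : Fin d, ((2:ℝ) ^ Q.k.toNat) ^ 2 := by
      refine Finset.sum_le_sum fun i _ => ?_
      rw [Real.norm_eq_abs]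
      exact pow_le_pow_left₀ (abs_nonneg _) (hi i) 2
    refine h3.trans ?_
    simp only [Finset.sum_const, Finset.card_univ, Fintype.card_fin, nsmul_eq_mul, mul_pow]
    refine mul_le_mul_of_nonneg_right ?_ (by positivity)
    have : d ≤ d ^ 2 := by nlinarith [Nat.zero_le d, Nat.le_self_pow (n := 2) (by norm_num) d]
    exact_mod_cast this
  disj := hdis

/-- Non-measurable inputs give the zero output. -/
lemma conv_nonmeas {k : Euc d → ℂ} (hk : Continuous k) (hz : (∀ x, k x = 0) ∨ ∀ᵐ x, k x ≠ 0)
    {g : Euc d → ℂ} (hg : ¬ AEStronglyMeasurable g volume) (x : Euc d) :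
    ∫ y, k (x - y) * g y = 0 := by
  rcases hz with hz | hz
  · simp [hz]
  · refine integral_undef fun hi => hg ?_
    have hz' : ∀ᵐ y, k (x - y) ≠ 0 :=
      (Measure.measurePreserving_sub_left (volume : Measure (Euc d)) x).quasiMeasurePreserving.ae hz
    have hinv : AEStronglyMeasurable (fun y => (k (x - y))⁻¹) volume := by
      have : Measurable (fun y => (k (x - y))⁻¹) :=
        (hk.comp (continuous_const.sub continuous_id)).measurable.inv
      exact this.aestronglyMeasurable
    refine (hinv.mul hi.aestronglyMeasurable).congr ?_
    filter_upwards [hz'] with y hy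
    simp [hy]

lemma interp_real {M S A b p e θ r : ℝ} (hM : 0 ≤ M) (hS : 0 < S) (hA : 0 ≤ A) (hθ0 : 0 ≤ θ) (hθ1 : θ ≤ 1)
    (hp : 0 ≤ p) (hr : r = 2 * θ + p * (1 - θ)) :
    (M * S ^ b * A ^ (2:ℝ)) ^ θ * (M * S ^ e * A ^ p) ^ (1 - θ) =
      M * S ^ (b * θ + e * (1 - θ)) * A ^ r := by
  have h1 : 0 ≤ 1 - θ := by linarith
  have hM' : M ^ θ * M ^ (1 - θ) = M := by
    rw [← Real.rpow_add_of_nonneg hM hθ0 h1]; simp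
  rw [Real.mul_rpow (by positivity) (by positivity), Real.mul_rpow (by positivity) (by positivity),
    Real.mul_rpow (by positivity) (by positivity), Real.mul_rpow (by positivity) (by positivity),
    ← Real.rpow_mul hS.le, ← Real.rpow_mul hS.le, ← Real.rpow_mul hA, ← Real.rpow_mul hA,
    Real.rpow_add hS, hr, Real.rpow_add_of_nonneg hA (by positivity) (by positivity)]
  calc _ = (M ^ θ * M ^ (1 - θ)) * (S ^ (b * θ) * S ^ (e * (1 - θ))) * (A ^ (2 * θ) * A ^ (p * (1 - θ))) := by ring
    _ = _ := by rw [hM']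

lemma interp_eLp {G : Euc d → ℂ} (hG : Continuous G) {M S A b p e θ r : ℝ} {μ : ℝ≥0∞} (hM : 0 ≤ M) (hS : 0 < S)
    (hA : 0 ≤ A) (hθ0 : 0 ≤ θ) (hθ1 : θ ≤ 1)
    (hp : 0 ≤ p) (hr0 : 0 < r) (hr : r = 2 * θ + p * (1 - θ))
    (h2 : ∫⁻ x, ‖G x‖ₑ ^ (2:ℝ) ≤ ENNReal.ofReal (M * S ^ b * A ^ (2:ℝ)) * μ)
    (hpp : ∫⁻ x, ‖G x‖ₑ ^ p ≤ ENNReal.ofReal (M * S ^ e * A ^ p) * μ) :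
    eLpNorm G (ENNReal.ofReal r) volume ≤
      ENNReal.ofReal (M ^ (1 / r) * S ^ ((b * θ + e * (1 - θ)) / r)) * μ ^ (1 / r) * ENNReal.ofReal A := by
  have h1 : 0 ≤ 1 - θ := by linarith
  have hGm : Measurable fun x => ‖G x‖ₑ := hG.measurable.enorm
  have hX : ∫⁻ x, ‖G x‖ₑ ^ r ≤ ENNReal.ofReal (M * S ^ (b * θ + e * (1 - θ)) * A ^ r) * μ := by
    calc ∫⁻ x, ‖G x‖ₑ ^ r = ∫⁻ x, (‖G x‖ₑ ^ (2:ℝ)) ^ θ * (‖G x‖ₑ ^ p) ^ (1 - θ) := by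
          refine lintegral_congr fun x => ?_
          rw [← ENNReal.rpow_mul, ← ENNReal.rpow_mul, hr, ENNReal.rpow_add_of_nonneg _ _ (by positivity) (by positivity)]
      _ ≤ (∫⁻ x, ‖G x‖ₑ ^ (2:ℝ)) ^ θ * (∫⁻ x, ‖G x‖ₑ ^ p) ^ (1 - θ) :=
          ENNReal.lintegral_mul_norm_pow_le (hGm.pow_const _).aemeasurable (hGm.pow_const _).aemeasurable hθ0 h1 (by ring)
      _ ≤ (ENNReal.ofReal (M * S ^ b * A ^ (2:ℝ)) * μ) ^ θ * (ENNReal.ofReal (M * S ^ e * A ^ p) * μ) ^ (1 - θ) :=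
          mul_le_mul' (ENNReal.rpow_le_rpow h2 hθ0) (ENNReal.rpow_le_rpow hpp h1)
      _ = (ENNReal.ofReal ((M * S ^ b * A ^ (2:ℝ)) ^ θ) * ENNReal.ofReal ((M * S ^ e * A ^ p) ^ (1 - θ))) * (μ ^ θ * μ ^ (1 - θ)) := by
          rw [ENNReal.mul_rpow_of_nonneg _ _ hθ0, ENNReal.mul_rpow_of_nonneg _ _ h1,
            ENNReal.ofReal_rpow_of_nonneg (by positivity) hθ0, ENNReal.ofReal_rpow_of_nonneg (by positivity) h1]
          ring
      _ = _ := by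
          rw [← ENNReal.ofReal_mul (by positivity), interp_real hM hS hA hθ0 hθ1 hp hr,
            ← ENNReal.rpow_add_of_nonneg _ _ hθ0 h1]
          simp
  rw [eLpNorm_eq_lintegral_rpow_enorm_toReal (by simpa using hr0) ENNReal.ofReal_ne_top, ENNReal.toReal_ofReal hr0.le]
  refine (ENNReal.rpow_le_rpow hX (by positivity)).trans (le_of_eq ?_)
  rw [ENNReal.mul_rpow_of_nonneg _ _ (by positivity), ENNReal.ofReal_rpow_of_nonneg (by positivity) (by positivity),
    Real.mul_rpow (by positivity) (by positivity), Real.mul_rpow (by positivity) (by positivity),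
    ← Real.rpow_mul hS.le, ← Real.rpow_mul hA, mul_one_div, mul_one_div_cancel hr0.ne', Real.rpow_one,
    ENNReal.ofReal_mul (by positivity)]
  ring

end PartR

section PartS

variable {d : ℕ}

lemma exists_interp {r : ℝ} (hr : 1 < r) : ∃ (n : ℕ) (θ : ℝ), 0 < θ ∧ θ ≤ 1 ∧ r = 2 * θ + ((n:ℝ) + 1) * (1 - θ) := by
  rcases lt_or_ge r 2 with h | h
  · exact ⟨0, r - 1, by linarith, by linarith, by push_cast; ring⟩
  · have h1 := Nat.lt_floor_add_one r
    have h2 : 2 ≤ ⌊r⌋₊ := Nat.le_floor (by exact_mod_cast h)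
    have h3 : (2:ℝ) ≤ ⌊r⌋₊ := by exact_mod_cast h2
    have h4 : (0:ℝ) < (⌊r⌋₊:ℝ) + 1 - 2 := by linarith
    refine ⟨⌊r⌋₊, ((⌊r⌋₊:ℝ) + 1 - r) / ((⌊r⌋₊:ℝ) + 1 - 2), div_pos (by linarith) h4, (div_le_one h4).2 (by linarith), ?_⟩
    field_simp
    ring

lemma main_est (hd : 2 ≤ d) {K : ℕ → Euc d → ℂ} (hK : KFam d K) {r : ℝ} (hr : 1 < r) :
    ∃ ε C : ℝ, 0 < ε ∧ 0 < C ∧ ∀ {ι : Type} [DecidableEq ι] (T : Finset ι) (E : ι → Set (Euc d))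
      (c : ι → Euc d) (k : ι → ℕ), CubeFam d T E c k → ∀ (s : ℕ) (g : ι → Euc d → ℂ) (A : ℝ), GData T E g A →
      eLpNorm (fun x => ∑ i ∈ T, Tconv (K (k i + s)) (g i) x) (ENNReal.ofReal r) volume ≤
        ENNReal.ofReal (C * (2:ℝ) ^ ((s : ℝ) * ((d : ℝ) - ε))) * (∑ i ∈ T, volume (E i)) ^ (1 / r) * ENNReal.ofReal A := by
  obtain ⟨n, θ, hθ0, hθ1, hrθ⟩ := exists_interp hr
  obtain ⟨C1, hC1, h1⟩ := op_Ln hK 1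
  obtain ⟨Cn, hCn, hn⟩ := op_Ln hK n
  obtain ⟨C2, hC2, h2⟩ := op_L2 hd hK
  obtain ⟨B, hB0, hB⟩ := hK.bdd
  have hr0 : 0 < r := by linarith
  have hd' : (2:ℝ) ≤ d := by exact_mod_cast hd
  set M : ℝ := C1 + Cn + C2 + 1 with hMdef
  have hM : 0 < M := by positivity
  refine ⟨θ * ((d:ℝ) - 1) / (2 * r), M ^ (1 / r), div_pos (mul_pos hθ0 (by linarith)) (by positivity), by positivity, ?_⟩
  intro ι _ T E c k hT s g A hg
  have hA := hg.nonneg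
  set S : ℝ := (2:ℝ) ^ s with hSdef
  have hS : 0 < S := by positivity
  have hG : Continuous (fun x => ∑ i ∈ T, Tconv (K (k i + s)) (g i) x) :=
    continuous_finsetSum _ fun i hi => Tconv_cont (hK.cont _) (hB _) (hg.integ i hi)
  have b2 : ∫⁻ x, ‖∑ i ∈ T, Tconv (K (k i + s)) (g i) x‖ₑ ^ (2:ℝ) ≤
      ENNReal.ofReal (M * S ^ ((3 * (d:ℝ) + 1) / 2) * A ^ (2:ℝ)) * ∑ i ∈ T, volume (E i) := by
    simp only [ENNReal.rpow_two, Real.rpow_two]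
    rcases Nat.eq_zero_or_pos s with hs | hs
    · refine (h1 T E c k hT s g A hg).trans (mul_le_mul_left (ENNReal.ofReal_le_ofReal ?_) _)
      rw [hSdef, hs]
      simp only [pow_zero, one_pow, mul_one, Real.one_rpow]
      exact mul_le_mul_of_nonneg_right (by linarith) (by positivity)
    · refine (h2 T E c k hT s hs g A hg).trans (mul_le_mul_left (ENNReal.ofReal_le_ofReal ?_) _)
      rw [mul_assoc, mul_assoc]
      exact mul_le_mul_of_nonneg_right (by linarith) (by positivity)
  have bn : ∫⁻ x, ‖∑ i ∈ T, Tconv (K (k i + s)) (g i) x‖ₑ ^ ((n:ℝ) + 1) ≤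
      ENNReal.ofReal (M * S ^ ((d:ℝ) * ((n:ℝ) + 1)) * A ^ ((n:ℝ) + 1)) * ∑ i ∈ T, volume (E i) := by
    have e1 : ∀ x : ℝ≥0∞, x ^ ((n:ℝ) + 1) = x ^ (n + 1) := fun x => by
      rw [← ENNReal.rpow_natCast]; push_cast; rfl
    have e2 : ∀ x : ℝ, x ^ ((n:ℝ) + 1) = x ^ (n + 1) := fun x => by
      rw [← Real.rpow_natCast]; push_cast; rfl
    simp only [Real.rpow_mul hS.le, e1, e2, Real.rpow_natCast]
    refine (hn T E c k hT s g A hg).trans (mul_le_mul_left (ENNReal.ofReal_le_ofReal ?_) _)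
    rw [mul_assoc, mul_assoc]
    exact mul_le_mul_of_nonneg_right (by linarith) (by positivity)
  have key := interp_eLp hG hM.le hS hA hθ0.le hθ1 (by positivity) hr0 hrθ b2 bn
  refine key.trans (le_of_eq ?_)
  congr 4
  rw [hSdef, ← Real.rpow_natCast, ← Real.rpow_mul (by norm_num)]
  congr 2
  have : (3 * (d:ℝ) + 1) / 2 * θ + (d:ℝ) * ((n:ℝ) + 1) * (1 - θ) = d * r - θ * ((d:ℝ) - 1) / 2 := by
    rw [hrθ]; ring
  rw [this]
  field_simp

end PartS

/-- The `L¹`-based estimate for `𝒜_{s,𝔔}` with an `ε(r)`-gain. -/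
theorem AopSum_L1_eps_gain
    (d : ℕ) (hd : 2 ≤ d) (Ω : Set (Euc d)) (ρ : Euc d → ℝ)
    (hρ : IsMinkowskiGauge d Ω ρ) (hcurv : HasNonvanishingCurvature d ρ)
    (lam : ℝ) (hlam0 : 0 < lam) (hlam1 : lam ≤ ((d:ℝ) - 1) / 2)
    (N0 : ℕ) (hN0 : d < N0) (χ Φ Ψ : ℝ → ℝ) (hH : HData lam N0 χ Φ Ψ)
    (r : ℝ) (hr : 1 < r) :
    ∃ ε C : ℝ, 0 < ε ∧ 0 ≤ C ∧
      ∀ (s : ℕ) (𝔔 : Finset (DyadicCube d)),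
        (∀ Q ∈ 𝔔, 0 ≤ Q.k) →
        ((𝔔 : Set (DyadicCube d)).Pairwise fun Q Q' => Disjoint Q.set Q'.set) →
        ∀ F : DyadicCube d → Euc d → ℂ,
          eLpNorm (AopSum ρ (hfun χ Φ Ψ lam) lam s 𝔔 F) (ENNReal.ofReal r) volume ≤
            ENNReal.ofReal (C * (2:ℝ) ^ ((s : ℝ) * ((d : ℝ) - ε))) *
              dyadicMeasure 𝔔 ^ (1 / r) * supLp 1 𝔔 F := by
  classical
  obtain ⟨K, hK, hrep⟩ := exists_KFam hd hρ hcurv hlam0 hH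
  obtain ⟨ε, C, hε, hC, hmain⟩ := main_est hd hK hr
  refine ⟨ε, C, hε, hC.le, ?_⟩
  intro s 𝔔 h0 hdis F
  rcases 𝔔.eq_empty_or_nonempty with he | ⟨Q0, hQ0⟩
  · subst he
    have : AopSum ρ (hfun χ Φ Ψ lam) lam s (∅ : Finset (DyadicCube d)) F = 0 := by
      funext x; simp [AopSum]
    rw [this]; simp
  have hr0 : 0 < r := by linarith
  by_cases htop : supLp 1 𝔔 F = ⊤
  · have hpos : 0 < dyadicMeasure 𝔔 := by
      refine lt_of_lt_of_le ?_ (Finset.single_le_sum (f := fun Q : DyadicCube d => volume Q.set) (fun _ _ => zero_le) hQ0)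
      simp only [cube_vol (h0 Q0 hQ0)]
      exact ENNReal.ofReal_pos.2 (by positivity)
    rw [htop, ENNReal.mul_top]
    · exact le_top
    · refine mul_ne_zero ?_ ?_
      · exact (ENNReal.ofReal_pos.2 (by positivity)).ne'
      · intro h
        rcases ENNReal.rpow_eq_zero_iff.1 h with h | h
        · exact hpos.ne' h.1
        · have : 0 < 1 / r := by positivity
          linarith [h.2]
  set A : ℝ := (supLp 1 𝔔 F).toReal with hA
  set gg : DyadicCube d → Euc d → ℂ := fun Q =>
    if AEStronglyMeasurable (Q.set.indicator (F Q)) volume then Q.set.indicator (F Q) else 0 with hgg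
  have hlin : ∀ Q ∈ 𝔔, ∫⁻ y, ‖gg Q y‖ₑ ≤ supLp 1 𝔔 F := by
    intro Q hQ
    have h1 : eLpNorm (F Q) (ENNReal.ofReal 1) volume ≤ supLp 1 𝔔 F :=
      le_iSup₂ (f := fun Q (_ : Q ∈ 𝔔) => eLpNorm (F Q) (ENNReal.ofReal 1) volume) Q hQ
    refine le_trans ?_ h1
    rw [ENNReal.ofReal_one, eLpNorm_one_eq_lintegral_enorm]
    refine lintegral_mono fun y => ?_
    simp only [hgg]
    split_ifs
    · exact enorm_indicator_le_enorm_self _ _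
    · simp
  have hintg : ∀ Q ∈ 𝔔, Integrable (gg Q) := by
    intro Q hQ
    refine ⟨?_, lt_of_le_of_lt (hlin Q hQ) (lt_top_iff_ne_top.2 htop)⟩
    simp only [hgg]
    split_ifs with h
    · exact h
    · exact aestronglyMeasurable_zero
  have hG : GData 𝔔 (fun Q => Q.set) gg A := by
    refine ⟨hintg, ?_, ?_, ENNReal.toReal_nonneg⟩
    · intro Q hQ y hy
      simp only [hgg]
      split_ifs
      · exact Set.indicator_of_notMem hy _
      · rfl
    · intro Q hQ
      rw [integral_norm_eq_lintegral_enorm (hintg Q hQ).aestronglyMeasurable]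
      exact ENNReal.toReal_mono htop (hlin Q hQ)
  have hsum : AopSum ρ (hfun χ Φ Ψ lam) lam s 𝔔 F =
      fun x => ∑ Q ∈ 𝔔, Tconv (K (Q.k.toNat + s)) (gg Q) x := by
    funext x
    refine Finset.sum_congr rfl fun Q hQ => ?_
    rw [hrep]
    by_cases h : AEStronglyMeasurable (Q.set.indicator (F Q)) volume
    · simp only [hgg, if_pos h, Tconv]
    · rw [conv_nonmeas (hK.cont _) (hK.zero_or _) h]
      simp [hgg, if_neg h, Tconv]
  have := hmain 𝔔 (fun Q => Q.set) _ (fun Q => Q.k.toNat) (cube_fam 𝔔 h0 hdis) s gg A hG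
  rw [hsum]
  rw [hA, ENNReal.ofReal_toReal htop] at this
  exact this
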